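/- Let K ⊂ ℂⁿ be a compact set and f : K → ℂ continuous. If f belongs to the Gonchar class R(K), i.e. liminf_{k→∞} ρ_k(f,K)^{1/k} < 1, where ρ_k(f,K) = inf_{r_k} max_{z∈K} |f(z) − r_k(z)| with the infimum over all rational functions r_k of degree at most k in n complex variables, then the graph Γ_f = {(z, f(z)) ∈ ℂ^{n+1} : z ∈ K} is a pluripolar subset of ℂ^{n+1}. -/

import Mathlib

open Filter Metric

noncomputable section

/-- A subharmonic function on `ℂ` with values in `[-∞, ∞)`: upper semicontinuous,
never `+∞`, and dominated on every closed disk by every continuous function which is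
harmonic inside the disk and dominates it on the boundary circle. -/
def SubharmonicFn (u : ℂ → EReal) : Prop :=
  UpperSemicontinuous u ∧ (∀ z, u z ≠ ⊤) ∧
  ∀ (c : ℂ) (r : ℝ), 0 < r →
    ∀ h : ℂ → ℝ, ContinuousOn h (closedBall c r) →
      (∃ F : ℂ → ℂ, DifferentiableOn ℂ F (ball c r) ∧ ∀ z ∈ ball c r, h z = (F z).re) →
      (∀ z ∈ sphere c r, u z ≤ ((h z : ℝ) : EReal)) →
      ∀ z ∈ closedBall c r, u z ≤ ((h z : ℝ) : EReal)

/-- A plurisubharmonic function on a complex normed space: upper semicontinuous,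
never `+∞`, and subharmonic along every complex line. -/
def PshFn {E : Type*} [NormedAddCommGroup E] [NormedSpace ℂ E] (u : E → EReal) : Prop :=
  UpperSemicontinuous u ∧ (∀ z, u z ≠ ⊤) ∧
  ∀ a v : E, SubharmonicFn (fun w : ℂ => u (a + w • v))

/-- A set is pluripolar if it is contained in the `-∞` set of a plurisubharmonic
function which is not identically `-∞`. -/
def Pluripolar {E : Type*} [NormedAddCommGroup E] [NormedSpace ℂ E] (S : Set E) : Prop :=
  ∃ u : E → EReal, PshFn u ∧ (∃ z, u z ≠ ⊥) ∧ ∀ p ∈ S, u p = ⊥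

/-- `rhoMv f K k` : the deviation of the best uniform approximation of `f` on the
compact set `K ⊆ ℂⁿ` by rational functions of degree at most `k` in `n` complex
variables (quotients of polynomials of total degree at most `k`). -/
def rhoMv {n : ℕ} (f : (Fin n → ℂ) → ℂ) (K : Set (Fin n → ℂ)) (k : ℕ) : ℝ :=
  sInf {t : ℝ | ∃ p q : MvPolynomial (Fin n) ℂ,
    p.totalDegree ≤ k ∧ q.totalDegree ≤ k ∧
    (∀ z ∈ K, MvPolynomial.eval z q ≠ 0) ∧
    ∀ z ∈ K, ‖f z - MvPolynomial.eval z p / MvPolynomial.eval z q‖ ≤ t}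



section PiolaAlg
open Matrix
variable {k R : Type*} [CommRing k] [CommRing R] [Algebra k R] {N : ℕ}

theorem ma_der_prod (D : Derivation k R R) {ι : Type*} [DecidableEq ι] (s : Finset ι) (f : ι → R) :
    D (∏ i ∈ s, f i) = ∑ m ∈ s, ∏ i ∈ s, (if i = m then D (f i) else f i) := by
  induction s using Finset.induction_on with
  | empty => simp
  | insert a s ha ih =>
    rw [Finset.prod_insert ha, D.leibniz, ih, Finset.sum_insert ha, Finset.prod_insert ha]
    simp only [smul_eq_mul, if_true]
    rw [add_comm, mul_comm]
    congr 1
    · congr 1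
      apply Finset.prod_congr rfl
      intro i hi
      have h : i ≠ a := by rintro rfl; exact ha hi
      rw [if_neg h]
    · rw [Finset.mul_sum]
      apply Finset.sum_congr rfl
      intro m hm
      have h : a ≠ m := by rintro rfl; exact ha hm
      rw [Finset.prod_insert ha, if_neg h]

theorem ma_der_det (D : Derivation k R R) (A : Matrix (Fin N) (Fin N) R) :
    D A.det = ∑ m, (A.updateRow m (fun l => D (A m l))).det := by
  rw [← det_transpose]
  simp_rw [← det_transpose (updateRow _ _ _)]
  simp only [det_apply, transpose_apply, map_sum]
  rw [Finset.sum_comm]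
  apply Finset.sum_congr rfl
  intro σ _
  rw [← Finset.smul_sum, Units.smul_def, map_zsmul, ma_der_prod]
  congr 1
  apply Finset.sum_congr rfl
  intro m _
  apply Finset.prod_congr rfl
  intro i _
  rw [updateRow_apply]
  by_cases h : i = m
  · subst h; simp
  · simp [h]

theorem ma_det_updateRow_expand (A : Matrix (Fin N) (Fin N) R) (m : Fin N) (c : Fin N → R) :
    (A.updateRow m c).det = ∑ l, c l * (A.updateRow m (Pi.single l 1)).det := by
  have : c = ∑ l, c l • (Pi.single l (1:R) : Fin N → R) := by
    ext j; simp [Finset.sum_apply, Pi.single_apply]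
  conv_lhs => rw [this]
  have h2 := (detRowAlternating : (Fin N → R) [⋀^Fin N]→ₗ[R] R).map_update_sum Finset.univ m
    (fun l => c l • (Pi.single l (1:R) : Fin N → R)) (fun i => A i)
  refine h2.trans ?_
  apply Finset.sum_congr rfl
  intro l _
  exact det_updateRow_smul A m (c l) _

theorem ma_der_det' (D : Derivation k R R) (A : Matrix (Fin N) (Fin N) R) :
    D A.det = (adjugate A * A.map D).trace := by
  rw [ma_der_det, trace]
  simp only [diag_apply, mul_apply, map_apply]
  rw [Finset.sum_comm]
  apply Finset.sum_congr rfl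
  intro m _
  rw [ma_det_updateRow_expand]
  apply Finset.sum_congr rfl
  intro l _
  rw [adjugate_apply, mul_comm]

/-- Piola identity. -/
theorem ma_piola (d e : Fin N → Derivation k R R)
    (hde : ∀ i j x, d i (e j x) = e j (d i x)) (hee : ∀ i j x, e i (e j x) = e j (e i x))
    (v : R) (i : Fin N) :
    ∑ j, e j (adjugate (Matrix.of fun a b => d a (e b v)) j i) = 0 := by
  set M : Matrix (Fin N) (Fin N) R := Matrix.of fun a b => d a (e b v) with hM
  simp_rw [adjugate_apply, ma_der_det]
  rw [Finset.sum_comm]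
  apply Finset.sum_eq_zero
  intro m _
  by_cases hm : m = i
  · subst hm
    apply Finset.sum_eq_zero
    intro j _
    apply det_eq_zero_of_row_eq_zero m
    intro l
    rw [updateRow_self, updateRow_self]
    by_cases hl : l = j
    · subst hl; simp
    · simp [hl]
  · have key : ∀ j, ((M.updateRow i (Pi.single j 1)).updateRow m
        (fun l => e j ((M.updateRow i (Pi.single j 1)) m l))).det
        = ∑ l, e j (d m (e l v)) * ((M.updateRow i (Pi.single j 1)).updateRow m
          (Pi.single l 1)).det := by
      intro j
      rw [ma_det_updateRow_expand]
      apply Finset.sum_congr rfl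
      intro l _
      rw [updateRow_ne hm]
      rfl
    simp_rw [key]
    have anti : ∀ j l, ((M.updateRow i (Pi.single j 1)).updateRow m (Pi.single l (1:R))).det
        = - ((M.updateRow i (Pi.single l 1)).updateRow m (Pi.single j (1:R))).det := by
      intro j l
      have h1 : ∀ c : Fin N → R, ((M.updateRow i c).updateRow m c).det = 0 := by
        intro c
        apply det_zero_of_row_eq hm
        rw [updateRow_self, updateRow_ne (Ne.symm hm), updateRow_self]
      have h2 := h1 (Pi.single j 1 + Pi.single l 1)
      rw [det_updateRow_add] at h2
      have sw : ∀ c c' : Fin N → R, (M.updateRow i c).updateRow m c'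
          = (M.updateRow m c').updateRow i c := by
        intro c c'
        exact (Function.update_comm (Ne.symm hm) c c' M)
      rw [sw, sw, det_updateRow_add, det_updateRow_add, ← sw, ← sw, ← sw, ← sw, h1, h1] at h2
      linear_combination h2
    -- split the sum into an antisymmetric pairing
    have : ∀ (T Z : Fin N → Fin N → R), (∀ j l, T j l = T l j) → (∀ j l, Z j l = - Z l j) →
        (∀ j, Z j j = 0) → ∑ j, ∑ l, T j l * Z j l = 0 := by
      intro T Z hT hZ hZ0
      have h1 : ∑ p : Fin N × Fin N, T p.1 p.2 * Z p.1 p.2 = 0 := by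
        refine Finset.sum_involution (fun p _ => (p.2, p.1)) ?_ ?_ ?_ ?_
        · rintro ⟨j, l⟩ _
          simp only
          rw [hT l j, hZ l j]; ring
        · rintro ⟨j, l⟩ _ h hh
          simp only [Prod.mk.injEq] at hh
          apply h
          simp [hh.1, hZ0]
        · simp
        · simp
      rw [← h1, Fintype.sum_prod_type]
    apply this
    · intro j l
      rw [← hde, ← hde, hee]
    · exact anti
    · intro j
      apply det_zero_of_row_eq hm
      rw [updateRow_self, updateRow_ne (Ne.symm hm), updateRow_self]

theorem ma_piola' (d e : Fin N → Derivation k R R)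
    (hde : ∀ i j x, d i (e j x) = e j (d i x)) (hdd : ∀ i j x, d i (d j x) = d j (d i x))
    (v : R) (j : Fin N) :
    ∑ i, d i (adjugate (Matrix.of fun a b => d a (e b v)) j i) = 0 := by
  have h := ma_piola e d (fun i j x => (hde j i x).symm) hdd v j
  have hT : (Matrix.of fun a b => e a (d b v)) = (Matrix.of fun a b => d a (e b v))ᵀ := by
    ext a b; simp [hde]
  rw [hT, ← adjugate_transpose] at h
  exact h

end PiolaAlg


section MatPSD
open Matrix
open scoped ComplexOrder
variable {N : ℕ}

theorem ma_posDef_add (A : Matrix (Fin N) (Fin N) ℂ) (hA : A.PosSemidef) (ε : ℝ) (hε : 0 < ε) :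
    (A + (ε : ℂ) • (1 : Matrix (Fin N) (Fin N) ℂ)).PosDef := by
  apply PosDef.posSemidef_add hA
  exact PosDef.one.smul (by exact_mod_cast hε)

theorem ma_adj_posDef (A : Matrix (Fin N) (Fin N) ℂ) (hA : A.PosDef) : A.adjugate.PosSemidef := by
  have h1 : A.adjugate = A.det • A⁻¹ := by
    rw [Matrix.inv_def, smul_smul, Ring.mul_inverse_cancel _ hA.det_pos.ne'.isUnit, one_smul]
  rw [h1]
  exact hA.inv.posSemidef.smul hA.det_pos.le

theorem ma_adj_psd (A : Matrix (Fin N) (Fin N) ℂ) (hA : A.PosSemidef) :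
    A.adjugate.PosSemidef := by
  have hcont : Continuous fun ε : ℝ =>
      (A + (ε : ℂ) • (1 : Matrix (Fin N) (Fin N) ℂ)).adjugate := by
    apply Continuous.matrix_adjugate
    fun_prop
  apply PosSemidef.of_dotProduct_mulVec_nonneg
  · rw [IsHermitian, adjugate_conjTranspose, hA.isHermitian.eq]
  · intro x
    have h2 : Tendsto (fun ε : ℝ => star x ⬝ᵥ
        ((A + (ε : ℂ) • (1 : Matrix (Fin N) (Fin N) ℂ)).adjugate *ᵥ x)) (nhdsWithin 0 (Set.Ioi 0))
        (nhds (star x ⬝ᵥ (A.adjugate *ᵥ x))) := by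
      have : Continuous (fun ε : ℝ => star x ⬝ᵥ
        ((A + (ε : ℂ) • (1 : Matrix (Fin N) (Fin N) ℂ)).adjugate *ᵥ x)) :=
        Continuous.dotProduct continuous_const (hcont.matrix_mulVec continuous_const)
      have h3 := this.tendsto 0
      simp only [Complex.ofReal_zero, zero_smul, add_zero] at h3
      exact h3.mono_left nhdsWithin_le_nhds
    refine ge_of_tendsto h2 ?_
    filter_upwards [self_mem_nhdsWithin] with ε hε
    exact (ma_adj_posDef _ (ma_posDef_add A hA ε hε)).dotProduct_mulVec_nonneg x

open scoped MatrixOrder in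
theorem ma_psd_factor (B : Matrix (Fin N) (Fin N) ℂ) (hB : B.PosSemidef) :
    ∃ C : Matrix (Fin N) (Fin N) ℂ, B = Cᴴ * C :=
  CStarAlgebra.nonneg_iff_eq_star_mul_self.mp hB.nonneg

theorem ma_tr_nonneg (A B : Matrix (Fin N) (Fin N) ℂ) (hA : A.PosSemidef) (hB : B.PosSemidef) :
    0 ≤ (A * B).trace := by
  obtain ⟨C, rfl⟩ := ma_psd_factor B hB
  rw [← mul_assoc, trace_mul_comm, ← mul_assoc]
  exact (hA.mul_mul_conjTranspose_same C).trace_nonneg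

theorem ma_hasDerivAt_det (A B : Matrix (Fin N) (Fin N) ℂ) (t : ℝ) :
    HasDerivAt (fun t : ℝ => (A + (t : ℂ) • B).det)
      ((adjugate (A + (t : ℂ) • B) * B).trace) t := by
  set M : Matrix (Fin N) (Fin N) (Polynomial ℂ) :=
    A.map Polynomial.C + (Polynomial.X : Polynomial ℂ) • B.map Polynomial.C with hM
  have hev : ∀ z : ℂ, (Polynomial.evalRingHom z).mapMatrix M = A + z • B := by
    intro z
    ext i j
    simp [hM]
    ring
  have h1 : ∀ z : ℂ, (A + z • B).det = M.det.eval z := by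
    intro z
    rw [← hev z, ← RingHom.map_det]; rfl
  have hD : M.map (Polynomial.derivative' (R := ℂ)) = B.map Polynomial.C := by
    ext1 i j
    simp [hM, Polynomial.derivative']
  have h2 : (Polynomial.derivative M.det).eval (t : ℂ)
      = (adjugate (A + (t : ℂ) • B) * B).trace := by
    have h3 := ma_der_det' (Polynomial.derivative' (R := ℂ)) M
    rw [hD] at h3
    have h4 : Polynomial.derivative M.det = (M.adjugate * B.map Polynomial.C).trace := h3
    rw [h4, ← Polynomial.coe_evalRingHom, ← hev (t : ℂ), ← RingHom.map_adjugate]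
    simp only [trace, diag_apply, mul_apply, map_sum, map_mul, RingHom.mapMatrix_apply, map_apply]
    simp
  have h5 := (Polynomial.hasDerivAt M.det (t : ℂ)).comp_ofReal
  rw [h2] at h5
  refine h5.congr_of_eventuallyEq ?_
  exact Eventually.of_forall fun s => h1 s

theorem ma_psd_path (A B : Matrix (Fin N) (Fin N) ℂ) (hA : A.PosSemidef) (hB : B.PosSemidef)
    (t : ℝ) (ht : 0 ≤ t) : (A + (t : ℂ) • B).PosSemidef :=
  hA.add (hB.smul (by exact_mod_cast ht))

theorem ma_det_mono (A B : Matrix (Fin N) (Fin N) ℂ) (hA : A.PosSemidef) (hB : B.PosSemidef) :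
    A.det.re ≤ (A + B).det.re := by
  have hd : ∀ t : ℝ, HasDerivAt (fun t : ℝ => (A + (t : ℂ) • B).det.re)
      ((adjugate (A + (t : ℂ) • B) * B).trace.re) t := fun t =>
    (Complex.reCLM.hasFDerivAt.comp_hasDerivAt t (ma_hasDerivAt_det A B t))
  have hmono : MonotoneOn (fun t : ℝ => (A + (t : ℂ) • B).det.re) (Set.Icc 0 1) := by
    apply monotoneOn_of_deriv_nonneg (convex_Icc 0 1)
    · exact fun t _ => (hd t).continuousAt.continuousWithinAt
    · exact fun t _ => (hd t).differentiableAt.differentiableWithinAt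
    · intro t ht
      rw [interior_Icc] at ht
      rw [(hd t).deriv]
      have := ma_tr_nonneg _ _ (ma_adj_psd _ (ma_psd_path A B hA hB t ht.1.le)) hB
      exact (Complex.le_def.mp this).1
  have := hmono (Set.left_mem_Icc.mpr zero_le_one) (Set.right_mem_Icc.mpr zero_le_one) zero_le_one
  simpa using this

theorem ma_det_re_nonneg (A : Matrix (Fin N) (Fin N) ℂ) (hA : A.PosSemidef) : 0 ≤ A.det.re :=
  (Complex.le_def.mp hA.det_nonneg).1

theorem ma_det_path (A B : Matrix (Fin N) (Fin N) ℂ) (hA : A.PosSemidef)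
    (hAB : (A + B).PosSemidef) (t : ℝ) (h0 : 0 ≤ t) (h1 : t ≤ 1) :
    (1 - t) ^ N * A.det.re ≤ (A + (t : ℂ) • B).det.re := by
  have e1 : A + (t : ℂ) • B = ((1 - t : ℝ) : ℂ) • A + (t : ℂ) • (A + B) := by
    push_cast
    module
  have e2 : (((1 - t : ℝ) : ℂ) • A).det.re = (1 - t) ^ N * A.det.re := by
    rw [det_smul, Fintype.card_fin, ← Complex.ofReal_pow, Complex.re_ofReal_mul]
  rw [e1, ← e2]
  apply ma_det_mono
  · exact hA.smul (by exact_mod_cast sub_nonneg.mpr h1)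
  · exact hAB.smul (by exact_mod_cast h0)

theorem ma_psd_convex (A B : Matrix (Fin N) (Fin N) ℂ) (hA : A.PosSemidef)
    (hAB : (A + B).PosSemidef) (t : ℝ) (h0 : 0 ≤ t) (h1 : t ≤ 1) :
    (A + (t : ℂ) • B).PosSemidef := by
  have e1 : A + (t : ℂ) • B = ((1 - t : ℝ) : ℂ) • A + (t : ℂ) • (A + B) := by
    push_cast
    module
  rw [e1]
  exact (hA.smul (by exact_mod_cast sub_nonneg.mpr h1)).add (hAB.smul (by exact_mod_cast h0))

end MatPSD


section Wirt
open Matrix MeasureTheory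
open scoped ContDiff
variable {N : ℕ}

/-- algebra of smooth complex functions on `ℂ^N` -/
def SmA (N : ℕ) : Subalgebra ℂ ((Fin N → ℂ) → ℂ) where
  carrier := {g | ContDiff ℝ ∞ g}
  mul_mem' := by
    intro a b ha hb
    exact ContDiff.mul (show ContDiff ℝ ∞ a from ha) (show ContDiff ℝ ∞ b from hb)
  add_mem' := by
    intro a b ha hb
    exact ContDiff.add (show ContDiff ℝ ∞ a from ha) (show ContDiff ℝ ∞ b from hb)
  algebraMap_mem' := by
    intro r
    exact (contDiff_const : ContDiff ℝ ∞ (fun _ : Fin N → ℂ => r))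

theorem SmA.cd (g : SmA N) : ContDiff ℝ ∞ (g : (Fin N → ℂ) → ℂ) := g.2

theorem SmA.diff (g : SmA N) : Differentiable ℝ (g : (Fin N → ℂ) → ℂ) :=
  (SmA.cd g).differentiable (by simp)

theorem cd_fderiv_apply {F : Type*} [NormedAddCommGroup F] [NormedSpace ℝ F]
    {g : (Fin N → ℂ) → F} (hg : ContDiff ℝ ∞ g) (ξ : Fin N → ℂ) :
    ContDiff ℝ ∞ (fun x => fderiv ℝ g x ξ) :=
  (hg.fderiv_right (m := ∞) (by simp)).clm_apply contDiff_const

/-- directional derivative as a derivation -/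
def pd (ξ : Fin N → ℂ) : Derivation ℂ (SmA N) (SmA N) where
  toFun g := ⟨fun x => fderiv ℝ (g : (Fin N → ℂ) → ℂ) x ξ, cd_fderiv_apply g.2 ξ⟩
  map_add' f g := by
    ext x
    change fderiv ℝ ((f : (Fin N → ℂ) → ℂ) + (g : (Fin N → ℂ) → ℂ)) x ξ = _
    rw [fderiv_add (SmA.diff f x) (SmA.diff g x)]
    rfl
  map_smul' c g := by
    ext x
    change fderiv ℝ (c • (g : (Fin N → ℂ) → ℂ)) x ξ = _
    rw [fderiv_const_smul (SmA.diff g x)]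
    rfl
  map_one_eq_zero' := by
    ext x
    change fderiv ℝ (fun _ => (1:ℂ)) x ξ = 0
    simp
  leibniz' f g := by
    ext x
    change fderiv ℝ ((f : (Fin N → ℂ) → ℂ) * (g : (Fin N → ℂ) → ℂ)) x ξ = _
    rw [fderiv_mul (SmA.diff f x) (SmA.diff g x)]
    simp

theorem pd_apply (ξ : Fin N → ℂ) (g : SmA N) (x : Fin N → ℂ) :
    (pd ξ g : (Fin N → ℂ) → ℂ) x = fderiv ℝ (g : (Fin N → ℂ) → ℂ) x ξ := rfl

theorem fderiv_fderiv_comm {F : Type*} [NormedAddCommGroup F] [NormedSpace ℝ F]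
    {g : (Fin N → ℂ) → F} (hg : ContDiff ℝ ∞ g) (ξ η x : Fin N → ℂ) :
    fderiv ℝ (fun y => fderiv ℝ g y ξ) x η = fderiv ℝ (fun y => fderiv ℝ g y η) x ξ := by
  have hd : DifferentiableAt ℝ (fderiv ℝ g) x :=
    (hg.fderiv_right (m := ∞) (by simp)).differentiable (by simp) x
  have h : ∀ ζ, fderiv ℝ (fun y => fderiv ℝ g y ζ) x = (fderiv ℝ (fderiv ℝ g) x).flip ζ := by
    intro ζ
    exact (hd.hasFDerivAt.clm_apply (hasFDerivAt_const ζ x)).fderiv.trans (by ext; simp)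
  rw [h, h]
  have := (hg.contDiffAt (x := x)).isSymmSndFDerivAt (by simp only [minSmoothness_of_isRCLikeNormedField]; exact ENat.LEInfty.out)
  simp only [ContinuousLinearMap.flip_apply]
  exact this.eq η ξ

theorem pd_comm (ξ η : Fin N → ℂ) (g : SmA N) : pd ξ (pd η g) = pd η (pd ξ g) := by
  ext x
  exact fderiv_fderiv_comm g.2 η ξ x

def wd (j : Fin N) : Derivation ℂ (SmA N) (SmA N) :=
  (1/2 : ℂ) • (pd (Pi.single j 1) - Complex.I • pd (Pi.single j Complex.I))

def we (j : Fin N) : Derivation ℂ (SmA N) (SmA N) :=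
  (1/2 : ℂ) • (pd (Pi.single j 1) + Complex.I • pd (Pi.single j Complex.I))

theorem comb_comm (ξ η ξ' η' : Fin N → ℂ) (a b c e : ℂ) (g : SmA N) :
    (a • pd ξ + b • pd η) ((c • pd ξ' + e • pd η') g)
      = (c • pd ξ' + e • pd η') ((a • pd ξ + b • pd η) g) := by
  have h : ∀ (u u' v v' : Fin N → ℂ) (x y z w : ℂ), (x • pd u + y • pd v) ((z • pd u' + w • pd v') g)
      = (x * z) • pd u (pd u' g) + (x * w) • pd u (pd v' g)
        + ((y * z) • pd v (pd u' g) + (y * w) • pd v (pd v' g)) := by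
    intro u u' v v' x y z w
    have h1 : ∀ D : Derivation ℂ (SmA N) (SmA N), D ((z • pd u' + w • pd v') g)
      = z • D (pd u' g) + w • D (pd v' g) := by
      intro D
      change D (z • pd u' g + w • pd v' g) = _
      rw [D.map_add, D.map_smul, D.map_smul]
    have h2 : (x • pd u + y • pd v) ((z • pd u' + w • pd v') g)
      = x • pd u ((z • pd u' + w • pd v') g) + y • pd v ((z • pd u' + w • pd v') g) := rfl
    rw [h2, h1, h1]
    module
  rw [h, h, pd_comm ξ ξ', pd_comm ξ η', pd_comm η ξ', pd_comm η η', mul_comm a, mul_comm a,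
    mul_comm b, mul_comm b]
  abel

theorem wd_eq (j : Fin N) : wd j = (1/2 : ℂ) • pd (Pi.single j 1)
    + (-(1/2) * Complex.I) • pd (Pi.single j Complex.I) := by
  rw [wd]; module

theorem we_eq (j : Fin N) : we j = (1/2 : ℂ) • pd (Pi.single j 1)
    + ((1/2) * Complex.I) • pd (Pi.single j Complex.I) := by
  rw [we]; module

theorem wd_we (i j : Fin N) (g : SmA N) : wd i (we j g) = we j (wd i g) := by
  rw [wd_eq, we_eq]; exact comb_comm ..

theorem wd_wd (i j : Fin N) (g : SmA N) : wd i (wd j g) = wd j (wd i g) := by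
  rw [wd_eq, wd_eq]; exact comb_comm ..

theorem we_we (i j : Fin N) (g : SmA N) : we i (we j g) = we j (we i g) := by
  rw [we_eq, we_eq]; exact comb_comm ..

/-- integration by parts -/
theorem pd_ibp (ξ : Fin N → ℂ) (F G : SmA N) (hF : HasCompactSupport (F : (Fin N → ℂ) → ℂ)) :
    ∫ x, (F : (Fin N → ℂ) → ℂ) x * (pd ξ G : (Fin N → ℂ) → ℂ) x
      = - ∫ x, (pd ξ F : (Fin N → ℂ) → ℂ) x * (G : (Fin N → ℂ) → ℂ) x := by
  have hpF : HasCompactSupport (pd ξ F : (Fin N → ℂ) → ℂ) := hF.fderiv_apply ℝ ξ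
  apply integral_mul_fderiv_eq_neg_fderiv_mul_of_integrable
  · exact ((SmA.cd (pd ξ F)).continuous.mul (SmA.cd G).continuous).integrable_of_hasCompactSupport hpF.mul_right
  · exact ((SmA.cd F).continuous.mul (SmA.cd (pd ξ G)).continuous).integrable_of_hasCompactSupport hF.mul_right
  · exact ((SmA.cd F).continuous.mul (SmA.cd G).continuous).integrable_of_hasCompactSupport hF.mul_right
  · exact fun x _ => SmA.diff F x
  · exact fun x _ => SmA.diff G x

theorem SmA.int_mul (F G : SmA N) (hF : HasCompactSupport (F : (Fin N → ℂ) → ℂ)) :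
    Integrable (fun x => (F : (Fin N → ℂ) → ℂ) x * (G : (Fin N → ℂ) → ℂ) x) :=
  ((SmA.cd F).continuous.mul (SmA.cd G).continuous).integrable_of_hasCompactSupport hF.mul_right

theorem pd_cs (ξ : Fin N → ℂ) (F : SmA N) (hF : HasCompactSupport (F : (Fin N → ℂ) → ℂ)) :
    HasCompactSupport (pd ξ F : (Fin N → ℂ) → ℂ) := hF.fderiv_apply ℝ ξ

theorem comb_ibp (ξ η : Fin N → ℂ) (a b : ℂ) (F G : SmA N)
    (hF : HasCompactSupport (F : (Fin N → ℂ) → ℂ)) :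
    ∫ x, (F : (Fin N → ℂ) → ℂ) x * ((a • pd ξ + b • pd η) G : SmA N).1 x
      = - ∫ x, ((a • pd ξ + b • pd η) F : SmA N).1 x * (G : (Fin N → ℂ) → ℂ) x := by
  have e1 : ∀ x, (F : (Fin N → ℂ) → ℂ) x * ((a • pd ξ + b • pd η) G : SmA N).1 x
      = a * ((F : (Fin N → ℂ) → ℂ) x * (pd ξ G).1 x) + b * ((F : (Fin N → ℂ) → ℂ) x * (pd η G).1 x) := by
    intro x
    change F.1 x * (a * (pd ξ G).1 x + b * (pd η G).1 x) = _
    ring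
  have e2 : ∀ x, ((a • pd ξ + b • pd η) F : SmA N).1 x * (G : (Fin N → ℂ) → ℂ) x
      = a * ((pd ξ F).1 x * G.1 x) + b * ((pd η F).1 x * G.1 x) := by
    intro x
    change (a * (pd ξ F).1 x + b * (pd η F).1 x) * G.1 x = _
    ring
  simp_rw [e1, e2]
  rw [integral_add, integral_add, integral_const_mul, integral_const_mul, integral_const_mul,
    integral_const_mul, pd_ibp ξ F G hF, pd_ibp η F G hF]
  · ring
  · exact (SmA.int_mul (pd ξ F) G (pd_cs ξ F hF)).const_mul a
  · exact (SmA.int_mul (pd η F) G (pd_cs η F hF)).const_mul b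
  · exact (SmA.int_mul F _ hF).const_mul a
  · exact (SmA.int_mul F _ hF).const_mul b

theorem wd_ibp (j : Fin N) (F G : SmA N) (hF : HasCompactSupport (F : (Fin N → ℂ) → ℂ)) :
    ∫ x, F.1 x * (wd j G).1 x = - ∫ x, (wd j F).1 x * G.1 x := by
  rw [wd_eq]; exact comb_ibp _ _ _ _ F G hF

theorem we_ibp (j : Fin N) (F G : SmA N) (hF : HasCompactSupport (F : (Fin N → ℂ) → ℂ)) :
    ∫ x, F.1 x * (we j G).1 x = - ∫ x, (we j F).1 x * G.1 x := by
  rw [we_eq]; exact comb_ibp _ _ _ _ F G hF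

theorem we_cs (j : Fin N) (F : SmA N) (hF : HasCompactSupport (F : (Fin N → ℂ) → ℂ)) :
    HasCompactSupport (we j F).1 := by
  have h1 : (we j F).1 = fun x => (1/2 : ℂ) * ((pd (Pi.single j 1) F).1 x
    + Complex.I * (pd (Pi.single j Complex.I) F).1 x) := rfl
  rw [h1]
  have := ((pd_cs (Pi.single j 1) F hF).add (((pd_cs (Pi.single j Complex.I) F hF)).mul_left
    (f := fun _ => Complex.I)))
  exact this.mul_left (f := fun _ => (1/2 : ℂ))

/-- complex Hessian matrix with entries in the algebra of smooth functions -/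
def Hm (v : SmA N) : Matrix (Fin N) (Fin N) (SmA N) := Matrix.of fun a b => wd a (we b v)

def Lm (v g : SmA N) : SmA N := (adjugate (Hm v) * Hm g).trace

theorem Lm_eq (v g : SmA N) : Lm v g = ∑ j, ∑ i, adjugate (Hm v) j i * wd i (we j g) := by
  simp [Lm, trace, mul_apply, Hm]

theorem Lm_div1 (v g : SmA N) :
    Lm v g = ∑ j, we j (∑ i, adjugate (Hm v) j i * wd i g) := by
  have h := fun i => ma_piola (k := ℂ) (R := SmA N) wd we (fun i j g => wd_we i j g) (fun i j g => we_we i j g) v i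
  rw [Lm_eq]
  have h2 : ∀ j, we j (∑ i, adjugate (Hm v) j i * wd i g)
      = (∑ i, adjugate (Hm v) j i * wd i (we j g)) + ∑ i, wd i g * we j (adjugate (Hm v) j i) := by
    intro j
    rw [← Finset.sum_add_distrib]
    refine (map_sum (we j).toLinearMap _ _).trans (Finset.sum_congr rfl fun i _ => ?_)
    rw [wd_we]
    exact (we j).leibniz _ _
  rw [Finset.sum_congr rfl fun j _ => h2 j, Finset.sum_add_distrib, left_eq_add, Finset.sum_comm]
  rw [Finset.sum_congr rfl fun i _ => (Finset.mul_sum _ _ _).symm]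
  apply Finset.sum_eq_zero
  intro i _
  have := h i
  change ∑ j, we j (adjugate (Hm v) j i) = 0 at this
  rw [this, mul_zero]

theorem Lm_div2 (v g : SmA N) :
    Lm v g = ∑ i, wd i (∑ j, adjugate (Hm v) j i * we j g) := by
  have h := fun i => ma_piola' (k := ℂ) (R := SmA N) wd we (fun i j g => wd_we i j g) (fun i j g => wd_wd i j g) v i
  rw [Lm_eq, Finset.sum_comm]
  have h2 : ∀ i, wd i (∑ j, adjugate (Hm v) j i * we j g)
      = (∑ j, adjugate (Hm v) j i * wd i (we j g)) + ∑ j, we j g * wd i (adjugate (Hm v) j i) := by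
    intro j
    rw [← Finset.sum_add_distrib]
    refine (map_sum (wd j).toLinearMap _ _).trans (Finset.sum_congr rfl fun i _ => ?_)
    exact (wd j).leibniz _ _
  rw [Finset.sum_congr rfl fun j _ => h2 j, Finset.sum_add_distrib, left_eq_add, Finset.sum_comm]
  rw [Finset.sum_congr rfl fun i _ => (Finset.mul_sum _ _ _).symm]
  apply Finset.sum_eq_zero
  intro i _
  have := h i
  change ∑ j, wd j (adjugate (Hm v) i j) = 0 at this
  rw [this, mul_zero]

theorem SmA.sum_apply {ι : Type*} (s : Finset ι) (F : ι → SmA N) (x : Fin N → ℂ) :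
    (∑ i ∈ s, F i : SmA N).1 x = ∑ i ∈ s, (F i).1 x := by
  have : (∑ i ∈ s, F i : SmA N).1 = ∑ i ∈ s, (F i).1 := by
    exact map_sum (SmA N).val F s
  rw [this, Finset.sum_apply]

theorem SmA.mul_apply' (F G : SmA N) (x : Fin N → ℂ) : (F * G).1 x = F.1 x * G.1 x := rfl

theorem Lm_symm (v f g : SmA N) (hf : HasCompactSupport f.1) :
    ∫ x, f.1 x * (Lm v g).1 x = ∫ x, g.1 x * (Lm v f).1 x := by
  have h1 : ∫ x, f.1 x * (Lm v g).1 x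
      = - ∑ j, ∫ x, (we j f).1 x * (∑ i, adjugate (Hm v) j i * wd i g : SmA N).1 x := by
    rw [Lm_div1]
    simp_rw [SmA.sum_apply Finset.univ (fun j => we j _), Finset.mul_sum]
    rw [integral_finsetSum _ (fun j _ => SmA.int_mul f _ hf), ← Finset.sum_neg_distrib]
    exact Finset.sum_congr rfl fun j _ => we_ibp j f _ hf
  have hcs : ∀ i, HasCompactSupport (∑ j, adjugate (Hm v) j i * we j f : SmA N).1 := by
    intro i
    rw [hasCompactSupport_iff_eventuallyEq]
    have : ∀ j, (we j f).1 =ᶠ[coclosedCompact (Fin N → ℂ)] 0 := fun j =>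
      hasCompactSupport_iff_eventuallyEq.mp (we_cs j f hf)
    have h3 := eventually_all.mpr this
    filter_upwards [h3] with x hx
    rw [SmA.sum_apply]
    apply Finset.sum_eq_zero
    intro j _
    rw [SmA.mul_apply', hx j]; simp
  have h2 : ∫ x, g.1 x * (Lm v f).1 x
      = - ∑ i, ∫ x, (∑ j, adjugate (Hm v) j i * we j f : SmA N).1 x * (wd i g).1 x := by
    rw [Lm_div2]
    simp_rw [SmA.sum_apply Finset.univ (fun j => wd j _), Finset.mul_sum]
    have hcs' : ∀ i, HasCompactSupport (wd i (∑ j, adjugate (Hm v) j i * we j f)).1 := by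
      intro i
      rw [wd_eq]
      have a1 := (pd_cs (Pi.single i 1) _ (hcs i)).mul_left (f := fun _ => (1/2 : ℂ))
      have a2 := (pd_cs (Pi.single i Complex.I) _ (hcs i)).mul_left
        (f := fun _ => (-(1/2) * Complex.I : ℂ))
      exact a1.add a2
    rw [integral_finsetSum _ (fun i _ => by
      simp_rw [mul_comm (g.1 _)]
      exact SmA.int_mul _ g (hcs' i)), ← Finset.sum_neg_distrib]
    refine Finset.sum_congr rfl fun i _ => ?_
    rw [wd_ibp i _ g (hcs i), neg_neg]
    congr 1
    ext x; ring
  rw [h1, h2]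
  congr 1
  simp_rw [SmA.sum_apply Finset.univ, Finset.mul_sum, Finset.sum_mul, SmA.mul_apply']
  have hi : ∀ i j, Integrable (fun x => (we j f).1 x *
      ((adjugate (Hm v) j i).1 x * (wd i g).1 x)) := by
    intro i j
    have := SmA.int_mul (we j f) (adjugate (Hm v) j i * wd i g) (we_cs j f hf)
    exact this
  have hi' : ∀ i j, (fun x => (adjugate (Hm v) j i).1 x * (we j f).1 x * (wd i g).1 x)
      = (fun x => (we j f).1 x * ((adjugate (Hm v) j i).1 x * (wd i g).1 x)) := by
    intro i j; ext x; ring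
  have l1 : ∀ j, ∫ x, ∑ i, (we j f).1 x * ((adjugate (Hm v) j i).1 x * (wd i g).1 x)
      = ∑ i, ∫ x, (we j f).1 x * ((adjugate (Hm v) j i).1 x * (wd i g).1 x) :=
    fun j => integral_finsetSum _ (fun i _ => hi i j)
  have l2 : ∀ i, ∫ x, ∑ j, (adjugate (Hm v) j i).1 x * (we j f).1 x * (wd i g).1 x
      = ∑ j, ∫ x, (we j f).1 x * ((adjugate (Hm v) j i).1 x * (wd i g).1 x) := by
    intro i
    rw [integral_finsetSum _ (fun j _ => by rw [hi']; exact hi i j)]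
    exact Finset.sum_congr rfl fun j _ => by rw [hi']
  simp_rw [l1, l2]
  exact Finset.sum_comm

theorem Lm_prod (v f g : SmA N) : Lm v (f * g) = f * Lm v g + g * Lm v f
    + ∑ j, ∑ i, adjugate (Hm v) j i * (wd i f * we j g + wd i g * we j f) := by
  simp only [Lm_eq, Finset.mul_sum, ← Finset.sum_add_distrib]
  apply Finset.sum_congr rfl
  intro j _
  apply Finset.sum_congr rfl
  intro i _
  simp only [Derivation.leibniz, smul_eq_mul, map_add]
  ring

end Wirt


section RealMA
open Matrix MeasureTheory
open scoped ContDiff ComplexOrder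
variable {N : ℕ}

/-- second derivative of a real function -/
def D2 (u : (Fin N → ℂ) → ℝ) (x ξ η : Fin N → ℂ) : ℝ :=
  fderiv ℝ (fun y => fderiv ℝ u y ξ) x η

/-- complex Hessian associated to a real bilinear form -/
def hessB (B : (Fin N → ℂ) → (Fin N → ℂ) → ℝ) : Matrix (Fin N) (Fin N) ℂ :=
  Matrix.of fun a b => (1/4 : ℂ) *
    (((B (Pi.single a 1) (Pi.single b 1) + B (Pi.single a Complex.I) (Pi.single b Complex.I) : ℝ) : ℂ)
    + Complex.I * ((B (Pi.single a 1) (Pi.single b Complex.I)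
        - B (Pi.single a Complex.I) (Pi.single b 1) : ℝ) : ℂ))

def hess (u : (Fin N → ℂ) → ℝ) (x : Fin N → ℂ) : Matrix (Fin N) (Fin N) ℂ := hessB (D2 u x)

def MA (u : (Fin N → ℂ) → ℝ) (x : Fin N → ℂ) : ℝ := (hess u x).det.re

def Lr (v g : (Fin N → ℂ) → ℝ) (x : Fin N → ℂ) : ℝ := (adjugate (hess v x) * hess g x).trace.re

/-- complexification of a smooth real function -/
def cx (u : (Fin N → ℂ) → ℝ) (hu : ContDiff ℝ ∞ u) : SmA N :=
  ⟨fun x => (u x : ℂ), Complex.ofRealCLM.contDiff.comp hu⟩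

/-- evaluation -/
def evx (x : Fin N → ℂ) : SmA N →+* ℂ := (Pi.evalRingHom (fun _ => ℂ) x).comp (SmA N).val.toRingHom

theorem evx_apply (x : Fin N → ℂ) (g : SmA N) : evx x g = g.1 x := rfl

theorem fderiv_ofReal {u : (Fin N → ℂ) → ℝ} {x : Fin N → ℂ} (hu : DifferentiableAt ℝ u x)
    (ξ : Fin N → ℂ) : fderiv ℝ (fun y => (u y : ℂ)) x ξ = ((fderiv ℝ u x ξ : ℝ) : ℂ) := by
  have := (Complex.ofRealCLM.hasFDerivAt.comp x hu.hasFDerivAt).fderiv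
  have h2 : fderiv ℝ (fun y => (u y : ℂ)) x = Complex.ofRealCLM.comp (fderiv ℝ u x) := this
  rw [h2]; rfl

theorem cd_diff {F : Type*} [NormedAddCommGroup F] [NormedSpace ℝ F]
    {g : (Fin N → ℂ) → F} (hg : ContDiff ℝ ∞ g) : Differentiable ℝ g := hg.differentiable (by simp)

theorem pd_cx (u : (Fin N → ℂ) → ℝ) (hu : ContDiff ℝ ∞ u) (ξ : Fin N → ℂ) :
    pd ξ (cx u hu) = cx (fun x => fderiv ℝ u x ξ) (cd_fderiv_apply hu ξ) := by
  ext x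
  exact fderiv_ofReal (cd_diff hu x) ξ

theorem D2_comm {u : (Fin N → ℂ) → ℝ} (hu : ContDiff ℝ ∞ u) (x ξ η : Fin N → ℂ) :
    D2 u x ξ η = D2 u x η ξ := fderiv_fderiv_comm hu ξ η x

theorem Hm_cx (u : (Fin N → ℂ) → ℝ) (hu : ContDiff ℝ ∞ u) (x : Fin N → ℂ) :
    (Hm (cx u hu)).map (evx x) = hess u x := by
  ext a b
  simp only [Hm, map_apply, of_apply, hess, hessB]
  have h1 : we b (cx u hu) = (1/2 : ℂ) • pd (Pi.single b 1) (cx u hu)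
      + ((1/2) * Complex.I) • pd (Pi.single b Complex.I) (cx u hu) := by rw [we_eq]; rfl
  have h2 : ∀ g : SmA N, wd a g = (1/2 : ℂ) • pd (Pi.single a 1) g
      + (-(1/2) * Complex.I) • pd (Pi.single a Complex.I) g := by intro g; rw [wd_eq]; rfl
  rw [h2, h1]
  simp only [Derivation.map_add, Derivation.map_smul, pd_cx]
  have e : ∀ ξ η, evx x (cx (fun y => fderiv ℝ (fun y => fderiv ℝ u y ξ) y η)
      (cd_fderiv_apply (cd_fderiv_apply hu ξ) η)) = (D2 u x ξ η : ℂ) := fun ξ η => rfl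
  have sm : ∀ (c : ℂ) (g : SmA N), evx x (c • g) = c * evx x g := fun c g => rfl
  simp only [map_add, sm, e]
  rw [D2_comm hu x (Pi.single b 1) (Pi.single a 1), D2_comm hu x (Pi.single b 1),
    D2_comm hu x (Pi.single b Complex.I), D2_comm hu x (Pi.single b Complex.I)]
  push_cast
  linear_combination (-(1/4:ℂ) * (D2 u x (Pi.single a Complex.I) (Pi.single b Complex.I) : ℂ)) * Complex.I_sq

theorem Lm_cx (v g : (Fin N → ℂ) → ℝ) (hv : ContDiff ℝ ∞ v) (hg : ContDiff ℝ ∞ g) (x : Fin N → ℂ) :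
    (Lm (cx v hv) (cx g hg)).1 x = (adjugate (hess v x) * hess g x).trace := by
  rw [← Hm_cx v hv, ← Hm_cx g hg, ← evx_apply, Lm]
  have h : (adjugate (Hm (cx v hv))).map (evx x) = adjugate ((Hm (cx v hv)).map (evx x)) :=
    (RingHom.map_adjugate (evx x) _)
  rw [← h]
  have h2 := (Matrix.map_mul (L := adjugate (Hm (cx v hv))) (M := Hm (cx g hg)) (f := evx x)).symm
  rw [h2]
  rw [Matrix.trace, map_sum]
  rfl

theorem Lr_eq (v g : (Fin N → ℂ) → ℝ) (hv : ContDiff ℝ ∞ v) (hg : ContDiff ℝ ∞ g) (x : Fin N → ℂ) :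
    Lr v g x = ((Lm (cx v hv) (cx g hg)).1 x).re := by rw [Lm_cx]; rfl

theorem Lr_cont {v g : (Fin N → ℂ) → ℝ} (hv : ContDiff ℝ ∞ v) (hg : ContDiff ℝ ∞ g) :
    Continuous (Lr v g) := by
  have : Lr v g = fun x => ((Lm (cx v hv) (cx g hg)).1 x).re := by ext x; exact Lr_eq v g hv hg x
  rw [this]
  exact Complex.continuous_re.comp (SmA.cd _).continuous

theorem Lr_symm {v f g : (Fin N → ℂ) → ℝ} (hv : ContDiff ℝ ∞ v) (hf : ContDiff ℝ ∞ f)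
    (hg : ContDiff ℝ ∞ g) (hfs : HasCompactSupport f) :
    ∫ x, f x * Lr v g x = ∫ x, g x * Lr v f x := by
  have hs : HasCompactSupport (cx f hf).1 := hfs.comp_left (g := fun r : ℝ => (r : ℂ)) (by simp)
  have h := Lm_symm (cx v hv) (cx f hf) (cx g hg) hs
  have key : ∀ f g : (Fin N → ℂ) → ℝ, ∀ hf : ContDiff ℝ ∞ f, ∀ hg : ContDiff ℝ ∞ g,
      Integrable (fun x => (cx f hf).1 x * (Lm (cx v hv) (cx g hg)).1 x) →
      (∫ x, (cx f hf).1 x * (Lm (cx v hv) (cx g hg)).1 x).re = ∫ x, f x * Lr v g x := by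
    intro f g hf hg hi
    have := integral_re hi
    simp only [RCLike.re_eq_complex_re] at this
    rw [← this]
    congr 1; ext x
    rw [Lr_eq v g hv hg]
    exact Complex.re_ofReal_mul _ _
  rw [← key f g hf hg (SmA.int_mul _ _ hs), ← key g f hg hf, h]
  have hz : HasCompactSupport (Lm (cx v hv) (cx f hf)).1 := by
    rw [hasCompactSupport_iff_eventuallyEq]
    have h2 : ∀ᶠ x in coclosedCompact (Fin N → ℂ), x ∉ tsupport f := by
      exact (hfs.isCompact.compl_mem_coclosedCompact_of_isClosed (isClosed_tsupport f))
    filter_upwards [h2] with x hx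
    rw [Lm_cx]
    have h3 : f =ᶠ[nhds x] 0 := notMem_tsupport_iff_eventuallyEq.mp hx
    have h4 : hess f x = 0 := by
      ext a b
      have h5 : ∀ ξ η, D2 f x ξ η = 0 := by
        intro ξ η
        have h6 : (fun y => fderiv ℝ f y ξ) =ᶠ[nhds x] fun _ => 0 := by
          filter_upwards [h3.eventuallyEq_nhds] with y hy
          rw [hy.fderiv_eq]; simp
        rw [D2, h6.fderiv_eq]; simp
      simp [hess, hessB, h5]
    rw [h4]; simp
  have := SmA.int_mul (Lm (cx v hv) (cx f hf)) (cx g hg) hz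
  simpa only [mul_comm] using this

end RealMA


section RealMA2
set_option linter.unusedSimpArgs false
open Matrix MeasureTheory
open scoped ContDiff ComplexOrder
variable {N : ℕ}

theorem D2_congr {f g : (Fin N → ℂ) → ℝ} {x : Fin N → ℂ} (h : f =ᶠ[nhds x] g) :
    D2 f x = D2 g x := by
  ext ξ η
  have h6 : (fun y => fderiv ℝ f y ξ) =ᶠ[nhds x] fun y => fderiv ℝ g y ξ := by
    filter_upwards [h.eventuallyEq_nhds] with y hy
    rw [hy.fderiv_eq]
  rw [D2, h6.fderiv_eq, D2]

theorem hess_congr {f g : (Fin N → ℂ) → ℝ} {x : Fin N → ℂ} (h : f =ᶠ[nhds x] g) :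
    hess f x = hess g x := by rw [hess, D2_congr h, hess]

theorem D2_add {f g : (Fin N → ℂ) → ℝ} (hf : ContDiff ℝ ∞ f) (hg : ContDiff ℝ ∞ g)
    (x ξ η : Fin N → ℂ) : D2 (fun y => f y + g y) x ξ η = D2 f x ξ η + D2 g x ξ η := by
  have h : (fun y => fderiv ℝ (fun y => f y + g y) y ξ)
      = fun y => fderiv ℝ f y ξ + fderiv ℝ g y ξ := by
    ext y; rw [fderiv_fun_add (cd_diff hf y) (cd_diff hg y)]; rfl
  rw [D2, h, fderiv_fun_add (cd_diff (cd_fderiv_apply hf ξ) x) (cd_diff (cd_fderiv_apply hg ξ) x)]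
  rfl

theorem D2_smul {f : (Fin N → ℂ) → ℝ} (hf : ContDiff ℝ ∞ f) (c : ℝ)
    (x ξ η : Fin N → ℂ) : D2 (fun y => c * f y) x ξ η = c * D2 f x ξ η := by
  have h : (fun y => fderiv ℝ (fun y => c * f y) y ξ) = fun y => c * fderiv ℝ f y ξ := by
    ext y; rw [fderiv_const_mul (cd_diff hf y)]; rfl
  rw [D2, h, fderiv_const_mul (cd_diff (cd_fderiv_apply hf ξ) x)]
  rfl

theorem D2_const (c : ℝ) (x ξ η : Fin N → ℂ) : D2 (fun _ => c) x ξ η = 0 := by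
  simp [D2]

theorem hess_add {f g : (Fin N → ℂ) → ℝ} (hf : ContDiff ℝ ∞ f) (hg : ContDiff ℝ ∞ g)
    (x : Fin N → ℂ) : hess (fun y => f y + g y) x = hess f x + hess g x := by
  ext a b
  simp only [hess, hessB, of_apply, D2_add hf hg, Matrix.add_apply]
  push_cast; ring

theorem hess_smul {f : (Fin N → ℂ) → ℝ} (hf : ContDiff ℝ ∞ f) (c : ℝ)
    (x : Fin N → ℂ) : hess (fun y => c * f y) x = (c : ℂ) • hess f x := by
  ext a b
  simp only [hess, hessB, of_apply, D2_smul hf, Matrix.smul_apply, smul_eq_mul]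
  push_cast; ring

theorem hess_const (c : ℝ) (x : Fin N → ℂ) : hess (fun _ => c) x = 0 := by
  ext a b
  simp [hess, hessB, D2_const]

theorem hess_supp {f : (Fin N → ℂ) → ℝ} {x : Fin N → ℂ} (hx : x ∉ tsupport f) : hess f x = 0 := by
  rw [hess_congr (notMem_tsupport_iff_eventuallyEq.mp hx)]
  exact hess_const 0 x

/-- real linear combos of basis -/
theorem pi_expand (ξ : Fin N → ℂ) : ξ = ∑ a, ((ξ a).re • (Pi.single a 1 : Fin N → ℂ)
    + (ξ a).im • (Pi.single a Complex.I : Fin N → ℂ)) := by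
  ext j
  simp only [Finset.sum_apply, Pi.add_apply, Pi.smul_apply, Pi.single_apply]
  rw [Finset.sum_eq_single j]
  · simp [Complex.re_add_im]
  · intro b _ hb
    simp [hb.symm]
  · simp

/-- bilinear form facts -/
theorem hessB_quad (B : (Fin N → ℂ) →ₗ[ℝ] (Fin N → ℂ) →ₗ[ℝ] ℝ) (hB : ∀ x y, B x y = B y x)
    (ξ : Fin N → ℂ) :
    star (star ξ) ⬝ᵥ (hessB (fun x y => B x y) *ᵥ star ξ)
      = (((1/4 : ℝ) * (B ξ ξ + B (Complex.I • ξ) (Complex.I • ξ)) : ℝ) : ℂ) := by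
  have hI : Complex.I • ξ = ∑ a, ((-(ξ a).im) • (Pi.single a 1 : Fin N → ℂ)
    + (ξ a).re • (Pi.single a Complex.I : Fin N → ℂ)) := by
    rw [pi_expand (Complex.I • ξ)]
    simp
  have h1 : ∀ p q r s : Fin N → ℝ, B (∑ a, (p a • (Pi.single a 1 : Fin N → ℂ)
      + q a • (Pi.single a Complex.I : Fin N → ℂ))) (∑ a, (r a • (Pi.single a 1 : Fin N → ℂ)
      + s a • (Pi.single a Complex.I : Fin N → ℂ)))
      = ∑ a, ∑ b, (p a * r b * B (Pi.single a 1) (Pi.single b 1)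
        + p a * s b * B (Pi.single a 1) (Pi.single b Complex.I)
        + q a * r b * B (Pi.single a Complex.I) (Pi.single b 1)
        + q a * s b * B (Pi.single a Complex.I) (Pi.single b Complex.I)) := by
    intro p q r s
    simp only [map_sum, map_add, map_smul, LinearMap.sum_apply, LinearMap.add_apply,
      LinearMap.smul_apply, smul_eq_mul]
    rw [Finset.sum_comm (s := Finset.univ) (t := Finset.univ)]
    refine Finset.sum_congr rfl fun a _ => ?_
    rw [Finset.mul_sum, Finset.mul_sum, ← Finset.sum_add_distrib]
    refine Finset.sum_congr rfl fun b _ => ?_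
    ring
  have e1 : B ξ ξ = ∑ a, ∑ b, ((ξ a).re * (ξ b).re * B (Pi.single a 1) (Pi.single b 1)
        + (ξ a).re * (ξ b).im * B (Pi.single a 1) (Pi.single b Complex.I)
        + (ξ a).im * (ξ b).re * B (Pi.single a Complex.I) (Pi.single b 1)
        + (ξ a).im * (ξ b).im * B (Pi.single a Complex.I) (Pi.single b Complex.I)) := by
    rw [← h1, ← pi_expand]
  rw [hI, h1, e1, ← Finset.sum_add_distrib, Finset.mul_sum]
  simp only [dotProduct, mulVec, hessB, of_apply, Finset.mul_sum, ← Finset.sum_add_distrib]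
  push_cast
  -- symmetrize
  set p : Fin N → Fin N → ℝ := fun a b => B (Pi.single a 1) (Pi.single b 1)
  set q : Fin N → Fin N → ℝ := fun a b => B (Pi.single a Complex.I) (Pi.single b Complex.I)
  set r : Fin N → Fin N → ℝ := fun a b => B (Pi.single a 1) (Pi.single b Complex.I)
  have hp : ∀ a b, B (Pi.single a 1) (Pi.single b 1) = p a b := fun _ _ => rfl
  have hq : ∀ a b, B (Pi.single a Complex.I) (Pi.single b Complex.I) = q a b := fun _ _ => rfl
  have hr : ∀ a b, B (Pi.single a 1) (Pi.single b Complex.I) = r a b := fun _ _ => rfl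
  have hr' : ∀ a b, B (Pi.single a Complex.I) (Pi.single b 1) = r b a := fun a b => hB _ _
  have hps : ∀ a b, p a b = p b a := fun a b => hB _ _
  have hqs : ∀ a b, q a b = q b a := fun a b => hB _ _
  simp only [hp, hq, hr, hr']
  have sym : ∀ F G : Fin N → Fin N → ℂ, (∀ a b, F a b + F b a = G a b + G b a) →
      ∑ a, ∑ b, F a b = ∑ a, ∑ b, G a b := by
    intro F G h
    have hF : ∑ a, ∑ b, F b a = ∑ a, ∑ b, F a b := Finset.sum_comm
    have hG : ∑ a, ∑ b, G b a = ∑ a, ∑ b, G a b := Finset.sum_comm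
    have : ∑ a, ∑ b, (F a b + F b a) = ∑ a, ∑ b, (G a b + G b a) :=
      Finset.sum_congr rfl fun a _ => Finset.sum_congr rfl fun b _ => h a b
    simp only [Finset.sum_add_distrib] at this
    rw [hF, hG] at this
    linear_combination this / 2
  apply sym
  intro a b
  rw [hps b a, hqs b a]
  have c1 : ∀ c : Fin N, ξ c = ((ξ c).re : ℂ) + ((ξ c).im : ℂ) * Complex.I := fun c =>
    (Complex.re_add_im _).symm
  have c2 : ∀ c : Fin N, (star ξ) c = ((ξ c).re : ℂ) - ((ξ c).im : ℂ) * Complex.I := by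
    intro c; simp [Complex.ext_iff]
  simp only [star_star, c2]
  rw [c1 a, c1 b]
  simp only [Complex.add_re, Complex.ofReal_re, Complex.mul_re, Complex.I_re, mul_zero,
    Complex.ofReal_im, Complex.I_im, mul_one, sub_self, add_zero, Complex.add_im, Complex.mul_im,
    zero_add]
  have hI := Complex.I_sq
  ring_nf
  simp only [Complex.I_sq, show Complex.I ^ 3 = - Complex.I by rw [pow_succ, Complex.I_sq]; ring,
    show Complex.I ^ 4 = 1 from Complex.I_pow_four]
  ring

theorem hessB_herm (B : (Fin N → ℂ) →ₗ[ℝ] (Fin N → ℂ) →ₗ[ℝ] ℝ) (hB : ∀ x y, B x y = B y x) :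
    (hessB (fun x y => B x y)).IsHermitian := by
  ext a b
  simp only [conjTranspose_apply, hessB, of_apply, star_mul', star_add]
  rw [hB (Pi.single b 1) (Pi.single a 1), hB (Pi.single b Complex.I) (Pi.single a Complex.I),
    hB (Pi.single b 1) (Pi.single a Complex.I), hB (Pi.single b Complex.I) (Pi.single a 1)]
  simp [Complex.ext_iff]

theorem hessB_psd (B : (Fin N → ℂ) →ₗ[ℝ] (Fin N → ℂ) →ₗ[ℝ] ℝ) (hB : ∀ x y, B x y = B y x)
    (h : ∀ ξ, 0 ≤ B ξ ξ + B (Complex.I • ξ) (Complex.I • ξ)) :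
    (hessB (fun x y => B x y)).PosSemidef := by
  refine PosSemidef.of_dotProduct_mulVec_nonneg (hessB_herm B hB) fun x => ?_
  have := hessB_quad B hB (star x)
  simp only [star_star] at this
  rw [this]
  have h2 := h (star x)
  exact_mod_cast (by linarith)

/-- second derivative as bilinear map -/
def D2L (u : (Fin N → ℂ) → ℝ) (x : Fin N → ℂ) : (Fin N → ℂ) →ₗ[ℝ] (Fin N → ℂ) →ₗ[ℝ] ℝ :=
  (ContinuousLinearMap.coeLM ℝ) ∘ₗ (fderiv ℝ (fderiv ℝ u) x).flip.toLinearMap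

theorem D2L_apply {u : (Fin N → ℂ) → ℝ} (hu : ContDiff ℝ ∞ u) (x ξ η : Fin N → ℂ) :
    D2L u x ξ η = D2 u x ξ η := by
  have hd : DifferentiableAt ℝ (fderiv ℝ u) x :=
    (hu.fderiv_right (m := ∞) (by simp)).differentiable (by simp) x
  have h := (hd.hasFDerivAt.clm_apply (hasFDerivAt_const ξ x)).fderiv
  rw [D2, h]
  simp [D2L]

theorem hess_eq_D2L {u : (Fin N → ℂ) → ℝ} (hu : ContDiff ℝ ∞ u) (x : Fin N → ℂ) :
    hess u x = hessB (fun ξ η => D2L u x ξ η) := by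
  rw [hess]; congr 1; ext ξ η; exact (D2L_apply hu x ξ η).symm

theorem D2L_symm {u : (Fin N → ℂ) → ℝ} (hu : ContDiff ℝ ∞ u) (x ξ η : Fin N → ℂ) :
    D2L u x ξ η = D2L u x η ξ := by
  rw [D2L_apply hu, D2L_apply hu, D2_comm hu]

/-- class of smooth psh functions -/
def Sp (u : (Fin N → ℂ) → ℝ) : Prop :=
  ContDiff ℝ ∞ u ∧ ∀ x ξ, 0 ≤ D2 u x ξ ξ + D2 u x (Complex.I • ξ) (Complex.I • ξ)

theorem Sp.psd {u : (Fin N → ℂ) → ℝ} (hu : Sp u) (x : Fin N → ℂ) : (hess u x).PosSemidef := by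
  rw [hess_eq_D2L hu.1]
  exact hessB_psd _ (D2L_symm hu.1 x) fun ξ => by
    rw [D2L_apply hu.1, D2L_apply hu.1]; exact hu.2 x ξ

theorem Sp.add {u v : (Fin N → ℂ) → ℝ} (hu : Sp u) (hv : Sp v) : Sp (fun x => u x + v x) := by
  refine ⟨hu.1.add hv.1, fun x ξ => ?_⟩
  rw [D2_add hu.1 hv.1, D2_add hu.1 hv.1]
  linarith [hu.2 x ξ, hv.2 x ξ]

theorem Sp.smul {u : (Fin N → ℂ) → ℝ} (hu : Sp u) {c : ℝ} (hc : 0 ≤ c) : Sp (fun x => c * u x) := by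
  refine ⟨contDiff_const.mul hu.1, fun x ξ => ?_⟩
  rw [D2_smul hu.1, D2_smul hu.1]
  nlinarith [hu.2 x ξ, mul_nonneg hc (hu.2 x ξ)]

theorem Sp.const (c : ℝ) : Sp (fun _ : Fin N → ℂ => c) := by
  refine ⟨contDiff_const, fun x ξ => ?_⟩
  simp [D2_const]

theorem Sp.MA_nonneg {u : (Fin N → ℂ) → ℝ} (hu : Sp u) (x : Fin N → ℂ) : 0 ≤ MA u x :=
  ma_det_re_nonneg _ (hu.psd x)

theorem Sp.Lr_nonneg {u v : (Fin N → ℂ) → ℝ} (hu : Sp u) (hv : Sp v) (x : Fin N → ℂ) :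
    0 ≤ Lr u v x := by
  have := ma_tr_nonneg _ _ (ma_adj_psd _ (hu.psd x)) (hv.psd x)
  exact (Complex.le_def.mp this).1

end RealMA2


section Gam
set_option linter.unusedSimpArgs false
open Matrix MeasureTheory
open scoped ContDiff ComplexOrder
variable {N : ℕ}

theorem Lr_add (v : (Fin N → ℂ) → ℝ) {f g : (Fin N → ℂ) → ℝ} (hf : ContDiff ℝ ∞ f)
    (hg : ContDiff ℝ ∞ g) (x : Fin N → ℂ) : Lr v (fun y => f y + g y) x = Lr v f x + Lr v g x := by
  simp only [Lr, hess_add hf hg, Matrix.mul_add, trace_add, Complex.add_re]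

theorem Lr_smul (v : (Fin N → ℂ) → ℝ) {f : (Fin N → ℂ) → ℝ} (hf : ContDiff ℝ ∞ f)
    (c : ℝ) (x : Fin N → ℂ) : Lr v (fun y => c * f y) x = c * Lr v f x := by
  simp only [Lr, hess_smul hf, Matrix.mul_smul, trace_smul, smul_eq_mul, Complex.re_ofReal_mul]

theorem Lr_sub (v : (Fin N → ℂ) → ℝ) {f g : (Fin N → ℂ) → ℝ} (hf : ContDiff ℝ ∞ f)
    (hg : ContDiff ℝ ∞ g) (x : Fin N → ℂ) : Lr v (fun y => f y - g y) x = Lr v f x - Lr v g x := by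
  have := Lr_add v hf (contDiff_const.mul hg : ContDiff ℝ ∞ fun y => (-1) * g y) x
  rw [Lr_smul v hg] at this
  simp only [neg_mul, one_mul, ← sub_eq_add_neg] at this
  exact this

theorem Lr_const (v : (Fin N → ℂ) → ℝ) (c : ℝ) (x : Fin N → ℂ) : Lr v (fun _ => c) x = 0 := by
  simp [Lr, hess_const]

theorem Lr_congr (v : (Fin N → ℂ) → ℝ) {f g : (Fin N → ℂ) → ℝ} {x : Fin N → ℂ}
    (h : f =ᶠ[nhds x] g) : Lr v f x = Lr v g x := by rw [Lr, hess_congr h, Lr]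

theorem Lr_supp (v : (Fin N → ℂ) → ℝ) {f : (Fin N → ℂ) → ℝ} {x : Fin N → ℂ}
    (h : x ∉ tsupport f) : Lr v f x = 0 := by rw [Lr, hess_supp h]; simp

/-- carré du champ -/
def Gam (v f g : (Fin N → ℂ) → ℝ) (x : Fin N → ℂ) : ℝ :=
  (1/2) * (Lr v (fun y => f y * g y) x - f x * Lr v g x - g x * Lr v f x)

theorem we_cx (u : (Fin N → ℂ) → ℝ) (hu : ContDiff ℝ ∞ u) (j : Fin N) (x : Fin N → ℂ) :
    (we j (cx u hu)).1 x = star ((wd j (cx u hu)).1 x) := by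
  have h1 : we j (cx u hu) = (1/2 : ℂ) • pd (Pi.single j 1) (cx u hu)
      + ((1/2) * Complex.I) • pd (Pi.single j Complex.I) (cx u hu) := by rw [we_eq]; rfl
  have h2 : wd j (cx u hu) = (1/2 : ℂ) • pd (Pi.single j 1) (cx u hu)
      + (-(1/2) * Complex.I) • pd (Pi.single j Complex.I) (cx u hu) := by rw [wd_eq]; rfl
  rw [h1, h2, pd_cx, pd_cx]
  change (1/2 : ℂ) * ((fderiv ℝ u x _ : ℝ) : ℂ) + (1/2 * Complex.I) * ((fderiv ℝ u x _ : ℝ) : ℂ)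
    = star ((1/2 : ℂ) * ((fderiv ℝ u x _ : ℝ) : ℂ) + (-(1/2) * Complex.I) * ((fderiv ℝ u x _ : ℝ) : ℂ))
  simp [Complex.ext_iff]

theorem Gam_self_nonneg {v f : (Fin N → ℂ) → ℝ} (hv : ContDiff ℝ ∞ v) (hf : ContDiff ℝ ∞ f)
    (x : Fin N → ℂ) (hp : (hess v x).PosSemidef) : 0 ≤ Gam v f f x := by
  have h := congrArg (fun g : SmA N => g.1 x) (Lm_prod (cx v hv) (cx f hf) (cx f hf))
  have hc : cx f hf * cx f hf = cx (fun y => f y * f y) (hf.mul hf) := by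
    apply Subtype.ext; funext y
    exact (Complex.ofReal_mul (f y) (f y)).symm
  rw [hc] at h
  set z : Fin N → ℂ := fun i => (wd i (cx f hf)).1 x with hz
  have e1 : ∀ i, (wd i (cx f hf)).1 x = z i := fun _ => rfl
  have e2 : ∀ i, (we i (cx f hf)).1 x = star (z i) := fun i => we_cx f hf i x
  have hadj : ∀ i j, (adjugate (Hm (cx v hv)) i j).1 x = adjugate (hess v x) i j := by
    intro i j
    have h0 : (adjugate (Hm (cx v hv))).map (evx x) = adjugate ((Hm (cx v hv)).map (evx x)) :=
      (RingHom.map_adjugate (evx x) _)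
    rw [Hm_cx v hv] at h0
    rw [← h0]; rfl
  have h3 : (Lm (cx v hv) (cx (fun y => f y * f y) (hf.mul hf))).1 x
      = f x * (Lm (cx v hv) (cx f hf)).1 x + f x * (Lm (cx v hv) (cx f hf)).1 x
        + ∑ j, ∑ i, adjugate (hess v x) j i * (z i * star (z j) + z i * star (z j)) := by
    refine h.trans ?_
    change f x * (Lm (cx v hv) (cx f hf)).1 x + f x * (Lm (cx v hv) (cx f hf)).1 x + _ = _
    congr 1
    rw [SmA.sum_apply]
    refine Finset.sum_congr rfl fun j _ => ?_
    rw [SmA.sum_apply]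
    refine Finset.sum_congr rfl fun i _ => ?_
    rw [SmA.mul_apply', hadj]
    change _ * ((wd i (cx f hf)).1 x * (we j (cx f hf)).1 x + (wd i (cx f hf)).1 x * (we j (cx f hf)).1 x) = _
    rw [e1, e2]
  have h4 := congrArg Complex.re h3
  rw [← Lr_eq, Complex.add_re, Complex.add_re, Complex.re_ofReal_mul, ← Lr_eq] at h4
  have h5 : ∑ j, ∑ i, adjugate (hess v x) j i * (z i * star (z j) + z i * star (z j))
      = 2 * (star z ⬝ᵥ (adjugate (hess v x) *ᵥ z)) := by
    simp only [dotProduct, mulVec, Finset.mul_sum, Pi.star_apply]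
    refine Finset.sum_congr rfl fun j _ => Finset.sum_congr rfl fun i _ => ?_
    ring
  have h6 := (ma_adj_psd _ hp).dotProduct_mulVec_nonneg z
  have h7 := (Complex.le_def.mp h6).1
  rw [h5] at h4
  have h8 : (2 * (star z ⬝ᵥ (adjugate (hess v x) *ᵥ z)) : ℂ).re
    = 2 * (star z ⬝ᵥ (adjugate (hess v x) *ᵥ z)).re := by simp
  rw [h8] at h4
  simp only [Complex.zero_re] at h7
  rw [Gam]; linarith

theorem Gam_cs {v f g : (Fin N → ℂ) → ℝ} (hv : ContDiff ℝ ∞ v) (hf : ContDiff ℝ ∞ f)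
    (hg : ContDiff ℝ ∞ g) (x : Fin N → ℂ) (hp : (hess v x).PosSemidef) (σ : ℝ) (hσ : 0 < σ) :
    - Gam v f g x ≤ σ / 2 * Gam v f f x + 1 / (2 * σ) * Gam v g g x := by
  have hs : ContDiff ℝ ∞ (fun y => σ * f y + g y) := (contDiff_const.mul hf).add hg
  have h := Gam_self_nonneg hv hs x hp
  have e : Gam v (fun y => σ * f y + g y) (fun y => σ * f y + g y) x
      = σ ^ 2 * Gam v f f x + 2 * σ * Gam v f g x + Gam v g g x := by
    have e0 : (fun y => (σ * f y + g y) * (σ * f y + g y))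
        = fun y => (σ ^ 2 * (f y * f y) + (2 * σ) * (f y * g y)) + g y * g y := by
      ext y; ring
    have c1 : ContDiff ℝ ∞ fun y => f y * f y := hf.mul hf
    have c2 : ContDiff ℝ ∞ fun y => f y * g y := hf.mul hg
    have c3 : ContDiff ℝ ∞ fun y => g y * g y := hg.mul hg
    have c4 : ContDiff ℝ ∞ fun y => σ ^ 2 * (f y * f y) := contDiff_const.mul c1
    have c5 : ContDiff ℝ ∞ fun y => (2 * σ) * (f y * g y) := contDiff_const.mul c2
    have c6 : ContDiff ℝ ∞ fun y => σ * f y := contDiff_const.mul hf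
    have c7 : ContDiff ℝ ∞ fun y => σ ^ 2 * (f y * f y) + (2 * σ) * (f y * g y) := c4.add c5
    simp only [Gam]
    rw [e0, Lr_add v c7 c3, Lr_add v c4 c5, Lr_smul v c1, Lr_smul v c2, Lr_add v c6 hg,
      Lr_smul v hf]
    ring
  rw [e] at h
  have : σ / 2 * Gam v f f x + 1 / (2 * σ) * Gam v g g x + Gam v f g x
      = (σ ^ 2 * Gam v f f x + 2 * σ * Gam v f g x + Gam v g g x) / (2 * σ) := by
    field_simp
    ring
  have h2 := div_nonneg h (by positivity : 0 ≤ 2 * σ)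
  linarith

theorem Lr_int {v g : (Fin N → ℂ) → ℝ} (hv : ContDiff ℝ ∞ v) (hg : ContDiff ℝ ∞ g)
    {f : (Fin N → ℂ) → ℝ} (hf : Continuous f) (hs : HasCompactSupport f) :
    Integrable (fun x => f x * Lr v g x) :=
  (hf.mul (Lr_cont hv hg)).integrable_of_hasCompactSupport hs.mul_right

theorem Lr_cs (v : (Fin N → ℂ) → ℝ) {g : (Fin N → ℂ) → ℝ} (hs : HasCompactSupport g) :
    HasCompactSupport (Lr v g) :=
  HasCompactSupport.intro hs.isCompact fun _ hx => Lr_supp v hx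

theorem Lr_int' {v g : (Fin N → ℂ) → ℝ} (hv : ContDiff ℝ ∞ v) (hg : ContDiff ℝ ∞ g)
    {f : (Fin N → ℂ) → ℝ} (hf : Continuous f) (hs : HasCompactSupport g) :
    Integrable (fun x => f x * Lr v g x) :=
  (hf.mul (Lr_cont hv hg)).integrable_of_hasCompactSupport (Lr_cs v hs).mul_left

/-- `∫ f L d = - ∫ Γ(f,d)` -/
theorem int_Gam {v f d : (Fin N → ℂ) → ℝ} (hv : ContDiff ℝ ∞ v) (hf : ContDiff ℝ ∞ f)
    (hd : ContDiff ℝ ∞ d) (hs : HasCompactSupport d) :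
    ∫ x, f x * Lr v d x = - ∫ x, Gam v f d x := by
  have hfd : ContDiff ℝ ∞ (fun y => f y * d y) := hf.mul hd
  have hfs : HasCompactSupport (fun y => f y * d y) := hs.mul_left
  have h1 : ∫ x, Lr v (fun y => f y * d y) x = 0 := by
    have := Lr_symm hv hfd (contDiff_const (c := (1:ℝ))) hfs
    simp only [Lr_const, mul_zero, integral_zero, one_mul] at this
    exact this.symm
  have h2 := Lr_symm hv hd hf hs
  have i1 : Integrable (Lr v (fun y => f y * d y)) := by
    have := Lr_int' hv hfd (continuous_const (y := (1:ℝ))) hfs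
    simpa using this
  have i2 := Lr_int' hv hd hf.continuous hs
  have i3 := Lr_int hv hf hd.continuous hs
  simp only [Gam]
  have i12 : Integrable fun x => Lr v (fun y => f y * d y) x - f x * Lr v d x := i1.sub i2
  rw [integral_const_mul, integral_sub i12 i3, integral_sub i1 i2, h1, h2]
  ring

theorem Gam_cont {v f g : (Fin N → ℂ) → ℝ} (hv : ContDiff ℝ ∞ v) (hf : ContDiff ℝ ∞ f)
    (hg : ContDiff ℝ ∞ g) : Continuous (Gam v f g) := by
  have := Lr_cont hv (hf.mul hg)
  exact continuous_const.mul ((this.sub (hf.continuous.mul (Lr_cont hv hg))).sub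
    (hg.continuous.mul (Lr_cont hv hf)))

theorem Gam_supp {v f d : (Fin N → ℂ) → ℝ} {x : Fin N → ℂ} (hx : x ∉ tsupport d) :
    Gam v f d x = 0 := by
  have h1 : x ∉ tsupport (fun y => f y * d y) := fun h => hx (tsupport_mul_subset_right h)
  rw [Gam, Lr_supp v h1, Lr_supp v hx, image_eq_zero_of_notMem_tsupport hx]; ring

/-- pointwise path derivative bound -/
theorem path_bound {v f d θ : (Fin N → ℂ) → ℝ} (hv : Sp v) (hf : ContDiff ℝ ∞ f)
    (hd : ContDiff ℝ ∞ d) (hs : HasCompactSupport d) (hθ : ContDiff ℝ ∞ θ)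
    (hθs : HasCompactSupport θ) (hθ0 : ∀ x, 0 ≤ θ x) (hθ1 : ∀ x ∈ tsupport d, θ x = 1)
    (σ : ℝ) (hσ : 0 < σ) :
    ∫ x, f x * Lr v d x ≤ σ / 2 * (∫ x, θ x * Gam v f f x)
      - 1 / (2 * σ) * ∫ x, d x * Lr v d x := by
  rw [int_Gam hv.1 hf hd hs, int_Gam hv.1 hd hd hs, ← integral_neg]
  have i1 : Integrable (fun x => θ x * Gam v f f x) :=
    (hθ.continuous.mul (Gam_cont hv.1 hf hf)).integrable_of_hasCompactSupport hθs.mul_right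
  have c1 : HasCompactSupport (Gam v d d) := HasCompactSupport.intro hs.isCompact
    fun x hx => Gam_supp hx
  have c2 : HasCompactSupport (Gam v f d) := HasCompactSupport.intro hs.isCompact
    fun x hx => Gam_supp hx
  have i2 : Integrable (Gam v d d) :=
    (Gam_cont hv.1 hd hd).integrable_of_hasCompactSupport c1
  have i3 : Integrable (Gam v f d) :=
    (Gam_cont hv.1 hf hd).integrable_of_hasCompactSupport c2
  have : σ / 2 * (∫ x, θ x * Gam v f f x) - 1 / (2 * σ) * -∫ x, Gam v d d x
      = ∫ x, (σ / 2 * (θ x * Gam v f f x) + 1 / (2 * σ) * Gam v d d x) := by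
    rw [integral_add (i1.const_mul _) (i2.const_mul _), integral_const_mul, integral_const_mul]
    ring
  rw [this]
  refine integral_mono i3.neg ((i1.const_mul _).add (i2.const_mul _)) fun x => ?_
  have hG := Gam_self_nonneg hv.1 hf x (hv.psd x)
  by_cases hx : x ∈ tsupport d
  · have := Gam_cs hv.1 hf hd x (hv.psd x) σ hσ
    simp only [Pi.neg_apply]
    rw [hθ1 x hx, one_mul]; exact this
  · simp only [Pi.neg_apply]
    rw [Gam_supp hx, Gam_supp hx]
    have := mul_nonneg (hθ0 x) hG
    simp; positivity

theorem Gam_mass {v w0 f θ a b : (Fin N → ℂ) → ℝ} (hv : Sp v) (ha : Sp a) (hb : Sp b)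
    (hfab : ∀ x, f x = a x - b x) (hθ : ContDiff ℝ ∞ θ)
    (hθs : HasCompactSupport θ) (hθ0 : ∀ x, 0 ≤ θ x) (hL : ∀ x, Lr v θ x = Lr w0 θ x)
    (C0 : ℝ) (hC : ∀ x ∈ tsupport θ, |f x| ≤ C0) :
    ∫ x, θ x * Gam v f f x ≤ 1 / 2 * (∫ x, (f x * f x) * Lr w0 θ x)
      + C0 * ∫ x, (a x + b x) * Lr w0 θ x := by
  obtain rfl : f = fun x => a x - b x := funext hfab
  set f : (Fin N → ℂ) → ℝ := fun x => a x - b x with hfdef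
  have hf : ContDiff ℝ ∞ f := ha.1.sub hb.1
  have hff : ContDiff ℝ ∞ fun y => f y * f y := hf.mul hf
  have hab : ContDiff ℝ ∞ fun y => a y + b y := ha.1.add hb.1
  have h1 := Lr_symm hv.1 hθ hff hθs
  have h2 := Lr_symm hv.1 hθ hab hθs
  have e1 : ∫ x, (f x * f x) * Lr w0 θ x = ∫ x, θ x * Lr v (fun y => f y * f y) x := by
    rw [h1]; simp only [hL]
  have e2 : ∫ x, (a x + b x) * Lr w0 θ x = ∫ x, θ x * Lr v (fun y => a y + b y) x := by
    rw [h2]; simp only [hL]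
  rw [e1, e2, ← integral_const_mul, ← integral_const_mul, ← integral_add]
  rotate_left
  · exact (Lr_int hv.1 hff hθ.continuous hθs).const_mul _
  · exact (Lr_int hv.1 hab hθ.continuous hθs).const_mul _
  refine integral_mono ?_ ?_ fun x => ?_
  · exact (hθ.continuous.mul (Gam_cont hv.1 hf hf)).integrable_of_hasCompactSupport hθs.mul_right
  · exact ((Lr_int hv.1 hff hθ.continuous hθs).const_mul _).add
      ((Lr_int hv.1 hab hθ.continuous hθs).const_mul _)
  · simp only [Gam]
    rw [Lr_add v ha.1 hb.1]
    have e3 : Lr v f x = Lr v a x - Lr v b x := Lr_sub v ha.1 hb.1 x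
    by_cases hx : x ∈ tsupport θ
    · have := abs_le.mp (hC x hx)
      have pa := hv.Lr_nonneg ha x
      have pb := hv.Lr_nonneg hb x
      have key : - (f x * Lr v f x) ≤ C0 * (Lr v a x + Lr v b x) := by
        rw [e3]
        nlinarith [mul_le_mul_of_nonneg_right this.2 pb, mul_le_mul_of_nonneg_right this.1 pa,
          mul_nonneg (abs_nonneg (f x)) pa, mul_nonneg (abs_nonneg (f x)) pb]
      nlinarith [mul_le_mul_of_nonneg_left key (hθ0 x)]
    · rw [image_eq_zero_of_notMem_tsupport hx]; simp

end Gam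


section Path
set_option linter.unusedSimpArgs false
open Matrix MeasureTheory
open scoped ContDiff ComplexOrder
variable {N : ℕ}

theorem hess_cont {u : (Fin N → ℂ) → ℝ} (hu : ContDiff ℝ ∞ u) : Continuous (hess u) := by
  have h : ∀ ξ η, Continuous fun x => D2 u x ξ η := fun ξ η =>
    (cd_fderiv_apply (cd_fderiv_apply hu ξ) η).continuous
  unfold hess hessB
  refine continuous_matrix fun a b => ?_
  simp only [of_apply]
  have := h
  refine continuous_const.mul (Continuous.add ?_ (continuous_const.mul ?_))
  · exact Complex.continuous_ofReal.comp ((h _ _).add (h _ _))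
  · exact Complex.continuous_ofReal.comp ((h _ _).sub (h _ _))

theorem MA_cont {u : (Fin N → ℂ) → ℝ} (hu : ContDiff ℝ ∞ u) : Continuous (MA u) :=
  Complex.continuous_re.comp (hess_cont hu).matrix_det

/-- derivative of a parametric integral with compact support -/
theorem int_deriv {F F' : ℝ → (Fin N → ℂ) → ℝ} {K : Set (Fin N → ℂ)} (hK : IsCompact K)
    (hF : ∀ t x, HasDerivAt (fun s => F s x) (F' t x) t)
    (hFc : ∀ t, Continuous (F t)) (hF' : Continuous (Function.uncurry F'))
    (hs : ∀ t x, x ∉ K → F t x = 0) (t : ℝ) :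
    HasDerivAt (fun t => ∫ x, F t x) (∫ x, F' t x) t := by
  have hs' : ∀ t x, x ∉ K → F' t x = 0 := by
    intro t x hx
    have h1 : (fun s => F s x) = fun _ => 0 := by ext s; exact hs s x hx
    have h2 := hF t x
    rw [h1] at h2
    exact h2.unique (hasDerivAt_const t 0)
  have hFt : ∀ t, Continuous (F' t) := fun t => hF'.comp (Continuous.prodMk_right t)
  obtain ⟨C, hC⟩ := ((isCompact_closedBall t 1).prod hK).exists_bound_of_continuousOn
    (f := Function.uncurry F') hF'.continuousOn
  have hInt : ∀ t, Integrable (F t) := fun t =>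
    (hFc t).integrable_of_hasCompactSupport (HasCompactSupport.intro hK (hs t))
  refine (hasDerivAt_integral_of_dominated_loc_of_deriv_le (F := F) (F' := F')
    (bound := K.indicator fun _ => C) (s := closedBall t 1) (closedBall_mem_nhds t one_pos)
    (Eventually.of_forall fun t => (hFc t).aestronglyMeasurable) (hInt t)
    (hFt t).aestronglyMeasurable ?_ ?_ ?_).2
  · refine Eventually.of_forall fun x s hx => ?_
    by_cases hxK : x ∈ K
    · rw [Set.indicator_of_mem hxK]; exact hC (s, x) ⟨hx, hxK⟩
    · rw [Set.indicator_of_notMem hxK, hs' s x hxK]; simp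
  · exact (integrable_indicator_iff hK.measurableSet).mpr
      (continuousOn_const.integrableOn_compact hK)
  · exact Eventually.of_forall fun x s _ => hF s x

/-- linear path of Hessians -/
theorem hess_path {v d : (Fin N → ℂ) → ℝ} (hv : ContDiff ℝ ∞ v) (hd : ContDiff ℝ ∞ d) (t : ℝ)
    (x : Fin N → ℂ) : hess (fun y => v y + t * d y) x = hess v x + (t : ℂ) • hess d x := by
  rw [hess_add hv (contDiff_const.mul hd), hess_smul hd]

theorem MA_path_deriv {v d : (Fin N → ℂ) → ℝ} (hv : ContDiff ℝ ∞ v) (hd : ContDiff ℝ ∞ d)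
    (x : Fin N → ℂ) (t : ℝ) : HasDerivAt (fun t : ℝ => MA (fun y => v y + t * d y) x)
      (Lr (fun y => v y + t * d y) d x) t := by
  simp only [MA, Lr, hess_path hv hd]
  exact (Complex.reCLM.hasFDerivAt.comp_hasDerivAt t (ma_hasDerivAt_det _ _ t))

theorem Lr_path_cont {v d g : (Fin N → ℂ) → ℝ} (hv : ContDiff ℝ ∞ v) (hd : ContDiff ℝ ∞ d)
    (hg : ContDiff ℝ ∞ g) :
    Continuous (fun p : ℝ × (Fin N → ℂ) => Lr (fun y => v y + p.1 * d y) g p.2) := by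
  simp only [Lr, hess_path hv hd]
  refine Complex.continuous_re.comp (Continuous.matrix_trace (Continuous.matrix_mul
    (Continuous.matrix_adjugate ?_) ((hess_cont hg).comp continuous_snd)))
  exact ((hess_cont hv).comp continuous_snd).add
    ((Complex.continuous_ofReal.comp continuous_fst).smul ((hess_cont hd).comp continuous_snd))

/-- derivative of `∫ g MA(v+td)`, g compactly supported -/
theorem MA_int_deriv {v d g : (Fin N → ℂ) → ℝ} (hv : ContDiff ℝ ∞ v) (hd : ContDiff ℝ ∞ d)
    (hg : Continuous g) (hgs : HasCompactSupport g) (t : ℝ) :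
    HasDerivAt (fun t : ℝ => ∫ x, g x * MA (fun y => v y + t * d y) x)
      (∫ x, g x * Lr (fun y => v y + t * d y) d x) t := by
  refine int_deriv (F := fun t x => g x * MA (fun y => v y + t * d y) x)
    (F' := fun t x => g x * Lr (fun y => v y + t * d y) d x) hgs.isCompact ?_ ?_ ?_ ?_ t
  · intro t x; exact (MA_path_deriv hv hd x t).const_mul _
  · intro t; exact hg.mul (MA_cont (hv.add (contDiff_const.mul hd)))
  · exact (hg.comp continuous_snd).mul (Lr_path_cont hv hd hd)
  · intro t x hx; rw [image_eq_zero_of_notMem_tsupport hx, zero_mul]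

theorem Sp.path {v d : (Fin N → ℂ) → ℝ} (hv : Sp v) (hv1 : Sp (fun x => v x + d x))
    (hd : ContDiff ℝ ∞ d) (t : ℝ) (h0 : 0 ≤ t) (h1 : t ≤ 1) : Sp (fun x => v x + t * d x) := by
  have := (hv.smul (by linarith : 0 ≤ 1 - t)).add (hv1.smul h0)
  convert this using 2
  ring

/-- mass conservation -/
theorem mass_path {v d θ : (Fin N → ℂ) → ℝ} (hv : ContDiff ℝ ∞ v) (hd : ContDiff ℝ ∞ d)
    (hs : HasCompactSupport d) (hθ : ContDiff ℝ ∞ θ) (hθs : HasCompactSupport θ)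
    (hθ1 : ∀ x ∈ tsupport d, θ =ᶠ[nhds x] fun _ => 1) :
    ∀ t : ℝ, ∫ x, θ x * MA (fun y => v y + t * d y) x = ∫ x, θ x * MA v x := by
  have hz : ∀ t : ℝ, ∫ x, θ x * Lr (fun y => v y + t * d y) d x = 0 := by
    intro t
    have hvt : ContDiff ℝ ∞ fun y => v y + t * d y := hv.add (contDiff_const.mul hd)
    rw [Lr_symm hvt hθ hd hθs]
    have : (fun x => d x * Lr (fun y => v y + t * d y) θ x) = fun _ => 0 := by
      ext x
      by_cases hx : x ∈ tsupport d
      · rw [Lr_congr _ (hθ1 x hx), Lr_const, mul_zero]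
      · rw [image_eq_zero_of_notMem_tsupport hx, zero_mul]
    rw [this]; simp
  have hder := fun t => MA_int_deriv hv hd hθ.continuous hθs t
  intro t
  have hdiff : Differentiable ℝ (fun t : ℝ => ∫ x, θ x * MA (fun y => v y + t * d y) x) :=
    fun t => (hder t).differentiableAt
  have := is_const_of_deriv_eq_zero hdiff (fun t => by rw [(hder t).deriv, hz]) t 0
  simp only [zero_mul, add_zero] at this
  exact this

/-- the key path estimate -/
theorem path_est {v d f θ : (Fin N → ℂ) → ℝ} (hv : Sp v) (hv1 : Sp (fun x => v x + d x))
    (hf : ContDiff ℝ ∞ f)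
    (hd : ContDiff ℝ ∞ d) (hs : HasCompactSupport d) (hd0 : ∀ x, 0 ≤ d x) (hθ : ContDiff ℝ ∞ θ)
    (hθs : HasCompactSupport θ) (hθ0 : ∀ x, 0 ≤ θ x)
    (hθ1 : ∀ x ∈ tsupport d, θ =ᶠ[nhds x] fun _ => 1)
    (σ : ℝ) (hσ : 0 < σ) (C : ℝ)
    (hC : ∀ t : ℝ, 0 ≤ t → t ≤ 1 → ∫ x, θ x * Gam (fun y => v y + t * d y) f f x ≤ C) :
    (∫ x, θ x * f x * MA (fun x => v x + d x) x) - (∫ x, θ x * f x * MA v x)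
      ≤ σ / 2 * C + 1 / (2 * σ) * ∫ x, d x * MA v x := by
  have hθf : Continuous fun x => θ x * f x := (hθ.mul hf).continuous
  have hθfs : HasCompactSupport fun x => θ x * f x := hθs.mul_right
  set X : ℝ → ℝ := fun t => ∫ x, θ x * f x * MA (fun y => v y + t * d y) x with hX
  set h : ℝ → ℝ := fun t => ∫ x, d x * MA (fun y => v y + t * d y) x with hh
  have hX' := fun t => MA_int_deriv hv.1 hd hθf hθfs t
  have hh' := fun t => MA_int_deriv hv.1 hd hd.continuous hs t
  set Y : ℝ → ℝ := fun t => X t + 1 / (2 * σ) * h t - σ / 2 * C * t with hY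
  have hY' : ∀ t, HasDerivAt Y ((∫ x, θ x * f x * Lr (fun y => v y + t * d y) d x)
      + 1 / (2 * σ) * (∫ x, d x * Lr (fun y => v y + t * d y) d x) - σ / 2 * C) t := by
    intro t
    have := ((hX' t).add ((hh' t).const_mul (1 / (2 * σ)))).sub ((hasDerivAt_id t).const_mul (σ / 2 * C))
    rw [mul_one] at this
    exact this
  have hanti : AntitoneOn Y (Set.Icc 0 1) := by
    apply antitoneOn_of_deriv_nonpos (convex_Icc 0 1)
    · exact fun t _ => (hY' t).continuousAt.continuousWithinAt
    · exact fun t _ => (hY' t).differentiableAt.differentiableWithinAt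
    · intro t ht
      rw [interior_Icc] at ht
      rw [(hY' t).deriv]
      have hvt := hv.path hv1 hd t ht.1.le ht.2.le
      have hb := path_bound hvt hf hd hs hθ hθs hθ0 (fun x hx => (hθ1 x hx).eq_of_nhds) σ hσ
      have e : ∫ x, θ x * f x * Lr (fun y => v y + t * d y) d x
          = ∫ x, f x * Lr (fun y => v y + t * d y) d x := by
        congr 1; ext x
        by_cases hx : x ∈ tsupport d
        · rw [(hθ1 x hx).eq_of_nhds, one_mul]
        · rw [Lr_supp _ hx]; simp
      rw [e]
      have := mul_le_mul_of_nonneg_left (hC t ht.1.le ht.2.le) (by positivity : 0 ≤ σ / 2)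
      linarith
  have h01 := hanti (Set.left_mem_Icc.mpr zero_le_one) (Set.right_mem_Icc.mpr zero_le_one) zero_le_one
  have hh1 : 0 ≤ h 1 := by
    refine integral_nonneg fun x => mul_nonneg (hd0 x) ?_
    exact (hv.path hv1 hd 1 zero_le_one le_rfl).MA_nonneg x
  have hpos : 0 ≤ 1 / (2 * σ) * h 1 := by positivity
  have e1 : X 1 = ∫ x, θ x * f x * MA (fun x => v x + d x) x := by simp [hX]
  have e0 : X 0 = ∫ x, θ x * f x * MA v x := by simp [hX]
  have e2 : h 0 = ∫ x, d x * MA v x := by simp [hh]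
  rw [← e1, ← e0, ← e2]
  simp only [hY] at h01
  linarith

end Path


section Energy
set_option linter.unusedSimpArgs false
set_option linter.unusedVariables false
open Matrix MeasureTheory
open scoped ContDiff ComplexOrder
variable {N : ℕ}

/-- two-parameter affine family -/
def vv (w g d : (Fin N → ℂ) → ℝ) (p q : ℝ) : (Fin N → ℂ) → ℝ := fun y => w y + p * g y + q * d y

theorem vv_cd {w g d : (Fin N → ℂ) → ℝ} (hw : ContDiff ℝ ∞ w) (hg : ContDiff ℝ ∞ g)
    (hd : ContDiff ℝ ∞ d) (p q : ℝ) : ContDiff ℝ ∞ (vv w g d p q) :=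
  (hw.add (contDiff_const.mul hg)).add (contDiff_const.mul hd)

theorem hess_vv {w g d : (Fin N → ℂ) → ℝ} (hw : ContDiff ℝ ∞ w) (hg : ContDiff ℝ ∞ g)
    (hd : ContDiff ℝ ∞ d) (p q : ℝ) (x : Fin N → ℂ) :
    hess (vv w g d p q) x = hess w x + (p : ℂ) • hess g x + (q : ℂ) • hess d x := by
  unfold vv
  rw [hess_path (v := fun y => w y + p * g y) (hw.add (contDiff_const.mul hg)) hd, hess_path hw hg]

theorem hess_vv_cont {w g d : (Fin N → ℂ) → ℝ} (hw : ContDiff ℝ ∞ w) (hg : ContDiff ℝ ∞ g)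
    (hd : ContDiff ℝ ∞ d) :
    Continuous (fun P : (ℝ × ℝ) × (Fin N → ℂ) => hess (vv w g d P.1.1 P.1.2) P.2) := by
  simp only [hess_vv hw hg hd]
  exact (((hess_cont hw).comp continuous_snd).add
    ((Complex.continuous_ofReal.comp (continuous_fst.comp continuous_fst)).smul
      ((hess_cont hg).comp continuous_snd))).add
    ((Complex.continuous_ofReal.comp (continuous_snd.comp continuous_fst)).smul
      ((hess_cont hd).comp continuous_snd))

theorem par_cont {X : Type*} [TopologicalSpace X] [FirstCountableTopology X] [LocallyCompactSpace X]
    {F : X × (Fin N → ℂ) → ℝ} {f : (Fin N → ℂ) → ℝ} (hf : Continuous f) (hfs : HasCompactSupport f)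
    (hF : Continuous F) : Continuous fun p => ∫ x, f x * F (p, x) := by
  have h : ∀ p, ∫ x, f x * F (p, x) = ∫ x in tsupport f, f x * F (p, x) := by
    intro p
    rw [setIntegral_eq_integral_of_forall_compl_eq_zero]
    intro x hx
    rw [image_eq_zero_of_notMem_tsupport hx, zero_mul]
  simp only [h]
  refine continuous_parametric_integral_of_continuous (f := fun p x => f x * F (p, x)) ?_ hfs.isCompact
  exact (hf.comp continuous_snd).mul hF

theorem MA_vv_cont {w g d f : (Fin N → ℂ) → ℝ} (hw : ContDiff ℝ ∞ w) (hg : ContDiff ℝ ∞ g)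
    (hd : ContDiff ℝ ∞ d) (hf : Continuous f) (hfs : HasCompactSupport f) :
    Continuous (fun P : ℝ × ℝ => ∫ x, f x * MA (vv w g d P.1 P.2) x) :=
  par_cont (F := fun P : (ℝ × ℝ) × (Fin N → ℂ) => MA (vv w g d P.1.1 P.1.2) P.2) hf hfs
    (Complex.continuous_re.comp (hess_vv_cont hw hg hd).matrix_det)

theorem Lr_vv_cont {w g d f k : (Fin N → ℂ) → ℝ} (hw : ContDiff ℝ ∞ w) (hg : ContDiff ℝ ∞ g)
    (hd : ContDiff ℝ ∞ d) (hk : ContDiff ℝ ∞ k) (hf : Continuous f) (hfs : HasCompactSupport f) :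
    Continuous (fun P : ℝ × ℝ => ∫ x, f x * Lr (vv w g d P.1 P.2) k x) :=
  par_cont (F := fun P : (ℝ × ℝ) × (Fin N → ℂ) => Lr (vv w g d P.1.1 P.1.2) k P.2) hf hfs
    (Complex.continuous_re.comp (Continuous.matrix_trace (Continuous.matrix_mul
      (Continuous.matrix_adjugate (hess_vv_cont hw hg hd)) ((hess_cont hk).comp continuous_snd))))

/-- Monge-Ampere energy -/
def Jen (w g : (Fin N → ℂ) → ℝ) : ℝ :=
  ∫ t in (0:ℝ)..1, ∫ x, g x * MA (fun y => w y + t * g y) x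

theorem Jen_deriv {w g d : (Fin N → ℂ) → ℝ} (hw : ContDiff ℝ ∞ w) (hg : ContDiff ℝ ∞ g)
    (hd : ContDiff ℝ ∞ d) (hgs : HasCompactSupport g) (hds : HasCompactSupport d) (s : ℝ) :
    HasDerivAt (fun s : ℝ => Jen w (fun y => g y + s * d y))
      (∫ x, d x * MA (fun y => w y + (g y + s * d y)) x) s := by
  have hvv : ∀ s t : ℝ, (fun y => w y + t * (g y + s * d y)) = vv w g d t (t * s) := by
    intro s t; ext y; simp only [vv]; ring
  set Φ : ℝ → ℝ → ℝ := fun s t => (∫ x, g x * MA (vv w g d t (t * s)) x)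
    + s * ∫ x, d x * MA (vv w g d t (t * s)) x with hΦ
  set Φ' : ℝ → ℝ → ℝ := fun s t => t * (∫ x, g x * Lr (vv w g d t (t * s)) d x)
    + ((∫ x, d x * MA (vv w g d t (t * s)) x)
      + s * (t * ∫ x, d x * Lr (vv w g d t (t * s)) d x)) with hΦ'
  have iMA : ∀ {f : (Fin N → ℂ) → ℝ} (hf : ContDiff ℝ ∞ f) (hfs : HasCompactSupport f) (p q : ℝ),
      Integrable fun x => f x * MA (vv w g d p q) x := fun hf hfs p q =>
    (hf.continuous.mul (MA_cont (vv_cd hw hg hd p q))).integrable_of_hasCompactSupport hfs.mul_right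
  have eJ : ∀ s, Jen w (fun y => g y + s * d y) = ∫ t in (0:ℝ)..1, Φ s t := by
    intro s
    unfold Jen
    congr 1; ext t
    simp only [hΦ]
    rw [hvv, ← integral_const_mul, ← integral_add (iMA hg hgs _ _) ((iMA hd hds _ _).const_mul s)]
    congr 1; ext x; ring
  have hder1 : ∀ (f : (Fin N → ℂ) → ℝ) (hf : ContDiff ℝ ∞ f) (hfs : HasCompactSupport f) (s t : ℝ),
      HasDerivAt (fun s : ℝ => ∫ x, f x * MA (vv w g d t (t * s)) x)
        (t * ∫ x, f x * Lr (vv w g d t (t * s)) d x) s := by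
    intro f hf hfs s t
    have := MA_int_deriv (v := fun y => w y + t * g y) (d := fun y => t * d y)
      (hw.add (contDiff_const.mul hg)) (contDiff_const.mul hd) hf.continuous hfs s
    have e : ∀ s : ℝ, (fun y => w y + t * g y + s * (t * d y)) = vv w g d t (t * s) := by
      intro s; ext y; simp only [vv]; ring
    simp only [e] at this
    convert this using 1
    rw [← integral_const_mul]; congr 1; ext x
    rw [Lr_smul _ hd]; ring
  have hder : ∀ s t, HasDerivAt (fun s => Φ s t) (Φ' s t) s := by
    intro s t
    have := (hder1 g hg hgs s t).add ((hasDerivAt_id s).mul (hder1 d hd hds s t))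
    simp only [id, one_mul] at this
    exact this
  have hmap : Continuous fun P : ℝ × ℝ => ((P.2, P.2 * P.1) : ℝ × ℝ) := by fun_prop
  have cΦ : Continuous (Function.uncurry Φ) := by
    have h1 := (MA_vv_cont hw hg hd hg.continuous hgs).comp hmap
    have h2 := (MA_vv_cont hw hg hd hd.continuous hds).comp hmap
    exact h1.add (continuous_fst.mul h2)
  have cΦ' : Continuous (Function.uncurry Φ') := by
    have h1 := (Lr_vv_cont hw hg hd hd hg.continuous hgs).comp hmap
    have h2 := (MA_vv_cont hw hg hd hd.continuous hds).comp hmap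
    have h3 := (Lr_vv_cont hw hg hd hd hd.continuous hds).comp hmap
    exact (continuous_snd.mul h1).add (h2.add (continuous_fst.mul (continuous_snd.mul h3)))
  obtain ⟨C, hC⟩ := ((isCompact_closedBall s 1).prod (isCompact_Icc (a := (0:ℝ)) (b := 1))).exists_bound_of_continuousOn
    (f := Function.uncurry Φ') cΦ'.continuousOn
  have key : HasDerivAt (fun s => ∫ t in (0:ℝ)..1, Φ s t) (∫ t in (0:ℝ)..1, Φ' s t) s := by
    refine (intervalIntegral.hasDerivAt_integral_of_dominated_loc_of_deriv_le
      (F := Φ) (F' := Φ') (bound := fun _ => C) (s := closedBall s 1)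
      (closedBall_mem_nhds s one_pos) ?_ ?_ ?_ ?_ ?_ ?_).2
    · exact Eventually.of_forall fun s =>
        (cΦ.comp (Continuous.prodMk_right s)).aestronglyMeasurable
    · exact (cΦ.comp (Continuous.prodMk_right s)).intervalIntegrable _ _
    · exact (cΦ'.comp (Continuous.prodMk_right s)).aestronglyMeasurable
    · refine Eventually.of_forall fun t ht r hr => hC (r, t) ⟨hr, ?_⟩
      rw [Set.uIoc_of_le zero_le_one] at ht
      exact ⟨ht.1.le, ht.2⟩
    · simp
    · exact Eventually.of_forall fun t _ r _ => hder r t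
  have hΨ : ∀ t : ℝ, HasDerivAt (fun t : ℝ => t * ∫ x, d x * MA (vv w g d t (t * s)) x) (Φ' s t) t := by
    intro t
    have hgd : ContDiff ℝ ∞ fun y => g y + s * d y := hg.add (contDiff_const.mul hd)
    have h1 := MA_int_deriv (v := w) (d := fun y => g y + s * d y) hw hgd hd.continuous hds t
    simp only [hvv] at h1
    have h2 := (hasDerivAt_id t).mul h1
    refine h2.congr_deriv ?_
    simp only [hΦ', id, one_mul]
    have hv := vv_cd hw hg hd t (t * s)
    have e1 : ∫ x, d x * Lr (vv w g d t (t * s)) (fun y => g y + s * d y) x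
      = (∫ x, g x * Lr (vv w g d t (t * s)) d x) + s * ∫ x, d x * Lr (vv w g d t (t * s)) d x := by
      rw [Lr_symm hv hd hgd hds, ← integral_const_mul, ← integral_add]
      · congr 1; ext x; ring
      · exact Lr_int hv hd hg.continuous hgs
      · exact (Lr_int hv hd hd.continuous hds).const_mul s
    rw [e1]; ring
  have hfin : ∫ t in (0:ℝ)..1, Φ' s t = ∫ x, d x * MA (fun y => w y + (g y + s * d y)) x := by
    rw [intervalIntegral.integral_eq_sub_of_hasDerivAt (fun t _ => hΨ t)
      ((cΦ'.comp (Continuous.prodMk_right s)).intervalIntegrable _ _)]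
    simp only [one_mul, zero_mul, sub_zero]
    have e := hvv s 1
    simp only [one_mul] at e
    rw [e]
  rw [← hfin]
  simp only [eJ]
  exact key

theorem MA_det_path {v d : (Fin N → ℂ) → ℝ} (hv : Sp v) (hv1 : Sp fun x => v x + d x)
    (hd : ContDiff ℝ ∞ d) (s : ℝ) (h0 : 0 ≤ s) (h1 : s ≤ 1) (x : Fin N → ℂ) :
    (1 - s) ^ N * MA v x ≤ MA (fun y => v y + s * d y) x := by
  unfold MA
  rw [hess_path hv.1 hd]
  refine ma_det_path _ _ (hv.psd x) ?_ s h0 h1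
  have := hv1.psd x
  rwa [hess_add hv.1 hd] at this

theorem Jen_incr {w g d : (Fin N → ℂ) → ℝ} (hw : ContDiff ℝ ∞ w) (hg : ContDiff ℝ ∞ g)
    (hd : ContDiff ℝ ∞ d) (hgs : HasCompactSupport g) (hds : HasCompactSupport d)
    (hd0 : ∀ x, 0 ≤ d x) (h0 : Sp fun x => w x + g x) (h1 : Sp fun x => w x + (g x + d x)) :
    (∫ x, d x * MA (fun y => w y + g y) x) ≤ (N + 1) * (Jen w (fun y => g y + d y) - Jen w g) := by
  set h := ∫ x, d x * MA (fun y => w y + g y) x with hh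
  set Y : ℝ → ℝ := fun s => Jen w (fun y => g y + s * d y) + (1 - s) ^ (N + 1) * (h / (N + 1)) with hY
  have hN : (0:ℝ) < N + 1 := by positivity
  have h1' : Sp fun x => (w x + g x) + d x := by convert h1 using 2; ring
  have hY' : ∀ s, HasDerivAt Y ((∫ x, d x * MA (fun y => w y + (g y + s * d y)) x) - (1 - s) ^ N * h) s := by
    intro s
    have e := (((hasDerivAt_id s).const_sub 1).pow (N + 1)).mul_const (h / (N + 1))
    refine ((Jen_deriv hw hg hd hgs hds s).add e).congr_deriv ?_
    simp only [id, Nat.add_sub_cancel]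
    push_cast
    field_simp
    ring
  have hmono : MonotoneOn Y (Set.Icc 0 1) := by
    apply monotoneOn_of_deriv_nonneg (convex_Icc 0 1)
    · exact fun t _ => (hY' t).continuousAt.continuousWithinAt
    · exact fun t _ => (hY' t).differentiableAt.differentiableWithinAt
    · intro s hs
      rw [interior_Icc] at hs
      rw [(hY' s).deriv, hh, ← integral_const_mul, sub_nonneg]
      have e : (fun y => w y + (g y + s * d y)) = fun y => (w y + g y) + s * d y := by ext y; ring
      rw [e]
      refine integral_mono ?_ ?_ fun x => ?_
      · exact ((hd.continuous.mul (MA_cont h0.1)).integrable_of_hasCompactSupport hds.mul_right).const_mul _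
      · exact (hd.continuous.mul (MA_cont (h0.1.add (contDiff_const.mul hd)))).integrable_of_hasCompactSupport hds.mul_right
      · have := mul_le_mul_of_nonneg_left (MA_det_path h0 h1' hd s hs.1.le hs.2.le x) (hd0 x)
        simp only
        linarith
  have h01 := hmono (Set.left_mem_Icc.mpr zero_le_one) (Set.right_mem_Icc.mpr zero_le_one) zero_le_one
  simp only [hY, zero_mul, add_zero, sub_zero, one_pow, one_mul, sub_self] at h01
  rw [zero_pow (by omega), zero_mul, add_zero] at h01
  have h3 : h / (N + 1) ≤ Jen w (fun y => g y + d y) - Jen w g := by linarith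
  rw [div_le_iff₀ hN] at h3
  linarith

theorem Jen_nonpos {w g : (Fin N → ℂ) → ℝ} (hw : Sp w) (hg : ContDiff ℝ ∞ g)
    (hg0 : ∀ x, g x ≤ 0) (h1 : Sp fun x => w x + g x) : Jen w g ≤ 0 := by
  unfold Jen
  rw [← neg_nonneg, ← intervalIntegral.integral_neg]
  refine intervalIntegral.integral_nonneg zero_le_one fun t ht => ?_
  rw [← integral_neg]
  refine integral_nonneg fun x => ?_
  have := (hw.path h1 hg t ht.1 ht.2).MA_nonneg x
  have := mul_nonneg (neg_nonneg.mpr (hg0 x)) this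
  simp only [Pi.zero_apply]
  linarith

theorem Jen_bound {w g θ : (Fin N → ℂ) → ℝ} (hw : Sp w) (hg : ContDiff ℝ ∞ g)
    (hgs : HasCompactSupport g) (B : ℝ) (hg0 : ∀ x, -B ≤ g x) (h1 : Sp fun x => w x + g x)
    (hθ : ContDiff ℝ ∞ θ) (hθs : HasCompactSupport θ) (hθ0 : ∀ x, 0 ≤ θ x)
    (hθ1 : ∀ x ∈ tsupport g, θ =ᶠ[nhds x] fun _ => 1) :
    - (B * ∫ x, θ x * MA w x) ≤ Jen w g := by
  have hm := mass_path hw.1 hg hgs hθ hθs hθ1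
  have hc := (MA_vv_cont hw.1 hg hg hg.continuous hgs).comp
    (show Continuous fun t : ℝ => ((t, 0) : ℝ × ℝ) by fun_prop)
  have e : ∀ t : ℝ, vv w g g t 0 = fun y => w y + t * g y := by
    intro t; ext y; simp [vv]
  simp only [Function.comp_def, e] at hc
  have := intervalIntegral.integral_mono_on (μ := volume) (a := 0) (b := 1)
    (f := fun _ => - (B * ∫ x, θ x * MA w x)) zero_le_one (by simp)
    (hc.intervalIntegrable _ _) (fun t ht => ?_)
  · simpa [Jen] using this
  · have hvt := hw.path h1 hg t ht.1 ht.2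
    rw [← hm t, ← integral_const_mul, ← integral_neg]
    refine integral_mono ?_ ?_ fun x => ?_
    · exact (((hθ.continuous.mul (MA_cont hvt.1)).integrable_of_hasCompactSupport hθs.mul_right).const_mul _).neg
    · exact (hg.continuous.mul (MA_cont hvt.1)).integrable_of_hasCompactSupport hgs.mul_right
    · have hma := hvt.MA_nonneg x
      simp only
      by_cases hx : x ∈ tsupport g
      · rw [(hθ1 x hx).eq_of_nhds]
        have := mul_le_mul_of_nonneg_right (hg0 x) hma
        linarith
      · rw [image_eq_zero_of_notMem_tsupport hx]
        have hB : 0 ≤ B := by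
          have := hg0 x; rw [image_eq_zero_of_notMem_tsupport hx] at this; linarith
        have := mul_nonneg hB (mul_nonneg (hθ0 x) hma)
        linarith

/-- comparison with the base measure -/
theorem I_mono {w g : (Fin N → ℂ) → ℝ} (hw : Sp w) (hg : ContDiff ℝ ∞ g)
    (hgs : HasCompactSupport g) (h1 : Sp fun x => w x + g x) :
    ∫ x, g x * MA (fun y => w y + g y) x ≤ ∫ x, g x * MA w x := by
  have hder := fun t => MA_int_deriv hw.1 hg hg.continuous hgs t
  have hanti : AntitoneOn (fun t : ℝ => ∫ x, g x * MA (fun y => w y + t * g y) x) (Set.Icc 0 1) := by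
    apply antitoneOn_of_deriv_nonpos (convex_Icc 0 1)
    · exact fun t _ => (hder t).continuousAt.continuousWithinAt
    · exact fun t _ => (hder t).differentiableAt.differentiableWithinAt
    · intro t ht
      rw [interior_Icc] at ht
      have hvt := hw.path h1 hg t ht.1.le ht.2.le
      rw [(hder t).deriv, int_Gam hvt.1 hg hg hgs, neg_nonpos]
      exact integral_nonneg fun x => Gam_self_nonneg hvt.1 hg x (hvt.psd x)
  have := hanti (Set.left_mem_Icc.mpr zero_le_one) (Set.right_mem_Icc.mpr zero_le_one) zero_le_one
  simpa using this

end Energy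


section SubMean
set_option linter.unusedSimpArgs false
set_option linter.unusedVariables false
open Matrix MeasureTheory
open scoped ContDiff ComplexOrder
variable {N : ℕ}

/-- the reference potential -/
def om (x : Fin N → ℂ) : ℝ := ∑ j, ((x j).re ^ 2 + (x j).im ^ 2)

theorem om_cd : ContDiff ℝ ∞ (om : (Fin N → ℂ) → ℝ) := by
  unfold om
  refine ContDiff.sum fun j _ => ?_
  have h : ContDiff ℝ ∞ fun x : Fin N → ℂ => x j := contDiff_apply ℝ ℂ j
  exact ((Complex.reCLM.contDiff.comp h).pow 2).add ((Complex.imCLM.contDiff.comp h).pow 2)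

theorem om_nonneg (x : Fin N → ℂ) : 0 ≤ om x := Finset.sum_nonneg fun j _ => by positivity

theorem om_smul (c : ℂ) (x : Fin N → ℂ) : om (c • x) = ‖c‖ ^ 2 * om x := by
  unfold om
  rw [Finset.mul_sum]
  refine Finset.sum_congr rfl fun j _ => ?_
  rw [← Complex.normSq_eq_norm_sq, Complex.normSq_apply]
  simp only [Pi.smul_apply, smul_eq_mul, Complex.mul_re, Complex.mul_im]
  ring

theorem om_rsmul (c : ℝ) (x : Fin N → ℂ) : om (c • x) = c ^ 2 * om x := by
  have := om_smul (c : ℂ) x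
  simpa using this

theorem om_le (x : Fin N → ℂ) : om x ≤ N * ‖x‖ ^ 2 := by
  unfold om
  have : ∀ j ∈ Finset.univ, (x j).re ^ 2 + (x j).im ^ 2 ≤ ‖x‖ ^ 2 := by
    intro j _
    have h1 : (x j).re ^ 2 + (x j).im ^ 2 = ‖x j‖ ^ 2 := by
      rw [← Complex.normSq_eq_norm_sq, Complex.normSq_apply]; ring
    rw [h1]
    exact pow_le_pow_left₀ (norm_nonneg _) (norm_le_pi_norm x j) 2
  simpa using Finset.sum_le_sum this

theorem le_om (x : Fin N → ℂ) : ‖x‖ ^ 2 ≤ om x := by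
  have h : ‖x‖ ≤ Real.sqrt (om x) := by
    rw [pi_norm_le_iff_of_nonneg (Real.sqrt_nonneg _)]
    intro j
    apply Real.le_sqrt_of_sq_le
    rw [← Complex.normSq_eq_norm_sq, Complex.normSq_apply]
    have := Finset.single_le_sum (f := fun j => (x j).re ^ 2 + (x j).im ^ 2)
      (fun i _ => by positivity) (Finset.mem_univ j)
    unfold om
    linarith
  calc ‖x‖ ^ 2 ≤ (Real.sqrt (om x)) ^ 2 := pow_le_pow_left₀ (norm_nonneg _) h 2
    _ = om x := Real.sq_sqrt (om_nonneg x)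

/-- bilinear form of om -/
def omB (x y : Fin N → ℂ) : ℝ := ∑ j, ((x j).re * (y j).re + (x j).im * (y j).im)

theorem om_add_smul (x ξ : Fin N → ℂ) (t : ℝ) :
    om (x + t • ξ) = om x + 2 * t * omB x ξ + t ^ 2 * om ξ := by
  simp only [om, omB, Finset.mul_sum, ← Finset.sum_add_distrib]
  refine Finset.sum_congr rfl fun j _ => ?_
  simp only [Pi.add_apply, Pi.smul_apply, Complex.add_re, Complex.add_im, Complex.real_smul,
    Complex.mul_re, Complex.mul_im, Complex.ofReal_re, Complex.ofReal_im]
  ring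

theorem line_d1 {u : (Fin N → ℂ) → ℝ} (hu : Differentiable ℝ u) (x ξ : Fin N → ℂ) (t : ℝ) :
    HasDerivAt (fun t : ℝ => u (x + t • ξ)) (fderiv ℝ u (x + t • ξ) ξ) t := by
  have h : HasDerivAt (fun t : ℝ => x + t • ξ) ξ t := by
    simpa using ((hasDerivAt_id t).smul_const ξ).const_add x
  exact (hu (x + t • ξ)).hasFDerivAt.comp_hasDerivAt t h

theorem line_d2 {u : (Fin N → ℂ) → ℝ} (hu : ContDiff ℝ ∞ u) (x ξ η : Fin N → ℂ) (t : ℝ) :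
    HasDerivAt (fun t : ℝ => fderiv ℝ u (x + t • η) ξ) (D2 u (x + t • η) ξ η) t :=
  line_d1 (cd_diff (cd_fderiv_apply hu ξ)) x η t

theorem fderiv_om (x ξ : Fin N → ℂ) : fderiv ℝ om x ξ = 2 * omB x ξ := by
  have h1 := line_d1 (cd_diff (om_cd (N := N))) x ξ 0
  simp only [om_add_smul, zero_smul, add_zero] at h1
  refine h1.unique ?_
  have := (((hasDerivAt_id (0:ℝ)).const_mul 2).mul_const (omB x ξ)).const_add (om x) |>.add
    (((hasDerivAt_id (0:ℝ)).pow 2).mul_const (om ξ))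
  refine this.congr_deriv ?_
  simp

theorem omB_add_smul (x η ξ : Fin N → ℂ) (t : ℝ) : omB (x + t • η) ξ = omB x ξ + t * omB η ξ := by
  simp only [omB, Finset.mul_sum, ← Finset.sum_add_distrib]
  refine Finset.sum_congr rfl fun j _ => ?_
  simp only [Pi.add_apply, Pi.smul_apply, Complex.add_re, Complex.add_im, Complex.real_smul,
    Complex.mul_re, Complex.mul_im, Complex.ofReal_re, Complex.ofReal_im]
  ring

theorem D2_om (x ξ η : Fin N → ℂ) : D2 om x ξ η = 2 * omB η ξ := by
  have h1 := line_d2 (om_cd (N := N)) x ξ η 0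
  simp only [fderiv_om, omB_add_smul, zero_smul, add_zero] at h1
  refine h1.unique ?_
  have := (((hasDerivAt_id (0:ℝ)).mul_const (omB η ξ)).const_add (omB x ξ)).const_mul 2
  refine this.congr_deriv ?_
  simp

theorem omB_self (x : Fin N → ℂ) : omB x x = om x := by
  simp only [om, omB]; refine Finset.sum_congr rfl fun j _ => by ring

theorem D2_om_levi (x ξ : Fin N → ℂ) :
    D2 om x ξ ξ + D2 om x (Complex.I • ξ) (Complex.I • ξ) = 4 * om ξ := by
  rw [D2_om, D2_om, omB_self, omB_self, om_smul]; simp; ring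

theorem om_sp : Sp (om : (Fin N → ℂ) → ℝ) :=
  ⟨om_cd, fun x ξ => by rw [D2_om_levi]; linarith [om_nonneg ξ]⟩

theorem hess_om (x : Fin N → ℂ) : hess om x = 1 := by
  ext a b
  simp only [hess, hessB, of_apply, D2_om, omB]
  by_cases hab : a = b
  · subst hab
    simp only [one_apply_eq, Pi.single_apply]
    have h1 : ∀ (z w : ℂ), ∑ j, (((if j = a then z else 0 : ℂ).re * (if j = a then w else 0 : ℂ).re
      + (if j = a then z else 0 : ℂ).im * (if j = a then w else 0 : ℂ).im)) = z.re * w.re + z.im * w.im := by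
      intro z w
      rw [Finset.sum_eq_single a]
      · simp
      · intro j _ hj; simp [hj]
      · simp
    simp only [h1]
    norm_num
  · have h1 : ∀ (z w : ℂ), ∑ j, (((Pi.single b z : Fin N → ℂ) j).re * ((Pi.single a w : Fin N → ℂ) j).re
      + ((Pi.single b z : Fin N → ℂ) j).im * ((Pi.single a w : Fin N → ℂ) j).im) = 0 := by
      intro z w
      refine Finset.sum_eq_zero fun j _ => ?_
      by_cases hj : j = a
      · subst hj; simp [Pi.single_apply, hab]
      · simp [Pi.single_apply, hj]
    simp [h1, one_apply_ne hab]

theorem MA_om (x : Fin N → ℂ) : MA om x = 1 := by simp [MA, hess_om]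

/-- `om`-plurisubharmonic smooth functions -/
def Osp (g : (Fin N → ℂ) → ℝ) : Prop :=
  ContDiff ℝ ∞ g ∧ ∀ x ξ, -(4 * om ξ) ≤ D2 g x ξ ξ + D2 g x (Complex.I • ξ) (Complex.I • ξ)

theorem Osp.sp {g : (Fin N → ℂ) → ℝ} (hg : Osp g) : Sp fun x => om x + g x := by
  refine ⟨om_cd.add hg.1, fun x ξ => ?_⟩
  rw [D2_add om_cd hg.1, D2_add om_cd hg.1]
  linarith [D2_om_levi x ξ, hg.2 x ξ]

theorem Sp.osp {u : (Fin N → ℂ) → ℝ} (hu : Sp u) : Osp fun x => u x - om x := by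
  have e : (fun x => u x - om x) = fun x => u x + (-1) * om x := by ext x; ring
  rw [e]
  refine ⟨hu.1.add (contDiff_const.mul om_cd), fun x ξ => ?_⟩
  rw [D2_add hu.1 (contDiff_const.mul om_cd), D2_add hu.1 (contDiff_const.mul om_cd),
    D2_smul om_cd, D2_smul om_cd]
  linarith [D2_om_levi x ξ, hu.2 x ξ]

/-- derivative of interval integrals with a parameter -/
theorem ii_deriv {F F' : ℝ → ℝ → ℝ} (a b : ℝ) (hF : Continuous (Function.uncurry F))
    (hF' : Continuous (Function.uncurry F')) (hd : ∀ s t, HasDerivAt (fun s => F s t) (F' s t) s)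
    (s : ℝ) : HasDerivAt (fun s => ∫ t in a..b, F s t) (∫ t in a..b, F' s t) s := by
  obtain ⟨C, hC⟩ := ((isCompact_closedBall s 1).prod (isCompact_uIcc (a := a) (b := b))).exists_bound_of_continuousOn
    (f := Function.uncurry F') hF'.continuousOn
  refine (intervalIntegral.hasDerivAt_integral_of_dominated_loc_of_deriv_le
      (F := F) (F' := F') (bound := fun _ => C) (s := closedBall s 1)
      (closedBall_mem_nhds s one_pos) ?_ ?_ ?_ ?_ ?_ ?_).2
  · exact Eventually.of_forall fun s =>
        (hF.comp (Continuous.prodMk_right s)).aestronglyMeasurable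
  · exact (hF.comp (Continuous.prodMk_right s)).intervalIntegrable _ _
  · exact (hF'.comp (Continuous.prodMk_right s)).aestronglyMeasurable
  · exact Eventually.of_forall fun t ht r hr => hC (r, t) ⟨hr, Set.uIoc_subset_uIcc ht⟩
  · simp
  · exact Eventually.of_forall fun t _ r _ => hd r t

/-- point on the circle -/
def cpt (x ξ : Fin N → ℂ) (θ : ℝ) : Fin N → ℂ := x + Complex.exp (θ * Complex.I) • ξ

theorem cpt_cont (x ξ : Fin N → ℂ) : Continuous (cpt x ξ) := by
  unfold cpt; fun_prop

/-- curve second derivative -/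
theorem curve_d2 {u : (Fin N → ℂ) → ℝ} (hu : ContDiff ℝ ∞ u) {c c' : ℝ → Fin N → ℂ}
    {c'' : Fin N → ℂ} {s : ℝ} (h1 : HasDerivAt c (c' s) s) (h2 : HasDerivAt c' c'' s) :
    HasDerivAt (fun s => fderiv ℝ u (c s) (c' s))
      (D2 u (c s) (c' s) (c' s) + fderiv ℝ u (c s) c'') s := by
  have hd : DifferentiableAt ℝ (fderiv ℝ u) (c s) :=
    (hu.fderiv_right (m := ∞) (by simp)).differentiable (by simp) _
  have := (hd.hasFDerivAt.comp_hasDerivAt s h1).clm_apply h2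
  refine this.congr_deriv ?_
  rw [← D2L_apply hu]
  rfl

theorem osp_submean {g : (Fin N → ℂ) → ℝ} (hg : Osp g) (x ξ : Fin N → ℂ) :
    2 * Real.pi * g x ≤ (∫ θ in (0:ℝ)..(2 * Real.pi), g (cpt x ξ θ)) + 2 * Real.pi * om ξ := by
  set E : ℝ → ℝ → ℂ := fun s θ => Complex.exp (s + θ * Complex.I) with hE
  set P : ℝ → ℝ → (Fin N → ℂ) := fun s θ => x + E s θ • ξ with hP
  have hEs : ∀ s θ, HasDerivAt (fun s => E s θ) (E s θ) s := by
    intro s θ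
    have h : HasDerivAt (fun s : ℝ => (s : ℂ) + θ * Complex.I) 1 s :=
      (Complex.ofRealCLM.hasDerivAt (x := s)).add_const _
    refine ((Complex.hasDerivAt_exp _).comp s h).congr_deriv ?_
    simp [hE]
  have hEt : ∀ s θ, HasDerivAt (fun θ => E s θ) (Complex.I * E s θ) θ := by
    intro s θ
    have h : HasDerivAt (fun θ : ℝ => (s : ℂ) + θ * Complex.I) Complex.I θ := by
      simpa using ((Complex.ofRealCLM.hasDerivAt (x := θ)).mul_const Complex.I).const_add (s : ℂ)
    refine ((Complex.hasDerivAt_exp _).comp θ h).congr_deriv ?_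
    simp [hE, mul_comm]
  have hEc : Continuous (fun p : ℝ × ℝ => E p.1 p.2) := by
    simp only [hE]; fun_prop
  have hPc : Continuous (fun p : ℝ × ℝ => P p.1 p.2) := by
    simp only [hP]; exact continuous_const.add (hEc.smul continuous_const)
  have hf1 : Continuous (fderiv ℝ g) := (hg.1.fderiv_right (m := ∞) (by simp)).continuous
  have hf2 : Continuous (fderiv ℝ (fderiv ℝ g)) :=
    ((hg.1.fderiv_right (m := ∞) (by simp)).fderiv_right (m := ∞) (by simp)).continuous
  have hD2e : ∀ y η, D2 g y η η = fderiv ℝ (fderiv ℝ g) y η η := fun y η => by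
    rw [← D2L_apply hg.1]; rfl
  set G1 : ℝ → ℝ → ℝ := fun s θ => fderiv ℝ g (P s θ) (E s θ • ξ) with hG1
  set G2 : ℝ → ℝ → ℝ := fun s θ => D2 g (P s θ) (E s θ • ξ) (E s θ • ξ)
    + fderiv ℝ g (P s θ) (E s θ • ξ) with hG2
  set T1 : ℝ → ℝ → ℝ := fun s θ => fderiv ℝ g (P s θ) ((Complex.I * E s θ) • ξ) with hT1
  set T2 : ℝ → ℝ → ℝ := fun s θ => D2 g (P s θ) ((Complex.I * E s θ) • ξ) ((Complex.I * E s θ) • ξ)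
    + fderiv ℝ g (P s θ) ((Complex.I * (Complex.I * E s θ)) • ξ) with hT2
  have cG : Continuous (Function.uncurry fun s θ => g (P s θ)) := hg.1.continuous.comp hPc
  have cG1 : Continuous (Function.uncurry G1) :=
    (hf1.comp hPc).clm_apply (hEc.smul continuous_const)
  have cG2 : Continuous (Function.uncurry G2) := by
    simp only [hG2, hD2e]
    exact (((hf2.comp hPc).clm_apply (hEc.smul continuous_const)).clm_apply
      (hEc.smul continuous_const)).add cG1
  have hE' : Continuous fun p : ℝ × ℝ => (Complex.I * E p.1 p.2) • ξ :=
    (continuous_const.mul hEc).smul continuous_const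
  have cT2 : Continuous (Function.uncurry T2) := by
    simp only [hT2, hD2e]
    exact (((hf2.comp hPc).clm_apply hE').clm_apply hE').add
      ((hf1.comp hPc).clm_apply ((continuous_const.mul (continuous_const.mul hEc)).smul continuous_const))
  have d1 : ∀ s θ, HasDerivAt (fun s => g (P s θ)) (G1 s θ) s := fun s θ =>
    (cd_diff hg.1 _).hasFDerivAt.comp_hasDerivAt s (((hEs s θ).smul_const ξ).const_add x)
  have d2 : ∀ s θ, HasDerivAt (fun s => G1 s θ) (G2 s θ) s := fun s θ =>
    curve_d2 (c := fun s => P s θ) (c' := fun s => E s θ • ξ) hg.1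
      (((hEs s θ).smul_const ξ).const_add x) ((hEs s θ).smul_const ξ)
  have dT : ∀ s θ, HasDerivAt (fun θ => T1 s θ) (T2 s θ) θ := fun s θ =>
    curve_d2 (c := fun θ => P s θ) (c' := fun θ => (Complex.I * E s θ) • ξ) hg.1
      (((hEt s θ).smul_const ξ).const_add x) (((hEt s θ).const_mul _).smul_const ξ)
  have hper : ∀ s, E s (2 * Real.pi) = E s 0 := by
    intro s
    simp only [hE, Complex.ofReal_mul, Complex.ofReal_ofNat, Complex.ofReal_zero, zero_mul, add_zero]
    rw [Complex.exp_add, Complex.exp_two_pi_mul_I, mul_one]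
  have hT0 : ∀ s, ∫ θ in (0:ℝ)..(2 * Real.pi), T2 s θ = 0 := by
    intro s
    rw [intervalIntegral.integral_eq_sub_of_hasDerivAt (fun t _ => dT s t)
      ((cT2.comp (Continuous.prodMk_right s)).intervalIntegrable _ _)]
    simp only [hT1, hP, hper, sub_self]
  have hpi := Real.pi_pos
  set M : ℝ → ℝ := fun s => (∫ θ in (0:ℝ)..(2 * Real.pi), g (P s θ))
    + 2 * Real.pi * om ξ * Real.exp (2 * s) with hM
  set M1 : ℝ → ℝ := fun s => (∫ θ in (0:ℝ)..(2 * Real.pi), G1 s θ)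
    + 2 * Real.pi * om ξ * (Real.exp (2 * s) * 2) with hM1
  set M2 : ℝ → ℝ := fun s => (∫ θ in (0:ℝ)..(2 * Real.pi), G2 s θ)
    + 2 * Real.pi * om ξ * (Real.exp (2 * s) * 2 * 2) with hM2
  have hexp : ∀ s : ℝ, HasDerivAt (fun s : ℝ => Real.exp (2 * s)) (Real.exp (2 * s) * 2) s := by
    intro s
    have := ((hasDerivAt_id s).const_mul 2).exp
    simpa using this
  have dM : ∀ s, HasDerivAt M (M1 s) s := fun s =>
    (ii_deriv _ _ cG cG1 d1 s).add ((hexp s).const_mul _)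
  have dM1 : ∀ s, HasDerivAt M1 (M2 s) s := fun s =>
    (ii_deriv _ _ cG1 cG2 d2 s).add (((hexp s).mul_const 2).const_mul _)
  have hM2n : ∀ s, 0 ≤ M2 s := by
    intro s
    have hsum : (∫ θ in (0:ℝ)..(2 * Real.pi), G2 s θ)
        = ∫ θ in (0:ℝ)..(2 * Real.pi), (G2 s θ + T2 s θ) := by
      have hadd := intervalIntegral.integral_add (μ := volume) (a := 0) (b := 2 * Real.pi)
        (f := G2 s) (g := T2 s) ?_ ?_
      · rw [hadd, hT0, add_zero]
      · exact (cG2.comp (Continuous.prodMk_right s)).intervalIntegrable _ _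
      · exact (cT2.comp (Continuous.prodMk_right s)).intervalIntegrable _ _
    have hle : ∀ θ, -(4 * om ξ * Real.exp (2 * s)) ≤ G2 s θ + T2 s θ := by
      intro θ
      have h1 := hg.2 (P s θ) (E s θ • ξ)
      have e1 : Complex.I • E s θ • ξ = (Complex.I * E s θ) • ξ := smul_smul _ _ _
      have e2 : fderiv ℝ g (P s θ) ((Complex.I * (Complex.I * E s θ)) • ξ)
          = - fderiv ℝ g (P s θ) (E s θ • ξ) := by
        rw [← map_neg, ← neg_smul, ← mul_assoc, Complex.I_mul_I, neg_one_mul]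
      rw [e1, om_smul] at h1
      have e3 : ‖E s θ‖ ^ 2 = Real.exp (2 * s) := by
        simp only [hE]
        rw [Complex.norm_exp, ← Real.exp_nat_mul]
        simp
      rw [e3] at h1
      simp only [hG2, hT2, e2]
      linarith
    have hInt := intervalIntegral.integral_mono_on (μ := volume) (a := 0) (b := 2 * Real.pi)
      (f := fun _ => -(4 * om ξ * Real.exp (2 * s))) (by positivity) (by simp)
      (g := fun θ => G2 s θ + T2 s θ)
      (((cG2.comp (Continuous.prodMk_right s)).add
        (cT2.comp (Continuous.prodMk_right s))).intervalIntegrable _ _) (fun θ _ => hle θ)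
    rw [intervalIntegral.integral_const] at hInt
    simp only [smul_eq_mul, sub_zero] at hInt
    simp only [hM2, hsum]
    linarith
  have hconv : ConvexOn ℝ Set.univ M := by
    have hm1 : deriv M = M1 := funext fun s => (dM s).deriv
    refine convexOn_univ_of_deriv2_nonneg (fun s => (dM s).differentiableAt) ?_ ?_
    · rw [hm1]; exact fun s => (dM1 s).differentiableAt
    · intro s
      rw [Function.iterate_succ, Function.iterate_one, Function.comp, hm1, (dM1 s).deriv]
      exact hM2n s
  have hlim : Tendsto M atBot (nhds (2 * Real.pi * g x)) := by
    set H : ℝ → ℝ := fun r => (∫ θ in (0:ℝ)..(2 * Real.pi), g (x + ((r : ℂ) * Complex.exp (θ * Complex.I)) • ξ))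
      + 2 * Real.pi * om ξ * r ^ 2 with hH
    have hHc : Continuous H := by
      refine Continuous.add ?_ (by fun_prop)
      refine intervalIntegral.continuous_parametric_intervalIntegral_of_continuous' (f := fun (r θ : ℝ) => g (x + ((r : ℂ) * Complex.exp (θ * Complex.I)) • ξ)) ?_ _ _
      refine hg.1.continuous.comp ?_
      fun_prop
    have e : M = fun s => H (Real.exp s) := by
      ext s
      simp only [hM, hH, hP, hE, Complex.ofReal_exp, ← Complex.exp_add]
      rw [← Real.exp_nat_mul]; norm_num
    have h0 : H 0 = 2 * Real.pi * g x := by simp [hH]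
    rw [e, ← h0]
    exact (hHc.tendsto 0).comp Real.tendsto_exp_atBot
  have hM0 : M 0 = (∫ θ in (0:ℝ)..(2 * Real.pi), g (cpt x ξ θ)) + 2 * Real.pi * om ξ := by
    simp [hM, hP, hE, cpt]
  rw [← hM0]
  have h2 : ∀ s, M (s * (1/2)) ≤ (1/2) * M s + (1/2) * M 0 := by
    intro s
    have := hconv.2 (Set.mem_univ s) (Set.mem_univ 0) (by norm_num : (0:ℝ) ≤ 1/2)
      (by norm_num : (0:ℝ) ≤ 1/2) (by norm_num)
    simp only [smul_eq_mul, mul_zero, add_zero] at this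
    rw [mul_comm s]; exact this
  have h3 : Tendsto (fun s : ℝ => M (s * (1/2))) atBot (nhds (2 * Real.pi * g x)) :=
    hlim.comp (tendsto_id.atBot_mul_const (by norm_num))
  have h4 := le_of_tendsto_of_tendsto' h3 ((hlim.const_mul (1/2)).add_const ((1/2) * M 0)) h2
  linarith

end SubMean


section Moll
set_option linter.unusedSimpArgs false
set_option linter.unusedVariables false
open Matrix MeasureTheory
open scoped ContDiff ComplexOrder
variable {N : ℕ}

theorem second_test {h h' : ℝ → ℝ} {c : ℝ} (h1 : ∀ r, HasDerivAt h (h' r) r)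
    (h2 : HasDerivAt h' c 0) (hm : ∀ r, h 0 ≤ h r) : 0 ≤ c := by
  by_contra hc
  push Not at hc
  have hd : deriv h = h' := funext fun r => (h1 r).deriv
  have h0 : h' 0 = 0 := by
    have : IsLocalMin h 0 := Eventually.of_forall hm
    exact this.hasDerivAt_eq_zero (h1 0)
  have hmax : IsLocalMax h 0 := isLocalMax_of_deriv_deriv_neg
    (by rw [hd, h2.deriv]; exact hc) (by rw [hd, h0]) (h1 0).continuousAt
  have hev : h =ᶠ[nhds 0] fun _ => h 0 := by
    filter_upwards [hmax] with r hr
    exact le_antisymm hr (hm r)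
  have hev' : h' =ᶠ[nhds 0] fun _ => (0:ℝ) := by
    have := hev.deriv
    rw [hd] at this
    simpa using this
  have := hev'.hasDerivAt_iff.1 h2
  have := this.unique (hasDerivAt_const 0 (0:ℝ))
  linarith

/-- second derivative from a quadratic expansion along a line -/
theorem D2_of_quad {u : (Fin N → ℂ) → ℝ} (hu : ContDiff ℝ ∞ u) (x ξ : Fin N → ℂ) (c0 c1 c2 : ℝ)
    (h : ∀ t : ℝ, u (x + t • ξ) = c0 + c1 * t + c2 * t ^ 2) : D2 u x ξ ξ = 2 * c2 := by
  have e : (fun t : ℝ => u (x + t • ξ)) = fun t => c0 + c1 * t + c2 * t ^ 2 := funext h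
  have h1 : ∀ t : ℝ, fderiv ℝ u (x + t • ξ) ξ = c1 + 2 * c2 * t := by
    intro t
    have a := line_d1 (cd_diff hu) x ξ t
    rw [e] at a
    refine a.unique ?_
    refine (((hasDerivAt_const t c0).add ((hasDerivAt_id t).const_mul c1)).add
      (((hasDerivAt_id t).pow 2).const_mul c2)).congr_deriv ?_
    simp; ring
  have a := line_d2 hu x ξ ξ 0
  rw [show (fun t : ℝ => fderiv ℝ u (x + t • ξ) ξ) = fun t => c1 + 2 * c2 * t from funext h1] at a
  simp only [zero_smul, add_zero] at a
  refine a.unique ?_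
  refine ((hasDerivAt_const (0:ℝ) c1).add ((hasDerivAt_id (0:ℝ)).const_mul (2*c2))).congr_deriv ?_
  simp

theorem D2_rot {u : (Fin N → ℂ) → ℝ} (hu : ContDiff ℝ ∞ u) (x ξ : Fin N → ℂ) (θ : ℝ) :
    D2 u x (Complex.exp (θ * Complex.I) • ξ) (Complex.exp (θ * Complex.I) • ξ) =
      Real.cos θ ^ 2 * D2 u x ξ ξ + 2 * (Real.sin θ * Real.cos θ) * D2 u x ξ (Complex.I • ξ)
        + Real.sin θ ^ 2 * D2 u x (Complex.I • ξ) (Complex.I • ξ) := by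
  have e : Complex.exp (θ * Complex.I) • ξ = Real.cos θ • ξ + Real.sin θ • (Complex.I • ξ) := by
    ext j
    simp [Complex.exp_mul_I, Complex.real_smul]; ring
  rw [e]
  simp only [← D2L_apply hu]
  simp only [map_add, map_smul, LinearMap.add_apply, LinearMap.smul_apply, smul_eq_mul]
  rw [D2L_symm hu x (Complex.I • ξ) ξ]; ring

theorem osp_of_submean {g : (Fin N → ℂ) → ℝ} (hg : ContDiff ℝ ∞ g)
    (h : ∀ x ξ, 2 * Real.pi * g x ≤ (∫ θ in (0:ℝ)..(2 * Real.pi), g (cpt x ξ θ))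
      + 2 * Real.pi * om ξ) : Osp g := by
  refine ⟨hg, fun x ξ => ?_⟩
  have hgc := hg.continuous
  have hd := cd_diff hg
  set e : ℝ → ℂ := fun θ => Complex.exp (θ * Complex.I) with he
  have hec : Continuous e := by rw [he]; fun_prop
  have hfc : Continuous (fderiv ℝ g) := hg.continuous_fderiv (by simp)
  have hD : ∀ η ζ, Continuous fun y => D2 g y η ζ := fun η ζ =>
    (cd_fderiv_apply (cd_fderiv_apply hg η) ζ).continuous
  have d1 := fun r => ii_deriv (F := fun r θ => g (x + r • (e θ • ξ)))
    (F' := fun r θ => fderiv ℝ g (x + r • (e θ • ξ)) (e θ • ξ)) 0 (2 * Real.pi)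
    (by simp only [Function.uncurry_def]; fun_prop)
    (by simp only [Function.uncurry_def]
        exact (hfc.comp (by fun_prop)).clm_apply (by fun_prop))
    (fun s t => line_d1 hd x (e t • ξ) s) r
  have d2 := fun r => ii_deriv (F := fun r θ => fderiv ℝ g (x + r • (e θ • ξ)) (e θ • ξ))
    (F' := fun r θ => D2 g (x + r • (e θ • ξ)) (e θ • ξ) (e θ • ξ)) 0 (2 * Real.pi)
    (by simp only [Function.uncurry_def]
        exact (hfc.comp (by fun_prop)).clm_apply (by fun_prop))
    (by simp only [Function.uncurry_def, he, D2_rot hg]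
        have k : Continuous fun p : ℝ × ℝ => x + p.1 • (Complex.exp (p.2 * Complex.I) • ξ) := by fun_prop
        have k1 := (hD ξ ξ).comp k
        have k2 := (hD ξ (Complex.I • ξ)).comp k
        have k3 := (hD (Complex.I • ξ) (Complex.I • ξ)).comp k
        simp only [Function.comp_def] at k1 k2 k3
        fun_prop)
    (fun s t => line_d2 hg x (e t • ξ) (e t • ξ) s) r
  have key := second_test (h := fun r => (∫ θ in (0:ℝ)..(2 * Real.pi), g (x + r • (e θ • ξ)))
      + 2 * Real.pi * om ξ * r ^ 2)
    (h' := fun r => (∫ θ in (0:ℝ)..(2 * Real.pi), fderiv ℝ g (x + r • (e θ • ξ)) (e θ • ξ))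
      + 2 * Real.pi * om ξ * (2 * r))
    (c := (∫ θ in (0:ℝ)..(2 * Real.pi), D2 g (x + (0:ℝ) • (e θ • ξ)) (e θ • ξ) (e θ • ξ))
      + 2 * Real.pi * om ξ * 2)
    (fun r => (d1 r).add ((((hasDerivAt_id r).pow 2).const_mul _).congr_deriv (by simp)))
    ((d2 0).add ((((hasDerivAt_id (0:ℝ)).const_mul 2).const_mul _).congr_deriv (by simp)))
    (fun r => by
      have := h x (r • ξ)
      rw [om_rsmul] at this
      have e2 : ∀ θ, cpt x (r • ξ) θ = x + r • (e θ • ξ) := fun θ => by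
        simp only [cpt, he]; rw [smul_comm]
      simp only [e2] at this
      simp only [zero_smul, add_zero, intervalIntegral.integral_const, smul_eq_mul]
      nlinarith)
  simp only [zero_smul, add_zero, he, D2_rot hg] at key
  rw [intervalIntegral.integral_add (Continuous.intervalIntegrable (by fun_prop) _ _)
      (Continuous.intervalIntegrable (by fun_prop) _ _),
    intervalIntegral.integral_add (Continuous.intervalIntegrable (by fun_prop) _ _)
      (Continuous.intervalIntegrable (by fun_prop) _ _)] at key
  simp only [intervalIntegral.integral_mul_const, intervalIntegral.integral_const_mul,
    integral_cos_sq, integral_sin_sq, integral_sin_mul_cos₁] at key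
  simp at key
  have hp := Real.pi_pos
  nlinarith

/-- mollification -/
def mol (φ F : (Fin N → ℂ) → ℝ) (ρ : ℝ) (x : Fin N → ℂ) : ℝ := ∫ y, φ y * F (x - ρ • y)

theorem mol_eq (φ F : (Fin N → ℂ) → ℝ) {ρ : ℝ} (hρ : 0 < ρ) (x : Fin N → ℂ) :
    mol φ F ρ x = ρ⁻¹ ^ (Module.finrank ℝ (Fin N → ℂ)) *
      (convolution (fun y => φ (ρ⁻¹ • y)) F (ContinuousLinearMap.lsmul ℝ ℝ) volume) x := by
  have := Measure.integral_comp_smul (μ := (volume : Measure (Fin N → ℂ)))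
    (fun t => φ (ρ⁻¹ • t) * F (x - t)) ρ
  simp only [smul_smul, inv_mul_cancel₀ hρ.ne', one_smul] at this
  unfold mol
  rw [this, abs_of_pos (by positivity)]
  simp [convolution, inv_pow]

theorem mol_fderiv {φ F : (Fin N → ℂ) → ℝ} (hφ : ContDiff ℝ ∞ φ) (hs : HasCompactSupport φ)
    (hF : Continuous F) {ρ : ℝ} (hρ : 0 < ρ) :
    ContDiff ℝ ∞ (mol φ F ρ) ∧
    ∀ x ξ, fderiv ℝ (mol φ F ρ) x ξ = ρ⁻¹ * mol (fun y => fderiv ℝ φ y ξ) F ρ x := by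
  set ψ : (Fin N → ℂ) → ℝ := fun y => φ (ρ⁻¹ • y) with hψ
  have hψc : ContDiff ℝ ∞ ψ := hφ.comp (contDiff_const_smul _)
  have hψs : HasCompactSupport ψ := hs.comp_smul (inv_ne_zero hρ.ne')
  have e : mol φ F ρ = fun x => ρ⁻¹ ^ (Module.finrank ℝ (Fin N → ℂ)) *
      (convolution ψ F (ContinuousLinearMap.lsmul ℝ ℝ) volume) x := funext fun x => mol_eq φ F hρ x
  have hc : ContDiff ℝ ∞ (convolution ψ F (ContinuousLinearMap.lsmul ℝ ℝ) volume) :=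
    hψs.contDiff_convolution_left _ hψc hF.locallyIntegrable
  refine ⟨by rw [e]; exact contDiff_const.mul hc, fun x ξ => ?_⟩
  have hd := hψs.hasFDerivAt_convolution_left (ContinuousLinearMap.lsmul ℝ ℝ) (hψc.of_le (by simp))
    (hF.locallyIntegrable (μ := volume)) x
  rw [mol_eq _ _ hρ, e]
  rw [fderiv_const_mul hd.differentiableAt, hd.fderiv]
  rw [_root_.smul_apply, smul_eq_mul]
  rw [mul_left_comm]
  congr 1
  have hψd : ∀ t, fderiv ℝ ψ t ξ = ρ⁻¹ * fderiv ℝ φ (ρ⁻¹ • t) ξ := by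
    intro t
    have := ((cd_diff hφ (ρ⁻¹ • t)).hasFDerivAt.comp t ((hasFDerivAt_id (𝕜 := ℝ) t).const_smul ρ⁻¹))
    have h2 := this.fderiv
    change fderiv ℝ ψ t = _ at h2
    rw [h2]; simp
  unfold convolution
  rw [← integral_const_mul]
  rw [ContinuousLinearMap.integral_apply]
  · refine integral_congr_ae (Eventually.of_forall fun t => ?_)
    simp [ContinuousLinearMap.precompL_apply, hψd]; ring
  · refine Continuous.integrable_of_hasCompactSupport ?_ ?_
    · have := hψc.continuous_fderiv (by simp)
      have h3 : Continuous fun t => F (x - t) := by fun_prop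
      exact ((ContinuousLinearMap.precompL _ _).continuous.comp this).clm_apply h3
    · have h4 : HasCompactSupport (fderiv ℝ ψ) := hψs.fderiv (𝕜 := ℝ)
      refine h4.mono fun t ht => ?_
      rw [Function.mem_support] at ht ⊢
      intro h0
      exact ht (by simp [h0])

theorem mol_D2 {φ F : (Fin N → ℂ) → ℝ} (hφ : ContDiff ℝ ∞ φ) (hs : HasCompactSupport φ)
    (hF : Continuous F) {ρ : ℝ} (hρ : 0 < ρ) (x ξ η : Fin N → ℂ) :
    D2 (mol φ F ρ) x ξ η = ρ⁻¹ ^ 2 * mol (fun y => D2 φ y ξ η) F ρ x := by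
  have h1 := mol_fderiv hφ hs hF hρ
  have h2 := mol_fderiv (cd_fderiv_apply hφ ξ) (hs.fderiv_apply (𝕜 := ℝ) ξ) hF hρ
  unfold D2
  rw [show (fun y => fderiv ℝ (mol φ F ρ) y ξ) = fun y => ρ⁻¹ * mol (fun y => fderiv ℝ φ y ξ) F ρ y
    from funext fun y => h1.2 y ξ]
  rw [fderiv_const_mul (cd_diff h2.1 x), _root_.smul_apply, h2.2, smul_eq_mul]
  ring

theorem mol_integrable {φ F : (Fin N → ℂ) → ℝ} (hφ : Continuous φ) (hs : HasCompactSupport φ)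
    (hF : Continuous F) (ρ : ℝ) (x : Fin N → ℂ) : Integrable fun y => φ y * F (x - ρ • y) :=
  Continuous.integrable_of_hasCompactSupport (by fun_prop) hs.mul_right

/-- a fixed mollifier -/
structure Mlf (φ : (Fin N → ℂ) → ℝ) : Prop where
  cd : ContDiff ℝ ∞ φ
  cs : HasCompactSupport φ
  nn : ∀ x, 0 ≤ φ x
  int : ∫ x, φ x = 1
  supp : ∀ x, 1 < ‖x‖ → φ x = 0

theorem mlf_exists : ∃ φ : (Fin N → ℂ) → ℝ, Mlf φ := by
  let b : ContDiffBump (0 : Fin N → ℂ) := ⟨1/2, 1, by norm_num, by norm_num⟩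
  refine ⟨b.normed volume, b.contDiff_normed, b.hasCompactSupport_normed, b.nonneg_normed,
    b.integral_normed, fun x hx => ?_⟩
  have := b.support_normed_eq (μ := volume)
  by_contra h
  have h2 : x ∈ Function.support (b.normed volume) := h
  rw [this] at h2
  simp [b] at h2
  linarith

theorem mol_mono {φ F G : (Fin N → ℂ) → ℝ} (hφ : Mlf φ) (hF : Continuous F) (hG : Continuous G)
    (ρ : ℝ) (x : Fin N → ℂ) (h : ∀ y, ‖y‖ ≤ 1 → F (x - ρ • y) ≤ G (x - ρ • y)) :
    mol φ F ρ x ≤ mol φ G ρ x := by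
  refine integral_mono (mol_integrable hφ.cd.continuous hφ.cs hF ρ x)
    (mol_integrable hφ.cd.continuous hφ.cs hG ρ x) fun y => ?_
  by_cases hy : ‖y‖ ≤ 1
  · exact mul_le_mul_of_nonneg_left (h y hy) (hφ.nn y)
  · simp [hφ.supp y (not_le.1 hy)]

theorem mol_const {φ : (Fin N → ℂ) → ℝ} (hφ : Mlf φ) (c ρ : ℝ) (x : Fin N → ℂ) :
    mol φ (fun _ => c) ρ x = c := by
  simp [mol, integral_mul_const, hφ.int]

theorem mol_le {φ F : (Fin N → ℂ) → ℝ} (hφ : Mlf φ) (hF : Continuous F)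
    (ρ : ℝ) (x : Fin N → ℂ) (c : ℝ) (h : ∀ y, ‖y‖ ≤ 1 → F (x - ρ • y) ≤ c) : mol φ F ρ x ≤ c := by
  rw [← mol_const hφ c ρ x]; exact mol_mono hφ hF continuous_const ρ x h

theorem le_mol {φ F : (Fin N → ℂ) → ℝ} (hφ : Mlf φ) (hF : Continuous F)
    (ρ : ℝ) (x : Fin N → ℂ) (c : ℝ) (h : ∀ y, ‖y‖ ≤ 1 → c ≤ F (x - ρ • y)) : c ≤ mol φ F ρ x := by
  rw [← mol_const hφ c ρ x]; exact mol_mono hφ continuous_const hF ρ x h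

theorem mol_submean {φ F : (Fin N → ℂ) → ℝ} (hφ : Mlf φ) (hF : Continuous F) {ρ : ℝ} (hρ : 0 < ρ)
    (h : ∀ x ξ, 2 * Real.pi * F x ≤ (∫ θ in (0:ℝ)..(2 * Real.pi), F (cpt x ξ θ))
      + 2 * Real.pi * om ξ) : Osp (mol φ F ρ) := by
  refine osp_of_submean (mol_fderiv hφ.cd hφ.cs hF hρ).1 fun x ξ => ?_
  have hc := hφ.cd.continuous
  have hcpt : Continuous fun p : ℝ × (Fin N → ℂ) => cpt x ξ p.1 - ρ • p.2 := by
    unfold cpt; fun_prop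
  have sw : (∫ θ in (0:ℝ)..(2 * Real.pi), mol φ F ρ (cpt x ξ θ)) =
      ∫ y, φ y * ∫ θ in (0:ℝ)..(2 * Real.pi), F (cpt (x - ρ • y) ξ θ) := by
    unfold mol
    rw [intervalIntegral_integral_swap]
    · refine integral_congr_ae (Eventually.of_forall fun y => ?_)
      simp only
      rw [← intervalIntegral.integral_const_mul]
      refine intervalIntegral.integral_congr fun θ _ => ?_
      simp only [cpt]
      congr 2; abel
    · rw [Set.uIoc_of_le (by positivity)]
      have hcont : Continuous (Function.uncurry fun (θ : ℝ) (y : Fin N → ℂ) => φ y * F (cpt x ξ θ - ρ • y)) := by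
        simp only [Function.uncurry_def]
        exact (hc.comp continuous_snd).mul (hF.comp hcpt)
      have : IntegrableOn (Function.uncurry fun (θ : ℝ) (y : Fin N → ℂ) => φ y * F (cpt x ξ θ - ρ • y))
          (Set.Icc 0 (2 * Real.pi) ×ˢ tsupport φ) (volume.prod volume) :=
        hcont.continuousOn.integrableOn_compact (isCompact_Icc.prod hφ.cs.isCompact)
      have h2 : IntegrableOn (Function.uncurry fun (θ : ℝ) (y : Fin N → ℂ) => φ y * F (cpt x ξ θ - ρ • y))
          (Set.Icc 0 (2 * Real.pi) ×ˢ Set.univ) (volume.prod volume) := by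
        refine this.of_forall_sdiff_eq_zero (measurableSet_Icc.prod MeasurableSet.univ) ?_
        rintro ⟨θ, y⟩ hy
        have : y ∉ tsupport φ := fun h => hy.2 ⟨hy.1.1, h⟩
        simp [image_eq_zero_of_notMem_tsupport this]
      replace h2 := h2.mono_set (Set.prod_mono (Set.Ioc_subset_Icc_self (a := (0:ℝ))) subset_rfl)
      rw [IntegrableOn, ← Measure.prod_restrict, Measure.restrict_univ] at h2
      exact h2
  rw [sw]
  have hI : Continuous fun y : Fin N → ℂ => ∫ θ in (0:ℝ)..(2 * Real.pi), F (cpt (x - ρ • y) ξ θ) := by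
    refine intervalIntegral.continuous_parametric_intervalIntegral_of_continuous' ?_ _ _
    simp only [Function.uncurry_def, cpt]; fun_prop
  have i1 : Integrable fun y => φ y * ∫ θ in (0:ℝ)..(2 * Real.pi), F (cpt (x - ρ • y) ξ θ) :=
    Continuous.integrable_of_hasCompactSupport (hc.mul hI) hφ.cs.mul_right
  have i2 : Integrable fun y => φ y * (2 * Real.pi * om ξ) :=
    Continuous.integrable_of_hasCompactSupport (by fun_prop) hφ.cs.mul_right
  have e2 : ∫ y, φ y * (2 * Real.pi * om ξ) = 2 * Real.pi * om ξ := by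
    rw [integral_mul_const, hφ.int, one_mul]
  rw [← e2, ← integral_add i1 i2]
  unfold mol
  rw [← integral_const_mul]
  refine integral_mono ((mol_integrable hc hφ.cs hF ρ x).const_mul _) (i1.add i2) fun y => ?_
  have := mul_le_mul_of_nonneg_left (h (x - ρ • y) ξ) (hφ.nn y)
  simp only [Pi.add_apply]
  nlinarith

end Moll


section LogPsh
set_option linter.unusedSimpArgs false
set_option linter.unusedVariables false
open Matrix MeasureTheory
open scoped ContDiff ComplexOrder
variable {N : ℕ}

/-- Levi form -/
def Lev (u : (Fin N → ℂ) → ℝ) (x ξ : Fin N → ℂ) : ℝ :=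
  D2 u x ξ ξ + D2 u x (Complex.I • ξ) (Complex.I • ξ)

/-- log-plurisubharmonicity for nonnegative smooth functions -/
structure Lp (S : (Fin N → ℂ) → ℝ) : Prop where
  cd : ContDiff ℝ ∞ S
  nn : ∀ x, 0 ≤ S x
  lv : ∀ x ξ, 0 ≤ Lev S x ξ
  cs : ∀ x ξ, (fderiv ℝ S x ξ) ^ 2 + (fderiv ℝ S x (Complex.I • ξ)) ^ 2 ≤ S x * Lev S x ξ

theorem cs_aux {a1 b1 a2 b2 S T L M : ℝ} (hS : 0 ≤ S) (hT : 0 ≤ T) (hL : 0 ≤ L) (hM : 0 ≤ M)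
    (h1 : a1 ^ 2 + b1 ^ 2 ≤ S * L) (h2 : a2 ^ 2 + b2 ^ 2 ≤ T * M) :
    (a1 + a2) ^ 2 + (b1 + b2) ^ 2 ≤ (S + T) * (L + M) := by
  have h3 : 2 * (a1 * a2 + b1 * b2) ≤ S * M + T * L := by
    refine abs_le_of_sq_le_sq' ?_ (by positivity) |>.2
    have h4 : (a1 ^ 2 + b1 ^ 2) * (a2 ^ 2 + b2 ^ 2) ≤ (S * L) * (T * M) := by gcongr
    nlinarith [sq_nonneg (a1 * b2 - a2 * b1), sq_nonneg (S * M - T * L)]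
  nlinarith

theorem Lp.add {S T : (Fin N → ℂ) → ℝ} (hS : Lp S) (hT : Lp T) : Lp fun x => S x + T x := by
  have hL : ∀ x ξ, Lev (fun x => S x + T x) x ξ = Lev S x ξ + Lev T x ξ := fun x ξ => by
    simp only [Lev, D2_add hS.cd hT.cd]; ring
  refine ⟨hS.cd.add hT.cd, fun x => add_nonneg (hS.nn x) (hT.nn x), fun x ξ => ?_, fun x ξ => ?_⟩
  · rw [hL]; exact add_nonneg (hS.lv x ξ) (hT.lv x ξ)
  · rw [hL]
    rw [show fderiv ℝ (fun x => S x + T x) x = fderiv ℝ S x + fderiv ℝ T x from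
      fderiv_add (cd_diff hS.cd x) (cd_diff hT.cd x)]
    exact cs_aux (hS.nn x) (hT.nn x) (hS.lv x ξ) (hT.lv x ξ) (hS.cs x ξ) (hT.cs x ξ)

theorem Lp.const {c : ℝ} (hc : 0 ≤ c) : Lp (fun _ : Fin N → ℂ => c) := by
  have hL : ∀ x ξ : Fin N → ℂ, Lev (fun _ => c) x ξ = 0 := fun x ξ => by
    simp [Lev, D2]
  refine ⟨contDiff_const, fun _ => hc, fun x ξ => (hL x ξ).ge, fun x ξ => ?_⟩
  rw [hL]; simp

theorem Lp.smul {S : (Fin N → ℂ) → ℝ} (hS : Lp S) {c : ℝ} (hc : 0 ≤ c) : Lp fun x => c * S x := by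
  have hL : ∀ x ξ : Fin N → ℂ, Lev (fun x => c * S x) x ξ = c * Lev S x ξ := fun x ξ => by
    simp only [Lev, D2_smul hS.cd]; ring
  refine ⟨contDiff_const.mul hS.cd, fun x => mul_nonneg hc (hS.nn x), fun x ξ => ?_, fun x ξ => ?_⟩
  · rw [hL]; exact mul_nonneg hc (hS.lv x ξ)
  · rw [hL, fderiv_const_mul (cd_diff hS.cd x)]
    simp only [_root_.smul_apply, smul_eq_mul]
    have := mul_le_mul_of_nonneg_left (hS.cs x ξ) (sq_nonneg c)
    linarith

theorem fderiv_mul_apply' {f g : (Fin N → ℂ) → ℝ} (hf : Differentiable ℝ f) (hg : Differentiable ℝ g)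
    (x ξ : Fin N → ℂ) : fderiv ℝ (fun y => f y * g y) x ξ = f x * fderiv ℝ g x ξ + g x * fderiv ℝ f x ξ := by
  rw [fderiv_fun_mul (hf x) (hg x)]; simp

theorem D2_mul {f g : (Fin N → ℂ) → ℝ} (hf : ContDiff ℝ ∞ f) (hg : ContDiff ℝ ∞ g)
    (x ξ η : Fin N → ℂ) : D2 (fun y => f y * g y) x ξ η =
      f x * D2 g x ξ η + fderiv ℝ f x η * fderiv ℝ g x ξ + fderiv ℝ g x η * fderiv ℝ f x ξ
        + g x * D2 f x ξ η := by
  unfold D2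
  rw [show (fun y => fderiv ℝ (fun y => f y * g y) y ξ) = fun y => (f y * fderiv ℝ g y ξ) + (g y * fderiv ℝ f y ξ)
    from funext fun y => fderiv_mul_apply' (cd_diff hf) (cd_diff hg) y ξ]
  have a := cd_diff (hf.mul (cd_fderiv_apply hg ξ))
  have b := cd_diff (hg.mul (cd_fderiv_apply hf ξ))
  rw [fderiv_fun_add (a x) (b x), _root_.add_apply,
    fderiv_mul_apply' (cd_diff hf) (cd_diff (cd_fderiv_apply hg ξ)),
    fderiv_mul_apply' (cd_diff hg) (cd_diff (cd_fderiv_apply hf ξ))]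
  ring

/-- squared modulus of a holomorphic function -/
theorem Lp.holo {h : (Fin N → ℂ) → ℂ} (hh : ContDiff ℂ ∞ h) : Lp fun x => ‖h x‖ ^ 2 := by
  have hr : ContDiff ℝ ∞ h := hh.restrict_scalars ℝ
  set U : (Fin N → ℂ) → ℝ := fun x => (h x).re with hU
  set V : (Fin N → ℂ) → ℝ := fun x => (h x).im with hV
  have hUc : ContDiff ℝ ∞ U := Complex.reCLM.contDiff.comp hr
  have hVc : ContDiff ℝ ∞ V := Complex.imCLM.contDiff.comp hr
  have hd : ∀ x, HasFDerivAt h ((fderiv ℂ h x).restrictScalars ℝ) x := fun x =>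
    ((hh.differentiable (by simp) x).hasFDerivAt).restrictScalars ℝ
  have hU1 : ∀ x ξ, fderiv ℝ U x ξ = (fderiv ℂ h x ξ).re := fun x ξ => by
    have := (Complex.reCLM.hasFDerivAt (x := h x)).comp x (hd x)
    have h2 := this.fderiv
    change fderiv ℝ U x = _ at h2
    rw [h2]; rfl
  have hV1 : ∀ x ξ, fderiv ℝ V x ξ = (fderiv ℂ h x ξ).im := fun x ξ => by
    have := (Complex.imCLM.hasFDerivAt (x := h x)).comp x (hd x)
    have h2 := this.fderiv
    change fderiv ℝ V x = _ at h2
    rw [h2]; rfl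
  have c1 : ∀ x ξ, fderiv ℝ U x (Complex.I • ξ) = - fderiv ℝ V x ξ := fun x ξ => by
    rw [hU1, hV1, map_smul]; simp
  have c2 : ∀ x ξ, fderiv ℝ V x (Complex.I • ξ) = fderiv ℝ U x ξ := fun x ξ => by
    rw [hU1, hV1, map_smul]; simp
  have l1 : ∀ x ξ, D2 U x (Complex.I • ξ) (Complex.I • ξ) = - D2 U x ξ ξ := fun x ξ => by
    have e1 : D2 U x (Complex.I • ξ) (Complex.I • ξ) = - D2 V x ξ (Complex.I • ξ) := by
      unfold D2; simp only [c1]; simp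
    rw [e1, D2_comm hVc]
    unfold D2; simp only [c2]
  have l2 : ∀ x ξ, D2 V x (Complex.I • ξ) (Complex.I • ξ) = - D2 V x ξ ξ := fun x ξ => by
    have e1 : D2 V x (Complex.I • ξ) (Complex.I • ξ) = D2 U x ξ (Complex.I • ξ) := by
      unfold D2; simp only [c2]
    rw [e1, D2_comm hUc]
    unfold D2; simp only [c1]; simp
  have hS : (fun x => ‖h x‖ ^ 2) = fun x => U x * U x + V x * V x := by
    ext x; rw [← Complex.normSq_eq_norm_sq, Complex.normSq_apply]
  rw [hS]
  have hL : ∀ x ξ, Lev (fun x => U x * U x + V x * V x) x ξ =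
      4 * ((fderiv ℝ U x ξ) ^ 2 + (fderiv ℝ V x ξ) ^ 2) := fun x ξ => by
    simp only [Lev, D2_add (hUc.mul hUc) (hVc.mul hVc), D2_mul hUc hUc, D2_mul hVc hVc, c1, c2, l1, l2]
    ring
  refine ⟨(hUc.mul hUc).add (hVc.mul hVc), fun x => add_nonneg (mul_self_nonneg _) (mul_self_nonneg _), fun x ξ => ?_, fun x ξ => ?_⟩
  · rw [hL]; positivity
  · rw [hL, fderiv_fun_add (cd_diff (hUc.mul hUc) x) (cd_diff (hVc.mul hVc) x)]
    simp only [_root_.add_apply]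
    simp only [fderiv_mul_apply' (cd_diff hUc) (cd_diff hUc), fderiv_mul_apply' (cd_diff hVc) (cd_diff hVc), c1, c2]
    apply le_of_eq; ring

theorem Lp.log {S : (Fin N → ℂ) → ℝ} (hS : Lp S) (hp : ∀ x, 0 < S x) : Sp fun x => Real.log (S x) := by
  have hc : ContDiff ℝ ∞ fun x => Real.log (S x) := hS.cd.log fun x => (hp x).ne'
  have h1 : ∀ x ξ, fderiv ℝ (fun x => Real.log (S x)) x ξ = (S x)⁻¹ * fderiv ℝ S x ξ := fun x ξ => by
    rw [fderiv.log (cd_diff hS.cd x) (hp x).ne']; simp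
  have hinv : ContDiff ℝ ∞ fun x => (S x)⁻¹ := hS.cd.inv fun x => (hp x).ne'
  have hinv1 : ∀ x ξ, fderiv ℝ (fun x => (S x)⁻¹) x ξ = -((S x)^2)⁻¹ * fderiv ℝ S x ξ := fun x ξ => by
    have := (hasDerivAt_inv (hp x).ne').comp_hasFDerivAt x (cd_diff hS.cd x).hasFDerivAt
    have h2 := this.fderiv
    change fderiv ℝ (fun x => (S x)⁻¹) x = _ at h2
    rw [h2]; simp
  have h2 : ∀ x ξ η, D2 (fun x => Real.log (S x)) x ξ η =
      (S x)⁻¹ * D2 S x ξ η - ((S x)^2)⁻¹ * fderiv ℝ S x η * fderiv ℝ S x ξ := fun x ξ η => by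
    conv_lhs => unfold D2
    simp only [h1]
    rw [fderiv_mul_apply' (cd_diff hinv) (cd_diff (cd_fderiv_apply hS.cd ξ)), hinv1]
    unfold D2; ring
  refine ⟨hc, fun x ξ => ?_⟩
  rw [h2, h2]
  have hx := hp x
  have e : (S x)⁻¹ * D2 S x ξ ξ - ((S x)^2)⁻¹ * fderiv ℝ S x ξ * fderiv ℝ S x ξ +
      ((S x)⁻¹ * D2 S x (Complex.I • ξ) (Complex.I • ξ) - ((S x)^2)⁻¹ * fderiv ℝ S x (Complex.I • ξ) * fderiv ℝ S x (Complex.I • ξ))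
      = ((S x)^2)⁻¹ * (S x * Lev S x ξ - ((fderiv ℝ S x ξ) ^ 2 + (fderiv ℝ S x (Complex.I • ξ)) ^ 2)) := by
    unfold Lev; field_simp; ring
  rw [e]
  exact mul_nonneg (by positivity) (by linarith [hS.cs x ξ])

theorem om_lp : Lp (om : (Fin N → ℂ) → ℝ) := by
  have : ∀ s : Finset (Fin N), Lp fun x : Fin N → ℂ => ∑ j ∈ s, ‖x j‖ ^ 2 := by
    intro s
    induction s using Finset.induction_on with
    | empty => simpa using Lp.const (N := N) le_rfl
    | insert a s ha ih =>
      simp only [Finset.sum_insert ha]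
      exact (Lp.holo (contDiff_apply ℂ ℂ a)).add ih
  have e : (om : (Fin N → ℂ) → ℝ) = fun x => ∑ j, ‖x j‖ ^ 2 := by
    ext x
    simp only [om]
    refine Finset.sum_congr rfl fun j _ => ?_
    rw [← Complex.normSq_eq_norm_sq, Complex.normSq_apply]; ring
  rw [e]; exact this _

theorem log_om_sp : Sp fun x : Fin N → ℂ => Real.log (1 + om x) :=
  ((Lp.const zero_le_one).add om_lp).log fun x => by linarith [om_nonneg x]

end LogPsh


section Envel
set_option linter.unusedSimpArgs false
set_option linter.unusedVariables false
open Matrix MeasureTheory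
open scoped ContDiff ComplexOrder
variable {N : ℕ}

theorem D2_translate (u : (Fin N → ℂ) → ℝ) (h x ξ η : Fin N → ℂ) :
    D2 (fun y => u (y + h)) x ξ η = D2 u (x + h) ξ η := by
  unfold D2
  simp only [fderiv_comp_add_right]
  rw [fderiv_comp_add_right (f := fun y => fderiv ℝ u y ξ)]

theorem Osp.translate {u : (Fin N → ℂ) → ℝ} (hu : Osp u) (h : Fin N → ℂ) : Osp fun y => u (y + h) :=
  ⟨hu.1.comp (contDiff_id.add contDiff_const), fun x ξ => by
    rw [D2_translate, D2_translate]; exact hu.2 _ _⟩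

theorem Osp.addc {u : (Fin N → ℂ) → ℝ} (hu : Osp u) (c : ℝ) : Osp fun y => u y + c :=
  ⟨hu.1.add contDiff_const, fun x ξ => by
    rw [D2_add hu.1 contDiff_const, D2_add hu.1 contDiff_const, D2_const, D2_const]
    linarith [hu.2 x ξ]⟩

theorem Osp.avg {u v : (Fin N → ℂ) → ℝ} (hu : Osp u) (hv : Osp v) :
    Osp fun y => 1/2 * u y + 1/2 * v y :=
  ⟨(contDiff_const.mul hu.1).add (contDiff_const.mul hv.1), fun x ξ => by
    rw [D2_add (contDiff_const.mul hu.1) (contDiff_const.mul hv.1),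
      D2_add (contDiff_const.mul hu.1) (contDiff_const.mul hv.1), D2_smul hu.1, D2_smul hv.1,
      D2_smul hu.1, D2_smul hv.1]
    linarith [hu.2 x ξ, hv.2 x ξ]⟩

/-- the obstacle data -/
structure Obst (g : (Fin N → ℂ) → ℝ) (R t : ℝ) : Prop where
  cd : ContDiff ℝ ∞ g
  cs : HasCompactSupport g
  np : ∀ x, g x ≤ 0
  ge : ∀ x, -(om x + t) ≤ g x
  z : ∀ x, R ≤ om x → g x = 0
  t0 : 0 ≤ t
  R0 : 0 ≤ R

def Cand (g ψ : (Fin N → ℂ) → ℝ) : Prop := Osp ψ ∧ ∀ y, ψ y ≤ g y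

def env (g : (Fin N → ℂ) → ℝ) (x : Fin N → ℂ) : ℝ := sSup {r | ∃ ψ, Cand g ψ ∧ r = ψ x}

theorem le_env {g ψ : (Fin N → ℂ) → ℝ} (h : Cand g ψ) (x : Fin N → ℂ) : ψ x ≤ env g x :=
  le_csSup ⟨g x, by rintro r ⟨χ, hχ, rfl⟩; exact hχ.2 x⟩ ⟨ψ, h, rfl⟩

theorem cand0 {g : (Fin N → ℂ) → ℝ} {R t : ℝ} (hg : Obst g R t) : Cand g fun x => -t - om x := by
  refine ⟨(Sp.osp (u := fun _ => -t) ⟨contDiff_const, fun x ξ => by simp [D2_const]⟩), fun y => ?_⟩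
  linarith [hg.ge y]

theorem env_lub {g : (Fin N → ℂ) → ℝ} {R t : ℝ} (hg : Obst g R t) (x : Fin N → ℂ) (c : ℝ)
    (h : ∀ ψ, Cand g ψ → ψ x ≤ c) : env g x ≤ c :=
  csSup_le ⟨_, _, cand0 hg, rfl⟩ (by rintro r ⟨ψ, hψ, rfl⟩; exact h ψ hψ)

theorem env_le {g : (Fin N → ℂ) → ℝ} {R t : ℝ} (hg : Obst g R t) (x : Fin N → ℂ) : env g x ≤ g x :=
  env_lub hg x _ fun ψ h => h.2 x

/-- the support radius -/
def A0 (R t : ℝ) : ℝ := (1 + R) * Real.exp (1 + t)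

theorem A0_ge {R t : ℝ} (hR : 0 ≤ R) (ht : 0 ≤ t) : 1 ≤ A0 R t := by
  have : 1 ≤ Real.exp (1 + t) := Real.one_le_exp (by linarith)
  unfold A0; nlinarith

theorem candA {g : (Fin N → ℂ) → ℝ} {R t : ℝ} (hg : Obst g R t) (A : ℝ) (hA : A0 R t ≤ A) :
    Cand g fun x => A * Real.log (1 + om x) + (A - 1 - A * Real.log A) - om x := by
  have hA1 : 1 ≤ A := (A0_ge hg.R0 hg.t0).trans hA
  have hsp : Sp fun x : Fin N → ℂ => A * Real.log (1 + om x) + (A - 1 - A * Real.log A) := by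
    refine ⟨(contDiff_const.mul log_om_sp.1).add contDiff_const, fun x ξ => ?_⟩
    rw [D2_add (contDiff_const.mul log_om_sp.1) contDiff_const,
      D2_add (contDiff_const.mul log_om_sp.1) contDiff_const, D2_smul log_om_sp.1,
      D2_smul log_om_sp.1, D2_const, D2_const]
    have := mul_nonneg (by linarith : 0 ≤ A) (log_om_sp.2 x ξ)
    linarith
  refine ⟨hsp.osp, fun y => ?_⟩
  by_cases hy : R ≤ om y
  · rw [hg.z y hy]
    have hs : 0 < 1 + om y := by linarith [om_nonneg y]
    have hAp : 0 < A := by linarith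
    have h1 := Real.log_le_sub_one_of_pos (div_pos hs hAp)
    rw [Real.log_div hs.ne' hAp.ne'] at h1
    have h2 := mul_le_mul_of_nonneg_left h1 hAp.le
    have h3 : A * ((1 + om y) / A - 1) = 1 + om y - A := by field_simp
    rw [h3] at h2
    linarith
  · push Not at hy
    refine le_trans ?_ (hg.ge y)
    have h1 : Real.log (1 + om y) ≤ Real.log (1 + R) :=
      Real.log_le_log (by linarith [om_nonneg y]) (by linarith)
    have h2 : Real.log (1 + R) + (1 + t) ≤ Real.log A := by
      have : Real.log (A0 R t) = Real.log (1 + R) + (1 + t) := by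
        unfold A0
        rw [Real.log_mul (by linarith [hg.R0]) (Real.exp_pos _).ne', Real.log_exp]
      rw [← this]
      exact Real.log_le_log (by linarith [A0_ge hg.R0 hg.t0]) hA
    have h3 : A * (Real.log (1 + om y) + 1 + t - Real.log A) ≤ 0 :=
      mul_nonpos_of_nonneg_of_nonpos (by linarith) (by linarith)
    have h4 : t ≤ A * t := le_mul_of_one_le_left hg.t0 hA1
    nlinarith

theorem env_zero {g : (Fin N → ℂ) → ℝ} {R t : ℝ} (hg : Obst g R t) (x : Fin N → ℂ)
    (hx : A0 R t ≤ ‖x‖) : env g x = 0 := by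
  refine le_antisymm ((env_le hg x).trans (hg.np x)) ?_
  have h1 := A0_ge hg.R0 hg.t0
  have h2 : A0 R t ≤ 1 + om x := by nlinarith [le_om x]
  have := le_env (candA hg (1 + om x) h2) x
  linarith

theorem env_ge {g : (Fin N → ℂ) → ℝ} {R t : ℝ} (hg : Obst g R t) (x : Fin N → ℂ) :
    -(t + N * (A0 R t) ^ 2) ≤ env g x := by
  by_cases hx : A0 R t ≤ ‖x‖
  · rw [env_zero hg x hx]
    have := hg.t0
    have : 0 ≤ (N:ℝ) * (A0 R t) ^ 2 := by positivity
    linarith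
  · have := le_env (cand0 hg) x
    have h2 := om_le x
    push Not at hx
    have h3 : (N:ℝ) * ‖x‖ ^ 2 ≤ N * (A0 R t) ^ 2 := by gcongr
    linarith

/-- regularity constants of the obstacle -/
structure Reg (g : (Fin N → ℂ) → ℝ) (L C : ℝ) : Prop where
  L0 : 0 ≤ L
  C0 : 0 ≤ C
  lip : ∀ x y, |g x - g y| ≤ L * ‖x - y‖
  sc : ∀ x h, g (x + h) + g (x - h) ≤ 2 * g x + 2 * C * ‖h‖ ^ 2

theorem reg_exists {g : (Fin N → ℂ) → ℝ} (hg : ContDiff ℝ ∞ g) (hs : HasCompactSupport g) :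
    ∃ L C, Reg g L C := by
  obtain ⟨L, hL⟩ := (hg.of_le (by exact_mod_cast le_top) : ContDiff ℝ 1 g).lipschitzWith_of_hasCompactSupport hs (by simp)
  have h2 : ContDiff ℝ 1 (fderiv ℝ g) := (hg.fderiv_right (m := ∞) (by simp)).of_le (by exact_mod_cast le_top)
  obtain ⟨C, hC⟩ := h2.lipschitzWith_of_hasCompactSupport (hs.fderiv (𝕜 := ℝ)) (by simp)
  refine ⟨L, C, L.2, C.2, fun x y => ?_, fun x h => ?_⟩
  · have := hL.dist_le_mul x y
    rwa [Real.dist_eq, dist_eq_norm] at this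
  · have key : ∀ h : Fin N → ℂ, |g (x + h) - g x - fderiv ℝ g x h| ≤ C * ‖h‖ ^ 2 := by
      intro h
      have := Convex.norm_image_sub_le_of_norm_fderiv_le' (𝕜 := ℝ) (f := g) (φ := fderiv ℝ g x)
        (C := C * ‖h‖) (s := closedBall x ‖h‖) (x := x) (y := x + h)
        (fun y _ => cd_diff hg y) (fun y hy => by
          have h1 := hC.dist_le_mul y x
          rw [dist_eq_norm] at h1
          refine h1.trans ?_
          gcongr
          exact hy) (convex_closedBall _ _) (by simp) (by simp)
      simp only [add_sub_cancel_left, Real.norm_eq_abs] at this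
      calc _ ≤ _ := this
        _ = _ := by ring
    have a := (abs_le.1 (key h)).2
    have b := (abs_le.1 (key (-h))).2
    simp only [map_neg, norm_neg, ← sub_eq_add_neg] at b
    linarith

theorem env_lip' {g : (Fin N → ℂ) → ℝ} {R t L C : ℝ} (hg : Obst g R t) (hr : Reg g L C)
    (x y : Fin N → ℂ) : env g x ≤ env g y + L * ‖x - y‖ := by
  refine env_lub hg x _ fun ψ hψ => ?_
  have hc : Cand g fun z => ψ (z + (x - y)) + -(L * ‖x - y‖) := by
    refine ⟨(hψ.1.translate _).addc _, fun z => ?_⟩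
    have h1 := hψ.2 (z + (x - y))
    have h2 := (abs_le.1 (hr.lip (z + (x - y)) z)).2
    rw [add_sub_cancel_left] at h2
    linarith
  have := le_env hc y
  simp only [add_sub_cancel] at this
  linarith

theorem env_lip {g : (Fin N → ℂ) → ℝ} {R t L C : ℝ} (hg : Obst g R t) (hr : Reg g L C)
    (x y : Fin N → ℂ) : |env g x - env g y| ≤ L * ‖x - y‖ := by
  rw [abs_le]
  have a := env_lip' hg hr x y
  have b := env_lip' hg hr y x
  rw [norm_sub_rev] at b
  constructor <;> linarith

theorem env_cont {g : (Fin N → ℂ) → ℝ} {R t L C : ℝ} (hg : Obst g R t) (hr : Reg g L C) :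
    Continuous (env g) := by
  have : LipschitzWith ⟨L, hr.L0⟩ (env g) := LipschitzWith.of_dist_le_mul fun x y => by
    rw [Real.dist_eq, dist_eq_norm]; exact env_lip hg hr x y
  exact this.continuous

theorem env_sc {g : (Fin N → ℂ) → ℝ} {R t L C : ℝ} (hg : Obst g R t) (hr : Reg g L C)
    (x h : Fin N → ℂ) : env g (x + h) + env g (x - h) ≤ 2 * env g x + 2 * C * ‖h‖ ^ 2 := by
  suffices H : env g (x + h) ≤ (2 * env g x + 2 * C * ‖h‖ ^ 2) - env g (x - h) by linarith
  refine env_lub hg _ _ fun ψ hψ => ?_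
  suffices H : env g (x - h) ≤ (2 * env g x + 2 * C * ‖h‖ ^ 2) - ψ (x + h) by linarith
  refine env_lub hg _ _ fun χ hχ => ?_
  have hc : Cand g fun z => (1/2 * ψ (z + h) + 1/2 * χ (z + -h)) + -(C * ‖h‖ ^ 2) := by
    refine ⟨((hψ.1.translate _).avg (hχ.1.translate _)).addc _, fun z => ?_⟩
    have h1 := hψ.2 (z + h)
    have h2 := hχ.2 (z + -h)
    have h3 := hr.sc z h
    rw [← sub_eq_add_neg] at h2
    simp only [← sub_eq_add_neg]
    linarith
  have := le_env hc x
  simp only [← sub_eq_add_neg] at this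
  linarith

theorem env_submean {g : (Fin N → ℂ) → ℝ} {R t L C : ℝ} (hg : Obst g R t) (hr : Reg g L C)
    (x ξ : Fin N → ℂ) : 2 * Real.pi * env g x ≤
      (∫ θ in (0:ℝ)..(2 * Real.pi), env g (cpt x ξ θ)) + 2 * Real.pi * om ξ := by
  have hp : 0 < 2 * Real.pi := by positivity
  rw [← le_div_iff₀' hp]
  refine env_lub hg _ _ fun ψ hψ => ?_
  rw [le_div_iff₀' hp]
  refine (osp_submean hψ.1 x ξ).trans ?_
  gcongr
  refine intervalIntegral.integral_mono_on hp.le ?_ ?_ fun θ _ => le_env hψ _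
  · exact (hψ.1.1.continuous.comp (cpt_cont x ξ)).intervalIntegrable _ _
  · exact ((env_cont hg hr).comp (cpt_cont x ξ)).intervalIntegrable _ _

/-! mollified envelope -/
theorem me_osp {g φ : (Fin N → ℂ) → ℝ} {R t L C ρ : ℝ} (hφ : Mlf φ) (hg : Obst g R t) (hr : Reg g L C)
    (hρ : 0 < ρ) : Osp (mol φ (env g) ρ) :=
  mol_submean hφ (env_cont hg hr) hρ (env_submean hg hr)

theorem me_close {g φ : (Fin N → ℂ) → ℝ} {R t L C ρ : ℝ} (hφ : Mlf φ) (hg : Obst g R t) (hr : Reg g L C)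
    (hρ : 0 < ρ) (x : Fin N → ℂ) : |mol φ (env g) ρ x - env g x| ≤ L * ρ := by
  have hb : ∀ y : Fin N → ℂ, ‖y‖ ≤ 1 → |env g (x - ρ • y) - env g x| ≤ L * ρ := fun y hy => by
    refine (env_lip hg hr _ _).trans ?_
    refine mul_le_mul_of_nonneg_left ?_ hr.L0
    rw [sub_sub_cancel_left, norm_neg, norm_smul, Real.norm_of_nonneg hρ.le]
    nlinarith
  rw [abs_le]
  constructor
  · have := le_mol hφ (env_cont hg hr) ρ x (env g x - L * ρ) fun y hy => by
      linarith [(abs_le.1 (hb y hy)).1]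
    linarith
  · have := mol_le hφ (env_cont hg hr) ρ x (env g x + L * ρ) fun y hy => by
      linarith [(abs_le.1 (hb y hy)).2]
    linarith

theorem me_cand {g φ : (Fin N → ℂ) → ℝ} {R t L C ρ : ℝ} (hφ : Mlf φ) (hg : Obst g R t) (hr : Reg g L C)
    (hρ : 0 < ρ) : Cand g fun x => mol φ (env g) ρ x + -(L * ρ) :=
  ⟨(me_osp hφ hg hr hρ).addc _, fun x => by
    linarith [(abs_le.1 (me_close hφ hg hr hρ x)).2, env_le hg x]⟩

theorem me_np {g φ : (Fin N → ℂ) → ℝ} {R t L C ρ : ℝ} (hφ : Mlf φ) (hg : Obst g R t) (hr : Reg g L C)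
    (x : Fin N → ℂ) : mol φ (env g) ρ x ≤ 0 :=
  mol_le hφ (env_cont hg hr) ρ x 0 fun y _ => (env_le hg _).trans (hg.np _)

theorem me_ge {g φ : (Fin N → ℂ) → ℝ} {R t L C ρ : ℝ} (hφ : Mlf φ) (hg : Obst g R t) (hr : Reg g L C)
    (x : Fin N → ℂ) : -(t + N * (A0 R t) ^ 2) ≤ mol φ (env g) ρ x :=
  le_mol hφ (env_cont hg hr) ρ x _ fun y _ => env_ge hg _

theorem me_zero {g φ : (Fin N → ℂ) → ℝ} {R t L C ρ : ℝ} (hφ : Mlf φ) (hg : Obst g R t) (hr : Reg g L C)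
    (hρ : 0 < ρ) (hρ1 : ρ ≤ 1) (x : Fin N → ℂ) (hx : A0 R t + 1 ≤ ‖x‖) : mol φ (env g) ρ x = 0 := by
  have hz : ∀ y : Fin N → ℂ, ‖y‖ ≤ 1 → env g (x - ρ • y) = 0 := fun y hy => by
    refine env_zero hg _ ?_
    have h1 := norm_sub_norm_le x (ρ • y)
    rw [norm_smul, Real.norm_of_nonneg hρ.le] at h1
    nlinarith [norm_nonneg y]
  exact le_antisymm (me_np hφ hg hr x) (le_mol hφ (env_cont hg hr) ρ x 0 fun y hy => (hz y hy).ge)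

theorem me_supp {g φ : (Fin N → ℂ) → ℝ} {R t L C ρ : ℝ} (hφ : Mlf φ) (hg : Obst g R t) (hr : Reg g L C)
    (hρ : 0 < ρ) (hρ1 : ρ ≤ 1) : tsupport (mol φ (env g) ρ) ⊆ closedBall 0 (A0 R t + 1) := by
  refine closure_minimal (fun x hx => ?_) isClosed_closedBall
  rw [mem_closedBall_zero_iff]
  by_contra h
  push Not at h
  exact hx (me_zero hφ hg hr hρ hρ1 x h.le)

theorem me_cs {g φ : (Fin N → ℂ) → ℝ} {R t L C ρ : ℝ} (hφ : Mlf φ) (hg : Obst g R t) (hr : Reg g L C)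
    (hρ : 0 < ρ) (hρ1 : ρ ≤ 1) : HasCompactSupport (mol φ (env g) ρ) :=
  HasCompactSupport.of_support_subset_isCompact (isCompact_closedBall 0 (A0 R t + 1))
    (subset_closure.trans (me_supp hφ hg hr hρ hρ1))

theorem me_D2_le {g φ : (Fin N → ℂ) → ℝ} {R t L C ρ : ℝ} (hφ : Mlf φ) (hg : Obst g R t) (hr : Reg g L C)
    (hρ : 0 < ρ) (x ξ : Fin N → ℂ) : D2 (mol φ (env g) ρ) x ξ ξ ≤ 2 * C * ‖ξ‖ ^ 2 := by
  set u := mol φ (env g) ρ with hu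
  have huc : ContDiff ℝ ∞ u := (me_osp hφ hg hr hρ).1
  have hFc := env_cont hg hr
  have hsc : ∀ h, u (x + h) + u (x - h) ≤ 2 * u x + 2 * C * ‖h‖ ^ 2 := fun h => by
    rw [hu]
    have i := fun z => mol_integrable hφ.cd.continuous hφ.cs hFc ρ z
    have ic : Integrable fun y => φ y * (2 * C * ‖h‖ ^ 2) :=
      Continuous.integrable_of_hasCompactSupport (by have := hφ.cd.continuous; fun_prop) hφ.cs.mul_right
    have e2 : ∫ y, φ y * (2 * C * ‖h‖ ^ 2) = 2 * C * ‖h‖ ^ 2 := by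
      rw [integral_mul_const, hφ.int, one_mul]
    unfold mol
    rw [← e2, ← integral_const_mul, ← integral_add (i _) (i _),
      ← integral_add ((i _).const_mul 2) ic]
    refine integral_mono ((i _).add (i _)) (((i _).const_mul 2).add ic) fun y => ?_
    have := mul_le_mul_of_nonneg_left (env_sc hg hr (x - ρ • y) h) (hφ.nn y)
    simp only [Pi.add_apply]
    rw [show x + h - ρ • y = x - ρ • y + h by abel, show x - h - ρ • y = x - ρ • y - h by abel]
    linarith
  have l1 := fun s => line_d1 (cd_diff huc) x ξ s
  have l1' := fun s => line_d1 (cd_diff huc) x (-ξ) s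
  have l2 := line_d2 huc x ξ ξ 0
  have l2' := line_d2 huc x (-ξ) (-ξ) 0
  have key := second_test
    (h := fun s => (2 * u x + 2 * C * ‖ξ‖ ^ 2 * s ^ 2) - (u (x + s • ξ) + u (x + s • (-ξ))))
    (h' := fun s => (4 * C * ‖ξ‖ ^ 2 * s) - (fderiv ℝ u (x + s • ξ) ξ + fderiv ℝ u (x + s • (-ξ)) (-ξ)))
    (fun s => ((((hasDerivAt_id s).pow 2).const_mul (2 * C * ‖ξ‖ ^ 2)).const_add (2 * u x)
      |>.congr_deriv (by simp; ring)).sub ((l1 s).add (l1' s)))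
    (((hasDerivAt_id (0:ℝ)).const_mul (4 * C * ‖ξ‖ ^ 2)).sub (l2.add l2'))
    (fun s => by
      have := hsc (s • ξ)
      rw [norm_smul, mul_pow, Real.norm_eq_abs, sq_abs] at this
      simp only [zero_smul, add_zero, smul_neg, ← sub_eq_add_neg, sub_zero]
      nlinarith)
  have e : D2 u x (-ξ) (-ξ) = D2 u x ξ ξ := by
    simp only [← D2L_apply huc]; simp
  simp only [zero_smul, add_zero, e] at key
  linarith

theorem me_D2_abs {g φ : (Fin N → ℂ) → ℝ} {R t L C ρ : ℝ} (hφ : Mlf φ) (hg : Obst g R t) (hr : Reg g L C)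
    (hρ : 0 < ρ) (x ξ : Fin N → ℂ) :
    |D2 (mol φ (env g) ρ) x ξ ξ| ≤ (2 * C + 4 * N) * ‖ξ‖ ^ 2 := by
  have h1 := me_D2_le hφ hg hr hρ x ξ
  have h2 := me_D2_le hφ hg hr hρ x (Complex.I • ξ)
  have h3 := (me_osp hφ hg hr hρ).2 x ξ
  have h4 := om_le ξ
  rw [norm_smul, Complex.norm_I, one_mul] at h2
  have : 0 ≤ (N:ℝ) * ‖ξ‖ ^ 2 := by positivity
  rw [abs_le]; constructor <;> nlinarith

end Envel


section Glue
set_option linter.unusedSimpArgs false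
set_option linter.unusedVariables false
open Matrix MeasureTheory
open scoped ContDiff ComplexOrder
variable {N : ℕ}

/-- smooth convex glue -/
def kt (s : ℝ) : ℝ := ∫ t in (0:ℝ)..s, expNegInvGlue t

theorem eg_cont : Continuous expNegInvGlue := (expNegInvGlue.contDiff (n := 0)).continuous

theorem eg_le_one (s : ℝ) : expNegInvGlue s ≤ 1 := by
  unfold expNegInvGlue
  split_ifs with h
  · exact zero_le_one
  · rw [Real.exp_le_one_iff]
    push Not at h
    have := inv_pos.2 h
    linarith

theorem kt_deriv (s : ℝ) : HasDerivAt kt (expNegInvGlue s) s :=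
  intervalIntegral.integral_hasDerivAt_right (eg_cont.intervalIntegrable _ _)
    eg_cont.aestronglyMeasurable.stronglyMeasurableAtFilter eg_cont.continuousAt

theorem eg_cd : ContDiff ℝ ∞ expNegInvGlue := expNegInvGlue.contDiff

theorem kt_cd : ContDiff ℝ ∞ kt := by
  rw [contDiff_infty_iff_deriv]
  refine ⟨fun s => (kt_deriv s).differentiableAt, ?_⟩
  rw [show deriv kt = expNegInvGlue from funext fun s => (kt_deriv s).deriv]
  exact eg_cd

theorem kt_np {s : ℝ} (hs : s ≤ 0) : kt s = 0 := by
  unfold kt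
  rw [intervalIntegral.integral_congr (g := fun _ => (0:ℝ)), intervalIntegral.integral_zero]
  intro t ht
  rw [Set.uIcc_of_ge hs] at ht
  exact expNegInvGlue.zero_of_nonpos ht.2

theorem kt_le {s : ℝ} (hs : 0 ≤ s) : kt s ≤ s := by
  have := intervalIntegral.integral_mono_on hs (eg_cont.intervalIntegrable (μ := volume) 0 s)
    ((continuous_const (y := (1:ℝ))).intervalIntegrable 0 s) fun t _ => eg_le_one t
  simpa [kt] using this

theorem kt_mono : Monotone kt := monotone_of_deriv_nonneg
  (fun s => (kt_deriv s).differentiableAt) fun s => by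
    rw [(kt_deriv s).deriv]; exact expNegInvGlue.nonneg s

theorem kt_pos {s : ℝ} (hs : 0 < s) : 0 < kt s := by
  refine intervalIntegral.intervalIntegral_pos_of_pos_on (eg_cont.intervalIntegrable _ _) (fun t ht => ?_) hs
  exact expNegInvGlue.pos_of_pos ht.1

theorem D2_kt {d : (Fin N → ℂ) → ℝ} (hd : ContDiff ℝ ∞ d) (x ξ : Fin N → ℂ) :
    D2 (fun y => kt (d y)) x ξ ξ = expNegInvGlue (d x) * D2 d x ξ ξ
      + deriv expNegInvGlue (d x) * (fderiv ℝ d x ξ) ^ 2 := by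
  have h1 : ∀ y, fderiv ℝ (fun y => kt (d y)) y ξ = expNegInvGlue (d y) * fderiv ℝ d y ξ := fun y => by
    have := ((kt_deriv (d y)).comp_hasFDerivAt y (cd_diff hd y).hasFDerivAt).fderiv
    change fderiv ℝ (fun y => kt (d y)) y = _ at this
    rw [this]; simp
  have he := ((eg_cd.differentiable (by simp) (d x)).hasDerivAt.comp_hasFDerivAt x (cd_diff hd x).hasFDerivAt).fderiv
  change fderiv ℝ (fun y => expNegInvGlue (d y)) x = _ at he
  unfold D2
  simp only [h1]
  rw [fderiv_mul_apply' (f := fun y => expNegInvGlue (d y)) (cd_diff (eg_cd.comp hd)) (cd_diff (cd_fderiv_apply hd ξ)), he]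
  simp; ring

theorem osp_kt {ψ w : (Fin N → ℂ) → ℝ} (hψ : Osp ψ) (hw : Osp w) :
    Osp fun y => ψ y + kt (w y - ψ y) := by
  have hd : ContDiff ℝ ∞ fun y => w y - ψ y := hw.1.sub hψ.1
  have hk : ContDiff ℝ ∞ fun y => kt (w y - ψ y) := kt_cd.comp hd
  refine ⟨hψ.1.add hk, fun x ξ => ?_⟩
  have hs : ∀ η, D2 (fun y => w y - ψ y) x η η = D2 w x η η - D2 ψ x η η := fun η => by
    have e : (fun y => w y - ψ y) = fun y => w y + (-1) * ψ y := by ext y; ring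
    rw [e, D2_add hw.1 (contDiff_const.mul hψ.1), D2_smul hψ.1]; ring
  rw [D2_add hψ.1 hk, D2_add hψ.1 hk, D2_kt hd, D2_kt hd, hs, hs]
  have h0 := expNegInvGlue.nonneg (w x - ψ x)
  have h1 := eg_le_one (w x - ψ x)
  have h2 : 0 ≤ deriv expNegInvGlue (w x - ψ x) := expNegInvGlue.monotone.deriv_nonneg
  have a := mul_le_mul_of_nonneg_left (hw.2 x ξ) h0
  have b := mul_le_mul_of_nonneg_left (hψ.2 x ξ) (sub_nonneg.2 h1)
  have c := mul_nonneg h2 (sq_nonneg (fderiv ℝ (fun y => w y - ψ y) x ξ))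
  have c' := mul_nonneg h2 (sq_nonneg (fderiv ℝ (fun y => w y - ψ y) x (Complex.I • ξ)))
  nlinarith

theorem osp_glue {ψ w : (Fin N → ℂ) → ℝ} (hψ : Osp ψ) (hw : Osp w) (x : Fin N → ℂ) (r : ℝ) (hr : 0 < r)
    (h : ∀ y, r / 2 ≤ ‖y - x‖ → ‖y - x‖ ≤ r → w y < ψ y) :
    Osp fun y => if ‖y - x‖ < r then ψ y + kt (w y - ψ y) else ψ y := by
  set χ : (Fin N → ℂ) → ℝ := fun y => if ‖y - x‖ < r then ψ y + kt (w y - ψ y) else ψ y with hχ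
  have hcn : Continuous fun y : Fin N → ℂ => ‖y - x‖ := by fun_prop
  have key : ∀ z, χ =ᶠ[nhds z] (fun y => ψ y + kt (w y - ψ y)) ∨ χ =ᶠ[nhds z] ψ := by
    intro z
    by_cases hz : ‖z - x‖ < r
    · left
      filter_upwards [(isOpen_lt hcn continuous_const).mem_nhds hz] with y hy
      simp only [hχ]; exact if_pos hy
    · right
      have : r / 2 < ‖z - x‖ := by push Not at hz; linarith
      filter_upwards [(isOpen_lt continuous_const hcn).mem_nhds this] with y hy
      simp only [hχ]
      split_ifs with h1
      · rw [kt_np (by linarith [h y (le_of_lt hy) h1.le]), add_zero]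
      · rfl
  have hk := osp_kt hψ hw
  refine ⟨contDiff_iff_contDiffAt.2 fun z => ?_, fun z ξ => ?_⟩
  · rcases key z with h1 | h1
    · exact hk.1.contDiffAt.congr_of_eventuallyEq h1
    · exact hψ.1.contDiffAt.congr_of_eventuallyEq h1
  · rcases key z with h1 | h1
    · rw [D2_congr h1]; exact hk.2 z ξ
    · rw [D2_congr h1]; exact hψ.2 z ξ

theorem D2_form {v : (Fin N → ℂ) → ℝ} (hv : ContDiff ℝ ∞ v) (x ξ η : Fin N → ℂ) :
    D2 v x ξ η = fderiv ℝ (fderiv ℝ v) x η ξ := by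
  rw [← D2L_apply hv]; rfl

theorem posdef_c {v : (Fin N → ℂ) → ℝ} (hv : Sp v) (x : Fin N → ℂ) (hd : MA v x ≠ 0) :
    ∃ c > 0, ∀ ξ, c * ‖ξ‖ ^ 2 ≤ D2 v x ξ ξ + D2 v x (Complex.I • ξ) (Complex.I • ξ) := by
  have hc : Continuous fun ξ => D2 v x ξ ξ + D2 v x (Complex.I • ξ) (Complex.I • ξ) := by
    simp only [D2_form hv.1]; fun_prop
  have hpos : ∀ ξ ∈ sphere (0 : Fin N → ℂ) 1, 0 < D2 v x ξ ξ + D2 v x (Complex.I • ξ) (Complex.I • ξ) := by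
    intro ξ hξ
    refine lt_of_le_of_ne (hv.2 x ξ) fun h0 => hd ?_
    have q := hessB_quad (D2L v x) (D2L_symm hv.1 x) ξ
    have e : hessB (fun a b => D2L v x a b) = hess v x := (hess_eq_D2L hv.1 x).symm
    rw [e] at q
    rw [D2L_apply hv.1, D2L_apply hv.1, ← h0] at q
    simp only [mul_zero, Complex.ofReal_zero] at q
    have z := ((hv.psd x).dotProduct_mulVec_zero_iff _).1 q
    have hne : star ξ ≠ 0 := by
      intro h
      rw [star_eq_zero] at h
      rw [h] at hξ; simp at hξ
    have : (hess v x).det = 0 := Matrix.exists_mulVec_eq_zero_iff.1 ⟨_, hne, z⟩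
    simp [MA, this]
  obtain ⟨c, hc0, hcb⟩ := (isCompact_sphere (0 : Fin N → ℂ) 1).exists_forall_le' hc.continuousOn hpos
  refine ⟨c, hc0, fun ξ => ?_⟩
  by_cases hξ : ξ = 0
  · subst hξ; simp [D2_form hv.1]
  · have hn : 0 < ‖ξ‖ := norm_pos_iff.2 hξ
    have := hcb (‖ξ‖⁻¹ • ξ) (by simp [norm_smul, hn.ne'])
    rw [smul_comm Complex.I] at this
    simp only [← D2L_apply hv.1, map_smul, LinearMap.smul_apply, smul_eq_mul] at this ⊢
    have h2 : c ≤ (‖ξ‖⁻¹) ^ 2 * (D2L v x ξ ξ + D2L v x (Complex.I • ξ) (Complex.I • ξ)) := by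
      linarith
    have h3 := mul_le_mul_of_nonneg_right h2 (sq_nonneg ‖ξ‖)
    have h4 : (‖ξ‖⁻¹) ^ 2 * (D2L v x ξ ξ + D2L v x (Complex.I • ξ) (Complex.I • ξ)) * ‖ξ‖ ^ 2 =
      D2L v x ξ ξ + D2L v x (Complex.I • ξ) (Complex.I • ξ) := by field_simp
    linarith

/-- the contradiction at a second order point in the noncontact set -/
theorem no_posdef {g φ T : (Fin N → ℂ) → ℝ} {R t L C : ℝ} (hφ : Mlf φ) (hg : Obst g R t) (hr : Reg g L C)
    (x : Fin N → ℂ) (hlt : env g x < g x) (hT : Osp T) (hT2 : ∀ z ξ, D2 T z ξ ξ = D2 T x ξ ξ)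
    (hTx : T x = env g x)
    (hTay : ∀ ε > 0, ∃ δ > 0, ∀ h : Fin N → ℂ, ‖h‖ ≤ δ → |env g (x + h) - T (x + h)| ≤ ε * ‖h‖ ^ 2) :
    MA (fun y => om y + T y) x = 0 := by
  by_contra hd
  obtain ⟨c1, hc1, hcb⟩ := posdef_c hT.sp x hd
  set c : ℝ := c1 / (4 * (N + 1)) with hc
  have hc0 : 0 < c := by positivity
  have hcN : 4 * c * N ≤ c1 := by
    rw [hc]
    have : 4 * (c1 / (4 * (N + 1))) * N = c1 * (N / (N + 1) : ℝ) := by field_simp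
    rw [this]
    have : (N / (N + 1) : ℝ) ≤ 1 := by rw [div_le_one (by positivity)]; linarith
    nlinarith
  have hom : ContDiff ℝ ∞ fun y : Fin N → ℂ => om (y - x) := om_cd.comp (contDiff_id.sub contDiff_const)
  have homD : ∀ z ξ, D2 (fun y => om (y - x)) z ξ ξ = 2 * om ξ := fun z ξ => by
    have := D2_translate om (-x) z ξ ξ
    simp only [← sub_eq_add_neg] at this
    rw [this, D2_om, omB_self]
  have hw : ∀ ε : ℝ, Osp fun y => (T y + (-c) * om (y - x)) + ε := fun ε => by
    refine Osp.addc ⟨hT.1.add (contDiff_const.mul hom), fun z ξ => ?_⟩ ε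
    have hb := hcb ξ
    rw [D2_add om_cd hT.1, D2_add om_cd hT.1] at hb
    have hl := D2_om_levi x ξ
    rw [D2_add hT.1 (contDiff_const.mul hom), D2_add hT.1 (contDiff_const.mul hom), D2_smul hom,
      D2_smul hom, homD, homD, hT2 z, hT2 z, om_smul, Complex.norm_I]
    have ho := om_le ξ
    have : 4 * c * om ξ ≤ c1 * ‖ξ‖ ^ 2 := by
      have := mul_le_mul_of_nonneg_left ho (by positivity : 0 ≤ 4 * c)
      nlinarith [sq_nonneg ‖ξ‖]
    linarith
  obtain ⟨δ, hδ, hδb⟩ := hTay (c / 8) (by positivity)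
  -- choice of radius
  obtain ⟨r, hr0, hrδ, hr1, hrg⟩ : ∃ r > 0, r ≤ δ ∧ r ≤ 1 ∧ 2 * L * r + c * r ^ 2 / 8 ≤ g x - env g x := by
    set K : ℝ := 2 * L + c / 8 with hK
    have hK0 : 0 < K := by have := hr.L0; positivity
    refine ⟨min (min δ 1) ((g x - env g x) / K), by
      have : 0 < (g x - env g x) / K := div_pos (by linarith) hK0
      positivity, (min_le_left _ _).trans (min_le_left _ _), (min_le_left _ _).trans (min_le_right _ _), ?_⟩
    set r := min (min δ 1) ((g x - env g x) / K)
    have hr0 : 0 < r := by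
      have : 0 < (g x - env g x) / K := div_pos (by linarith) hK0
      positivity
    have h1 : r ≤ 1 := (min_le_left _ _).trans (min_le_right _ _)
    have h2 : r ≤ (g x - env g x) / K := min_le_right _ _
    rw [le_div_iff₀ hK0] at h2
    have h3 : r ^ 2 ≤ r := by nlinarith
    nlinarith
  set ε : ℝ := c * r ^ 2 / 8 with hε
  have hε0 : 0 < ε := by positivity
  have hL := hr.L0
  set m : ℝ := min (kt ε) (c * r ^ 2 * (3 / 32)) with hm
  have hm0 : 0 < m := lt_min (kt_pos hε0) (by positivity)
  set ρ : ℝ := m / (4 * (L + 1)) with hρ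
  have hρ0 : 0 < ρ := by positivity
  have hLρ : 2 * (L * ρ) < m := by
    have h1 : ρ * (4 * (L + 1)) = m := by rw [hρ]; field_simp
    nlinarith
  have hψ := me_cand hφ hg hr hρ0
  set ψ : (Fin N → ℂ) → ℝ := fun x => mol φ (env g) ρ x + -(L * ρ) with hψd
  have hψge : ∀ y, env g y - 2 * (L * ρ) ≤ ψ y := fun y => by
    have := (abs_le.1 (me_close hφ hg hr hρ0 y)).1
    simp only [hψd]; linarith
  have hψle : ∀ y, ψ y ≤ env g y := fun y => le_env hψ y
  set w : (Fin N → ℂ) → ℝ := fun y => (T y + (-c) * om (y - x)) + ε with hwd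
  have hwb : ∀ y, ‖y - x‖ ≤ r → w y ≤ env g y - (7/8) * c * ‖y - x‖ ^ 2 + ε := fun y hy => by
    have := (abs_le.1 (hδb (y - x) (hy.trans hrδ))).1
    rw [add_sub_cancel] at this
    have h2 := mul_le_mul_of_nonneg_left (le_om (y - x)) hc0.le
    simp only [hwd]; linarith
  have hG := osp_glue hψ.1 (hw ε) x r hr0 (fun y h1 h2 => by
    have a := hwb y h2
    have b := hψge y
    have h3 : r ^ 2 / 4 ≤ ‖y - x‖ ^ 2 := by nlinarith
    have h4 : m ≤ c * r ^ 2 * (3 / 32) := min_le_right _ _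
    have h5 := mul_le_mul_of_nonneg_left h3 (by positivity : 0 ≤ 7/8 * c)
    change w y < ψ y
    linarith)
  have hcand : Cand g fun y => if ‖y - x‖ < r then ψ y + kt (w y - ψ y) else ψ y := by
    refine ⟨hG, fun y => ?_⟩
    simp only
    split_ifs with hy
    · by_cases hs : w y - ψ y ≤ 0
      · rw [kt_np hs, add_zero]; exact hψ.2 y
      · push Not at hs
        have h1 := kt_le hs.le
        have h2 := hwb y hy.le
        have h3 := (abs_le.1 (env_lip hg hr y x)).2
        have h4 := (abs_le.1 (hr.lip y x)).1
        have h5 := mul_le_mul_of_nonneg_left hy.le hL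
        have h6 : 0 ≤ (7/8) * c * ‖y - x‖ ^ 2 := by positivity
        linarith
    · exact hψ.2 y
  have hfin := le_env hcand x
  simp only [sub_self, norm_zero, hr0, if_true] at hfin
  have hwx : w x = env g x + ε := by
    simp only [hwd, sub_self, hTx]
    simp [om]
  have hk : kt ε ≤ kt (w x - ψ x) := kt_mono (by rw [hwx]; linarith [hψle x])
  have hm1 : m ≤ kt ε := min_le_left _ _
  linarith [hψge x]

end Glue


section Alex
set_option linter.unusedSimpArgs false
set_option linter.unusedVariables false
open Matrix MeasureTheory
open scoped ContDiff ComplexOrder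
variable {N : ℕ}

theorem taylor_of_D2 {u : (Fin N → ℂ) → ℝ} (hu : ContDiff ℝ ∞ u) (M : ℝ)
    (hM : ∀ x ξ, |D2 u x ξ ξ| ≤ M * ‖ξ‖ ^ 2) (x h : Fin N → ℂ) :
    |u (x + h) - u x - fderiv ℝ u x h| ≤ M * ‖h‖ ^ 2 := by
  have k1 : ∀ s ∈ Set.Icc (0:ℝ) 1, |fderiv ℝ u (x + s • h) h - fderiv ℝ u x h| ≤ M * ‖h‖ ^ 2 := by
    intro s hs
    have := (convex_univ (𝕜 := ℝ) (E := ℝ)).norm_image_sub_le_of_norm_hasDerivWithin_le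
      (f := fun t : ℝ => fderiv ℝ u (x + t • h) h) (f' := fun t => D2 u (x + t • h) h h)
      (C := M * ‖h‖ ^ 2) (x := 0) (y := s)
      (fun t _ => (line_d2 hu x h h t).hasDerivWithinAt) (fun t _ => hM _ _) trivial trivial
    simp only [zero_smul, add_zero, sub_zero, Real.norm_eq_abs] at this
    refine this.trans ?_
    rw [abs_of_nonneg hs.1]
    have h0 : 0 ≤ M * ‖h‖ ^ 2 := (abs_nonneg _).trans (hM x h)
    nlinarith [hs.2]
  have := norm_image_sub_le_of_norm_deriv_le_segment_01'
    (f := fun t : ℝ => u (x + t • h) - t * fderiv ℝ u x h)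
    (f' := fun t => fderiv ℝ u (x + t • h) h - fderiv ℝ u x h) (C := M * ‖h‖ ^ 2)
    (fun t _ => ((line_d1 (cd_diff hu) x h t).sub
      (((hasDerivAt_id t).mul_const (fderiv ℝ u x h)).congr_deriv (one_mul _))).hasDerivWithinAt)
    (fun t ht => k1 t ⟨ht.1, ht.2.le⟩)
  simp only [one_smul, zero_smul, add_zero, one_mul, zero_mul, sub_zero, Real.norm_eq_abs] at this
  rwa [sub_right_comm] at this

theorem env_taylor {g φ : (Fin N → ℂ) → ℝ} {R t L C : ℝ} (hφ : Mlf φ) (hg : Obst g R t) (hr : Reg g L C)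
    (x : Fin N → ℂ) : ∃ G : (Fin N → ℂ) →L[ℝ] ℝ, ∀ h,
      |env g (x + h) - env g x - G h| ≤ (2 * C + 4 * N) * ‖h‖ ^ 2 := by
  set M : ℝ := 2 * C + 4 * N with hM
  have hM0 : 0 ≤ M := by have := hr.C0; positivity
  set B : ℝ := t + N * (A0 R t) ^ 2 with hB
  have hB0 : 0 ≤ B := by have := hg.t0; positivity
  have hρ : ∀ n : ℕ, (0:ℝ) < 1 / (n + 1) := fun n => by positivity
  set u : ℕ → (Fin N → ℂ) → ℝ := fun n => mol φ (env g) (1 / (n + 1)) with hu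
  have htay := fun n h => taylor_of_D2 (me_osp hφ hg hr (hρ n)).1 M (me_D2_abs hφ hg hr (hρ n)) x h
  have hbd : ∀ n, fderiv ℝ (u n) x ∈ closedBall (0 : (Fin N → ℂ) →L[ℝ] ℝ) (B + M) := fun n => by
    rw [mem_closedBall_zero_iff]
    refine ContinuousLinearMap.opNorm_le_of_unit_norm (by positivity) fun h hh => ?_
    have h1 := abs_le.1 (htay n h)
    rw [hh] at h1
    have a1 := me_np hφ hg hr (ρ := 1 / ((n:ℝ) + 1)) x
    have a2 := me_np hφ hg hr (ρ := 1 / ((n:ℝ) + 1)) (x + h)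
    have b1 := me_ge hφ hg hr (ρ := 1 / ((n:ℝ) + 1)) x
    have b2 := me_ge hφ hg hr (ρ := 1 / ((n:ℝ) + 1)) (x + h)
    rw [Real.norm_eq_abs, abs_le]
    simp only [hu]
    constructor <;> linarith [h1.1, h1.2]
  have : ProperSpace ((Fin N → ℂ) →L[ℝ] ℝ) := FiniteDimensional.proper ℝ _
  obtain ⟨G, -, σ, hσ, hG⟩ := (isCompact_closedBall (0 : (Fin N → ℂ) →L[ℝ] ℝ) (B + M)).tendsto_subseq hbd
  refine ⟨G, fun h => ?_⟩
  have hlim : ∀ z, Tendsto (fun n => u n z) atTop (nhds (env g z)) := fun z => by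
    rw [tendsto_iff_norm_sub_tendsto_zero]
    refine squeeze_zero (fun n => norm_nonneg _) (fun n => me_close hφ hg hr (hρ n) z) ?_
    have := (tendsto_one_div_add_atTop_nhds_zero_nat (𝕜 := ℝ)).const_mul L
    simpa using this
  have hGh : Tendsto (fun n => fderiv ℝ (u (σ n)) x h) atTop (nhds (G h)) :=
    ((ContinuousLinearMap.apply ℝ ℝ h).continuous.tendsto G).comp hG
  have l1 := (hlim (x + h)).comp hσ.tendsto_atTop
  have l2 := (hlim x).comp hσ.tendsto_atTop
  exact le_of_tendsto ((l1.sub l2).sub hGh).abs (Eventually.of_forall fun n => htay (σ n) h)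

theorem hasFDeriv_of_taylor {F : (Fin N → ℂ) → ℝ} {x : Fin N → ℂ} {G : (Fin N → ℂ) →L[ℝ] ℝ} {M : ℝ}
    (h : ∀ h, |F (x + h) - F x - G h| ≤ M * ‖h‖ ^ 2) : HasFDerivAt F G x := by
  rw [hasFDerivAt_iff_isLittleO_nhds_zero]
  have h1 : (fun h => F (x + h) - F x - G h) =O[nhds 0] fun h : Fin N → ℂ => ‖h‖ ^ 2 :=
    Asymptotics.IsBigO.of_bound M (Eventually.of_forall fun y => by
      simpa using h y)
  refine h1.trans_isLittleO ?_
  exact (Asymptotics.isLittleO_norm_pow_id one_lt_two)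

theorem env_C11 {g φ : (Fin N → ℂ) → ℝ} {R t L C : ℝ} (hφ : Mlf φ) (hg : Obst g R t) (hr : Reg g L C) :
    Differentiable ℝ (env g) ∧ ∃ K, LipschitzWith K (fderiv ℝ (env g)) := by
  set M : ℝ := 2 * C + 4 * N with hM
  have hM0 : 0 ≤ M := by have := hr.C0; positivity
  choose G hG using env_taylor hφ hg hr
  have hd := fun x => hasFDeriv_of_taylor (hG x)
  refine ⟨fun x => (hd x).differentiableAt, ⟨6 * M, by positivity⟩, ?_⟩
  have e : fderiv ℝ (env g) = G := funext fun x => (hd x).fderiv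
  rw [e]
  refine LipschitzWith.of_dist_le_mul fun x y => ?_
  rw [dist_eq_norm, dist_eq_norm]
  change _ ≤ 6 * M * ‖x - y‖
  set d := ‖x - y‖ with hdd
  by_cases hxy : x = y
  · subst hxy; simp; positivity
  have hd0 : 0 < d := norm_pos_iff.2 (sub_ne_zero.2 hxy)
  refine ContinuousLinearMap.opNorm_le_of_unit_norm (by positivity) fun v hv => ?_
  set h := d • v with hh
  have hn : ‖h‖ = d := by rw [hh, norm_smul, hv, mul_one, Real.norm_of_nonneg hd0.le]
  have t1 := abs_le.1 (hG x h)
  have t2 := abs_le.1 (hG y (h + (x - y)))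
  have t3 := abs_le.1 (hG y (x - y))
  rw [show y + (h + (x - y)) = x + h by abel, map_add] at t2
  rw [add_sub_cancel] at t3
  rw [hn] at t1
  have hn2 : ‖h + (x - y)‖ ≤ 2 * d := by
    refine (norm_add_le _ _).trans ?_; rw [hn]; linarith
  have hn3 : M * ‖h + (x - y)‖ ^ 2 ≤ M * (2 * d) ^ 2 := by gcongr
  have e1 : (G x - G y) h = d * (G x - G y) v := by rw [hh, map_smul, smul_eq_mul]
  have key : |d * (G x - G y) v| ≤ d * (6 * M * d) := by
    rw [← e1, _root_.sub_apply, abs_le]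
    rw [← hM] at t1 t2 t3
    rw [← hdd] at t3
    constructor <;> nlinarith [t1.1, t1.2, t2.1, t2.2, t3.1, t3.2]
  rw [abs_mul, abs_of_pos hd0] at key
  exact le_of_mul_le_mul_left key hd0

/-- second order Taylor expansion at points of differentiability of the derivative -/
theorem taylor2 {F : (Fin N → ℂ) → ℝ} (hF : Differentiable ℝ F) {x : Fin N → ℂ}
    (hx : DifferentiableAt ℝ (fderiv ℝ F) x) (ε : ℝ) (hε : 0 < ε) :
    ∃ δ > 0, ∀ h : Fin N → ℂ, ‖h‖ ≤ δ →
      |F (x + h) - (F x + fderiv ℝ F x h + 1/2 * fderiv ℝ (fderiv ℝ F) x h h)| ≤ ε * ‖h‖ ^ 2 := by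
  set A := fderiv ℝ (fderiv ℝ F) x with hA
  have h0 := (hasFDerivAt_iff_isLittleO_nhds_zero.1 hx.hasFDerivAt).def hε
  obtain ⟨δ, hδ, hb⟩ := Metric.eventually_nhds_iff_ball.1 h0
  refine ⟨δ / 2, by positivity, fun h hh => ?_⟩
  have := norm_image_sub_le_of_norm_deriv_le_segment_01'
    (f := fun s : ℝ => F (x + s • h) - (s * fderiv ℝ F x h + s ^ 2 * (1/2 * A h h)))
    (f' := fun s => fderiv ℝ F (x + s • h) h - (fderiv ℝ F x h + s * A h h)) (C := ε * ‖h‖ ^ 2)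
    (fun s _ => (((line_d1 hF x h s).sub
      ((((hasDerivAt_id s).mul_const (fderiv ℝ F x h)).add
        (((hasDerivAt_id s).pow 2).mul_const (1/2 * A h h))).congr_deriv
          (by simp; ring)))).hasDerivWithinAt)
    (fun s hs => by
      have hsn : ‖s • h‖ ≤ ‖h‖ := by
        rw [norm_smul, Real.norm_of_nonneg hs.1]; nlinarith [norm_nonneg h, hs.2]
      have h1 := hb (s • h) (by rw [mem_ball_zero_iff]; linarith)
      have h2 := ContinuousLinearMap.le_opNorm (fderiv ℝ F (x + s • h) - fderiv ℝ F x - A (s • h)) h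
      have e : (fderiv ℝ F (x + s • h) - fderiv ℝ F x - A (s • h)) h =
          fderiv ℝ F (x + s • h) h - (fderiv ℝ F x h + s * A h h) := by
        simp; ring
      rw [e] at h2
      refine h2.trans ?_
      have h3 : ‖fderiv ℝ F (x + s • h) - fderiv ℝ F x - A (s • h)‖ ≤ ε * ‖h‖ :=
        h1.trans (by gcongr)
      calc _ ≤ (ε * ‖h‖) * ‖h‖ := by gcongr
        _ = _ := by ring)
  simp only [one_smul, zero_smul, add_zero, one_mul, zero_mul, sub_zero, Real.norm_eq_abs,
    one_pow, ne_eq, OfNat.ofNat_ne_zero, not_false_eq_true, zero_pow] at this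
  refine le_trans (le_of_eq ?_) this
  congr 1; ring

/-- quadratic Taylor polynomial -/
def Tq (x : Fin N → ℂ) (c : ℝ) (ℓ : (Fin N → ℂ) →L[ℝ] ℝ) (A : (Fin N → ℂ) →L[ℝ] (Fin N → ℂ) →L[ℝ] ℝ)
    (z : Fin N → ℂ) : ℝ := c + ℓ (z - x) + 1/2 * A (z - x) (z - x)

theorem Tq_cd (x : Fin N → ℂ) (c : ℝ) (ℓ : (Fin N → ℂ) →L[ℝ] ℝ)
    (A : (Fin N → ℂ) →L[ℝ] (Fin N → ℂ) →L[ℝ] ℝ) : ContDiff ℝ ∞ (Tq x c ℓ A) := by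
  unfold Tq
  have h1 : ContDiff ℝ ∞ fun z : Fin N → ℂ => z - x := contDiff_id.sub contDiff_const
  exact (contDiff_const.add (ℓ.contDiff.comp h1)).add
    (contDiff_const.mul ((A.contDiff.comp h1).clm_apply h1))

theorem Tq_quad (x : Fin N → ℂ) (c : ℝ) (ℓ : (Fin N → ℂ) →L[ℝ] ℝ)
    (A : (Fin N → ℂ) →L[ℝ] (Fin N → ℂ) →L[ℝ] ℝ) (z ξ : Fin N → ℂ) (s : ℝ) :
    Tq x c ℓ A (z + s • ξ) = Tq x c ℓ A z + (ℓ ξ + 1/2 * (A (z - x) ξ + A ξ (z - x))) * s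
      + (1/2 * A ξ ξ) * s ^ 2 := by
  unfold Tq
  rw [show z + s • ξ - x = (z - x) + s • ξ by abel]
  simp only [map_add, map_smul, _root_.add_apply, _root_.smul_apply, smul_eq_mul]
  ring

theorem Tq_D2 (x : Fin N → ℂ) (c : ℝ) (ℓ : (Fin N → ℂ) →L[ℝ] ℝ)
    (A : (Fin N → ℂ) →L[ℝ] (Fin N → ℂ) →L[ℝ] ℝ) (z ξ : Fin N → ℂ) :
    D2 (Tq x c ℓ A) z ξ ξ = A ξ ξ := by
  rw [D2_of_quad (Tq_cd x c ℓ A) z ξ _ _ _ (Tq_quad x c ℓ A z ξ)]; ring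

theorem Tq_mol_D2 {φ : (Fin N → ℂ) → ℝ} (hφ : Mlf φ) (x : Fin N → ℂ) (c : ℝ) (ℓ : (Fin N → ℂ) →L[ℝ] ℝ)
    (A : (Fin N → ℂ) →L[ℝ] (Fin N → ℂ) →L[ℝ] ℝ) {ρ : ℝ} (hρ : 0 < ρ) (z ξ : Fin N → ℂ) :
    D2 (mol φ (Tq x c ℓ A) ρ) z ξ ξ = A ξ ξ := by
  have hTc := (Tq_cd x c ℓ A).continuous
  have hφc := hφ.cd.continuous
  have i1 := mol_integrable hφc hφ.cs hTc ρ z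
  have i2 : Integrable fun y => φ y * (ℓ ξ + 1/2 * (A (z - ρ • y - x) ξ + A ξ (z - ρ • y - x))) :=
    Continuous.integrable_of_hasCompactSupport (by fun_prop) hφ.cs.mul_right
  have i3 : Integrable fun y => φ y * (1/2 * A ξ ξ) :=
    Continuous.integrable_of_hasCompactSupport (by fun_prop) hφ.cs.mul_right
  have i12 := fun s : ℝ => (i1.add (i2.mul_const s) : Integrable fun y => φ y * Tq x c ℓ A (z - ρ • y) +
    φ y * (ℓ ξ + 1/2 * (A (z - ρ • y - x) ξ + A ξ (z - ρ • y - x))) * s)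
  have := D2_of_quad (mol_fderiv hφ.cd hφ.cs hTc hρ).1 z ξ (mol φ (Tq x c ℓ A) ρ z)
    (∫ y, φ y * (ℓ ξ + 1/2 * (A (z - ρ • y - x) ξ + A ξ (z - ρ • y - x)))) (1/2 * A ξ ξ) (fun s => by
      have e3 : 1/2 * A ξ ξ = ∫ y, φ y * (1/2 * A ξ ξ) := by rw [integral_mul_const, hφ.int, one_mul]
      rw [e3]
      unfold mol
      rw [← integral_mul_const, ← integral_mul_const, ← integral_add i1 (i2.mul_const s),
        ← integral_add (i12 s) (i3.mul_const _)]
      refine integral_congr_ae (Eventually.of_forall fun y => ?_)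
      beta_reduce
      rw [show z + s • ξ - ρ • y = (z - ρ • y) + s • ξ by abel, Tq_quad]
      ring)
  rw [this]; ring

theorem D2_mlf_zero {φ : (Fin N → ℂ) → ℝ} (hφ : Mlf φ) (y ξ η : Fin N → ℂ) (hy : 1 < ‖y‖) :
    D2 φ y ξ η = 0 := by
  have : φ =ᶠ[nhds y] fun _ => 0 := by
    filter_upwards [(isOpen_lt continuous_const continuous_norm).mem_nhds hy] with z hz
    exact hφ.supp z hz
  rw [D2_congr this]; simp [D2]

theorem D2_mol_tendsto {φ F : (Fin N → ℂ) → ℝ} (hφ : Mlf φ) (hFc : Continuous F) (x : Fin N → ℂ) (c : ℝ)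
    (ℓ : (Fin N → ℂ) →L[ℝ] ℝ) (A : (Fin N → ℂ) →L[ℝ] (Fin N → ℂ) →L[ℝ] ℝ)
    (hTay : ∀ ε > 0, ∃ δ > 0, ∀ h : Fin N → ℂ, ‖h‖ ≤ δ → |F (x + h) - Tq x c ℓ A (x + h)| ≤ ε * ‖h‖ ^ 2)
    (ξ : Fin N → ℂ) :
    Tendsto (fun ρ => D2 (mol φ F ρ) x ξ ξ) (nhdsWithin 0 (Set.Ioi 0)) (nhds (A ξ ξ)) := by
  have hTc := (Tq_cd x c ℓ A).continuous
  have hDc : Continuous fun y => D2 φ y ξ ξ :=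
    (cd_fderiv_apply (cd_fderiv_apply hφ.cd ξ) ξ).continuous
  have hDs : HasCompactSupport fun y => D2 φ y ξ ξ :=
    (hφ.cs.fderiv_apply (𝕜 := ℝ) ξ).fderiv_apply (𝕜 := ℝ) ξ
  set I : ℝ := ∫ y, |D2 φ y ξ ξ| with hI
  have hI0 : 0 ≤ I := integral_nonneg fun y => abs_nonneg _
  rw [Metric.tendsto_nhdsWithin_nhds]
  intro ε hε
  obtain ⟨δ, hδ, hb⟩ := hTay (ε / (2 * (I + 1))) (by positivity)
  refine ⟨δ, hδ, fun ρ hρ hρδ => ?_⟩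
  have hρ0 : 0 < ρ := hρ
  rw [dist_zero_right, Real.norm_of_nonneg hρ0.le] at hρδ
  rw [Real.dist_eq, ← Tq_mol_D2 hφ x c ℓ A hρ0 x ξ, mol_D2 hφ.cd hφ.cs hFc hρ0,
    mol_D2 hφ.cd hφ.cs hTc hρ0, ← mul_sub, abs_mul, abs_of_pos (by positivity)]
  unfold mol
  rw [← integral_sub (mol_integrable hDc hDs hFc ρ x) (mol_integrable hDc hDs hTc ρ x)]
  have hest : |∫ y, (D2 φ y ξ ξ * F (x - ρ • y) - D2 φ y ξ ξ * Tq x c ℓ A (x - ρ • y))| ≤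
      ∫ y, (ε / (2 * (I + 1)) * ρ ^ 2) * |D2 φ y ξ ξ| := by
    have hInt : Integrable (fun y => |D2 φ y ξ ξ|) volume :=
      hDc.abs.integrable_of_hasCompactSupport hDs.norm
    rw [← Real.norm_eq_abs]
    refine norm_integral_le_of_norm_le (hInt.const_mul _) (Eventually.of_forall fun y => ?_)
    rw [← mul_sub, Real.norm_eq_abs, abs_mul, mul_comm]
    by_cases hy : ‖y‖ ≤ 1
    · refine mul_le_mul_of_nonneg_right ?_ (abs_nonneg _)
      have hn : ‖-(ρ • y)‖ ≤ ρ := by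
        rw [norm_neg, norm_smul, Real.norm_of_nonneg hρ0.le]; nlinarith
      have := hb (-(ρ • y)) (by linarith)
      rw [← sub_eq_add_neg] at this
      refine this.trans ?_
      gcongr
    · simp [D2_mlf_zero hφ y ξ ξ (not_le.1 hy)]
  rw [integral_const_mul, ← hI] at hest
  calc _ ≤ ρ⁻¹ ^ 2 * (ε / (2 * (I + 1)) * ρ ^ 2 * I) := by gcongr
    _ = ε * (I / (2 * (I + 1))) := by field_simp
    _ < ε * 1 := by
      refine mul_lt_mul_of_pos_left ?_ hε
      rw [div_lt_one (by positivity)]; linarith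
    _ = ε := mul_one _

theorem D2_polar {u : (Fin N → ℂ) → ℝ} (hu : ContDiff ℝ ∞ u) (x ξ η : Fin N → ℂ) :
    D2 u x ξ η = 1/2 * (D2 u x (ξ + η) (ξ + η) - D2 u x ξ ξ - D2 u x η η) := by
  simp only [← D2L_apply hu, map_add, LinearMap.add_apply]
  rw [D2L_symm hu x η ξ]; ring

/-- convergence of Monge-Ampere from convergence of quadratic forms -/
theorem MA_tendsto {α : Type*} {l : Filter α} {u : α → (Fin N → ℂ) → ℝ} {v : (Fin N → ℂ) → ℝ}
    (hu : ∀ᶠ a in l, ContDiff ℝ ∞ (u a)) (hv : ContDiff ℝ ∞ v) (x : Fin N → ℂ)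
    (h : ∀ ξ, Tendsto (fun a => D2 (u a) x ξ ξ) l (nhds (D2 v x ξ ξ))) :
    Tendsto (fun a => MA (fun y => om y + u a y) x) l (nhds (MA (fun y => om y + v y) x)) := by
  have h2 : ∀ ξ η, Tendsto (fun a => D2 (u a) x ξ η) l (nhds (D2 v x ξ η)) := fun ξ η => by
    rw [D2_polar hv]
    refine ((((h (ξ + η)).sub (h ξ)).sub (h η)).const_mul (1/2)).congr' ?_
    filter_upwards [hu] with a ha
    exact (D2_polar ha x ξ η).symm
  have h3 : Tendsto (fun a => hess (u a) x) l (nhds (hess v x)) := by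
    refine tendsto_pi_nhds.2 fun i => tendsto_pi_nhds.2 fun j => ?_
    simp only [hess, hessB, of_apply]
    have c : ∀ ξ η, Tendsto (fun a => D2 (u a) x ξ η) l (nhds (D2 v x ξ η)) := h2
    refine Tendsto.const_mul _ (Tendsto.add ?_ (Tendsto.const_mul _ ?_))
    · exact (Complex.continuous_ofReal.tendsto _).comp ((c _ _).add (c _ _))
    · exact (Complex.continuous_ofReal.tendsto _).comp ((c _ _).sub (c _ _))
  have h4 : Continuous fun H : Matrix (Fin N) (Fin N) ℂ => (1 + H).det.re :=
    Complex.continuous_re.comp (continuous_const.add continuous_id).matrix_det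
  have e : MA (fun y => om y + v y) x = (1 + hess v x).det.re := by
    rw [MA, hess_add om_cd hv, hess_om]
  rw [e]
  refine ((h4.tendsto _).comp h3).congr' ?_
  filter_upwards [hu] with a ha
  rw [MA, hess_add om_cd ha, hess_om]; rfl

/-- the Monge-Ampere measures die a.e. off the contact set -/
theorem MA_ae {g φ : (Fin N → ℂ) → ℝ} {R t L C : ℝ} (hφ : Mlf φ) (hg : Obst g R t) (hr : Reg g L C) :
    ∀ᵐ x : Fin N → ℂ, env g x < g x →
      Tendsto (fun ρ => MA (fun y => om y + mol φ (env g) ρ y) x) (nhdsWithin 0 (Set.Ioi 0)) (nhds 0) := by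
  obtain ⟨hd, K, hK⟩ := env_C11 hφ hg hr
  have hFc := env_cont hg hr
  filter_upwards [hK.ae_differentiableAt (μ := volume)] with x hx hlt
  set T := Tq x (env g x) (fderiv ℝ (env g) x) (fderiv ℝ (fderiv ℝ (env g)) x) with hT
  have hTay : ∀ ε > 0, ∃ δ > 0, ∀ h : Fin N → ℂ, ‖h‖ ≤ δ → |env g (x + h) - T (x + h)| ≤ ε * ‖h‖ ^ 2 := by
    intro ε hε
    obtain ⟨δ, h1, h2⟩ := taylor2 hd hx ε hε
    refine ⟨δ, h1, fun h hh => ?_⟩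
    simpa [hT, Tq] using h2 h hh
  have hD := D2_mol_tendsto hφ hFc x _ _ _ hTay
  have hTD := Tq_D2 x (env g x) (fderiv ℝ (env g) x) (fderiv ℝ (fderiv ℝ (env g)) x)
  have hTo : Osp T := by
    refine ⟨Tq_cd _ _ _ _, fun z ξ => ?_⟩
    rw [hT, hTD, hTD]
    refine ge_of_tendsto ((hD ξ).add (hD (Complex.I • ξ))) ?_
    filter_upwards [self_mem_nhdsWithin] with ρ hρ
    exact (me_osp hφ hg hr hρ).2 x ξ
  have hz := no_posdef hφ hg hr x hlt hTo (fun z ξ => by rw [hT, hTD, hTD]) (by simp [hT, Tq]) hTay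
  have key : ∀ᶠ ρ in nhdsWithin (0:ℝ) (Set.Ioi 0), ContDiff ℝ ∞ (mol φ (env g) ρ) := by
    filter_upwards [self_mem_nhdsWithin] with ρ hρ
    exact (me_osp hφ hg hr hρ).1
  have := MA_tendsto (u := fun ρ => mol φ (env g) ρ) key hTo.1 x (fun ξ => by rw [hT, hTD]; exact hD ξ)
  rw [hz] at this
  exact this

end Alex

section Mass
set_option linter.unusedSimpArgs false
set_option linter.unusedVariables false
open Matrix MeasureTheory
open scoped ContDiff ComplexOrder
variable {N : ℕ}

theorem D2_off {u : (Fin N → ℂ) → ℝ} (hu : ContDiff ℝ ∞ u) (x : Fin N → ℂ) {M : ℝ}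
    (h : ∀ ξ, |D2 u x ξ ξ| ≤ M * ‖ξ‖ ^ 2) (hM : 0 ≤ M) (ξ η : Fin N → ℂ) (h1 : ‖ξ‖ ≤ 1) (h2 : ‖η‖ ≤ 1) :
    |D2 u x ξ η| ≤ 3 * M := by
  rw [D2_polar hu]
  have a1 : |D2 u x ξ ξ| ≤ M := (h ξ).trans (by nlinarith [norm_nonneg ξ, pow_le_one₀ (n := 2) (norm_nonneg ξ) h1])
  have a2 : |D2 u x η η| ≤ M := (h η).trans (by nlinarith [norm_nonneg η, pow_le_one₀ (n := 2) (norm_nonneg η) h2])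
  have a3 : |D2 u x (ξ + η) (ξ + η)| ≤ 4 * M := (h _).trans (by
    have : ‖ξ + η‖ ≤ 2 := (norm_add_le _ _).trans (by linarith)
    have : ‖ξ + η‖ ^ 2 ≤ 2 ^ 2 := pow_le_pow_left₀ (norm_nonneg _) this 2
    nlinarith)
  rw [abs_le] at *
  constructor <;> linarith [a1.1, a1.2, a2.1, a2.2, a3.1, a3.2]

theorem hess_bound {u : (Fin N → ℂ) → ℝ} (hu : ContDiff ℝ ∞ u) (x : Fin N → ℂ) {M : ℝ}
    (h : ∀ ξ, |D2 u x ξ ξ| ≤ M * ‖ξ‖ ^ 2) (hM : 0 ≤ M) (i j : Fin N) : ‖hess u x i j‖ ≤ 3 * M := by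
  have n1 : ∀ i : Fin N, ‖(Pi.single i (1:ℂ) : Fin N → ℂ)‖ ≤ 1 := fun i => by simp [Pi.norm_single]
  have n2 : ∀ i : Fin N, ‖(Pi.single i Complex.I : Fin N → ℂ)‖ ≤ 1 := fun i => by simp [Pi.norm_single]
  have e := D2_off hu x h hM
  simp only [hess, hessB, of_apply]
  have q1 := e _ _ (n1 i) (n1 j)
  have q2 := e _ _ (n2 i) (n2 j)
  have q3 := e _ _ (n1 i) (n2 j)
  have q4 := e _ _ (n2 i) (n1 j)
  rw [norm_mul]
  have : ‖(1/4:ℂ)‖ = 1/4 := by norm_num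
  rw [this]
  have b1 := norm_add_le ((↑(D2 u x (Pi.single i 1) (Pi.single j 1) + D2 u x (Pi.single i Complex.I) (Pi.single j Complex.I)) : ℂ))
    (Complex.I * ↑(D2 u x (Pi.single i 1) (Pi.single j Complex.I) - D2 u x (Pi.single i Complex.I) (Pi.single j 1)))
  rw [norm_mul, Complex.norm_I, one_mul, Complex.norm_real, Complex.norm_real, Real.norm_eq_abs, Real.norm_eq_abs] at b1
  have b2 := abs_add_le (D2 u x (Pi.single i 1) (Pi.single j 1)) (D2 u x (Pi.single i Complex.I) (Pi.single j Complex.I))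
  have b3 := abs_sub (D2 u x (Pi.single i 1) (Pi.single j Complex.I)) (D2 u x (Pi.single i Complex.I) (Pi.single j 1))
  linarith

theorem MA_bound {u : (Fin N → ℂ) → ℝ} (hu : ContDiff ℝ ∞ u) (x : Fin N → ℂ) {M : ℝ}
    (h : ∀ ξ, |D2 u x ξ ξ| ≤ M * ‖ξ‖ ^ 2) (hM : 0 ≤ M) :
    MA (fun y => om y + u y) x ≤ (N.factorial : ℝ) * (1 + 3 * M) ^ N := by
  have : ∀ i j, (NormedField.toAbsoluteValue ℂ) ((1 + hess u x) i j) ≤ 1 + 3 * M := fun i j => by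
    change ‖(1 + hess u x) i j‖ ≤ _
    rw [Matrix.add_apply]
    refine (norm_add_le _ _).trans (add_le_add ?_ (hess_bound hu x h hM i j))
    rw [Matrix.one_apply]; split_ifs <;> simp
  have := Matrix.det_le this
  rw [MA, hess_add om_cd hu, hess_om]
  refine (Complex.re_le_norm _).trans (this.trans ?_)
  simp [nsmul_eq_mul]

def Cs (N : ℕ) (C : ℝ) : ℝ := (N.factorial : ℝ) * (1 + 3 * (2 * C + 4 * N)) ^ N

theorem me_MA_le {g φ : (Fin N → ℂ) → ℝ} {R t L C ρ : ℝ} (hφ : Mlf φ) (hg : Obst g R t) (hr : Reg g L C)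
    (hρ : 0 < ρ) (x : Fin N → ℂ) : MA (fun y => om y + mol φ (env g) ρ y) x ≤ Cs N C := by
  have := hr.C0
  exact MA_bound (me_osp hφ hg hr hρ).1 x (me_D2_abs hφ hg hr hρ x) (by positivity)

theorem me_MA_nonneg {g φ : (Fin N → ℂ) → ℝ} {R t L C ρ : ℝ} (hφ : Mlf φ) (hg : Obst g R t) (hr : Reg g L C)
    (hρ : 0 < ρ) (x : Fin N → ℂ) : 0 ≤ MA (fun y => om y + mol φ (env g) ρ y) x :=
  (me_osp hφ hg hr hρ).sp.MA_nonneg x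

theorem Cs_nonneg {C : ℝ} (hC : 0 ≤ C) : 0 ≤ Cs N C := by unfold Cs; positivity

theorem me_tendsto {g φ : (Fin N → ℂ) → ℝ} {R t L C : ℝ} (hφ : Mlf φ) (hg : Obst g R t) (hr : Reg g L C)
    (x : Fin N → ℂ) : Tendsto (fun ρ => mol φ (env g) ρ x) (nhdsWithin 0 (Set.Ioi 0)) (nhds (env g x)) := by
  rw [tendsto_iff_norm_sub_tendsto_zero]
  have : Tendsto (fun ρ : ℝ => L * ρ) (nhdsWithin 0 (Set.Ioi 0)) (nhds 0) := by
    have : Tendsto (fun ρ : ℝ => L * ρ) (nhds 0) (nhds (L * 0)) := (continuous_const.mul continuous_id).tendsto 0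
    rw [mul_zero] at this
    exact this.mono_left nhdsWithin_le_nhds
  refine squeeze_zero' (Eventually.of_forall fun _ => norm_nonneg _) ?_ this
  filter_upwards [self_mem_nhdsWithin] with ρ hρ
  exact me_close hφ hg hr hρ x

theorem Bpos {g : (Fin N → ℂ) → ℝ} {R t : ℝ} (hg : Obst g R t) : 0 ≤ t + N * A0 R t ^ 2 := by
  have := hg.t0; positivity

theorem ev01 : ∀ᶠ ρ : ℝ in nhdsWithin 0 (Set.Ioi 0), 0 < ρ ∧ ρ ≤ 1 := by
  filter_upwards [Ioc_mem_nhdsGT (show (0:ℝ) < 1 by norm_num)] with ρ h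
  exact h

theorem mass_low {g φ : (Fin N → ℂ) → ℝ} {R t L C τ : ℝ} (hφ : Mlf φ) (hg : Obst g R t) (hr : Reg g L C)
    (hτ : 0 < τ) (h : τ ≤ ∫ x, -env g x) :
    ∀ᶠ ρ in nhdsWithin (0:ℝ) (Set.Ioi 0), τ / 2 ≤ (t + N * A0 R t ^ 2) *
      ∫ x in {x | g x ≠ 0}, MA (fun y => om y + mol φ (env g) ρ y) x := by
  set B := t + N * A0 R t ^ 2 with hB
  have hB0 : 0 ≤ B := Bpos hg
  have hC0 := Cs_nonneg (N := N) hr.C0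
  set K := Metric.closedBall (0 : Fin N → ℂ) (A0 R t + 1) with hK
  have hKf : volume K ≠ ⊤ := (isCompact_closedBall _ _).measure_lt_top.ne
  have hKm : MeasurableSet K := isClosed_closedBall.measurableSet
  have zK : ∀ ρ, 0 < ρ ∧ ρ ≤ 1 → ∀ x, x ∉ K → mol φ (env g) ρ x = 0 := fun ρ h x hx =>
    me_zero hφ hg hr h.1 h.2 x (by rw [hK, mem_closedBall_zero_iff] at hx; linarith)
  have hUo : IsOpen {x | g x ≠ 0} := isOpen_ne_fun hg.cd.continuous continuous_const
  have t1 : Tendsto (fun ρ => ∫ x, -mol φ (env g) ρ x) (nhdsWithin 0 (Set.Ioi 0)) (nhds (∫ x, -env g x)) := by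
    refine tendsto_integral_filter_of_dominated_convergence (K.indicator fun _ => B) ?_ ?_ ?_ ?_
    · filter_upwards [ev01] with ρ h
      exact (me_osp hφ hg hr h.1).1.continuous.neg.aestronglyMeasurable
    · filter_upwards [ev01] with ρ h
      refine Eventually.of_forall fun x => ?_
      by_cases hx : x ∈ K
      · rw [Set.indicator_of_mem hx, norm_neg, Real.norm_eq_abs, abs_le]
        exact ⟨me_ge hφ hg hr x, (me_np hφ hg hr x).trans hB0⟩
      · rw [Set.indicator_of_notMem hx, zK ρ h x hx]; simp
    · exact (integrable_indicator_iff hKm).2 (integrableOn_const hKf)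
    · exact Eventually.of_forall fun x => (me_tendsto hφ hg hr x).neg
  have t2 : Tendsto (fun ρ => ∫ x in {x | g x ≠ 0}ᶜ, -mol φ (env g) ρ x * MA (fun y => om y + mol φ (env g) ρ y) x)
      (nhdsWithin 0 (Set.Ioi 0)) (nhds (∫ x in {x | g x ≠ 0}ᶜ, (0:ℝ))) := by
    refine tendsto_integral_filter_of_dominated_convergence (K.indicator fun _ => B * Cs N C) ?_ ?_ ?_ ?_
    · filter_upwards [ev01] with ρ h
      have h1 := (me_osp hφ hg hr h.1).1
      exact (h1.continuous.neg.mul (MA_cont (om_cd.add h1))).aestronglyMeasurable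
    · filter_upwards [ev01] with ρ h
      refine Eventually.of_forall fun x => ?_
      by_cases hx : x ∈ K
      · rw [Set.indicator_of_mem hx, norm_mul, norm_neg]
        refine mul_le_mul ?_ ?_ (norm_nonneg _) hB0
        · rw [Real.norm_eq_abs, abs_le]
          exact ⟨me_ge hφ hg hr x, (me_np hφ hg hr x).trans hB0⟩
        · rw [Real.norm_of_nonneg (me_MA_nonneg hφ hg hr h.1 x)]
          exact me_MA_le hφ hg hr h.1 x
      · rw [Set.indicator_of_notMem hx, zK ρ h x hx]; simp
    · exact ((integrable_indicator_iff hKm).2 (integrableOn_const hKf)).integrableOn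
    · rw [ae_restrict_iff' hUo.measurableSet.compl]
      filter_upwards [MA_ae hφ hg hr] with x hx hxU
      have gx : g x = 0 := by simpa using hxU
      rcases (env_le hg x).lt_or_eq with hlt | heq
      · have := (me_tendsto hφ hg hr x).neg.mul (hx hlt)
        simpa using this
      · have h1 := (me_tendsto hφ hg hr x).neg.mul_const (Cs N C)
        rw [heq, gx, neg_zero, zero_mul] at h1
        refine squeeze_zero' ?_ ?_ h1
        · filter_upwards [ev01] with ρ h
          exact mul_nonneg (neg_nonneg.2 (me_np hφ hg hr x)) (me_MA_nonneg hφ hg hr h.1 x)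
        · filter_upwards [ev01] with ρ h
          exact mul_le_mul_of_nonneg_left (me_MA_le hφ hg hr h.1 x) (neg_nonneg.2 (me_np hφ hg hr x))
  rw [integral_zero] at t2
  have t3 := t1.sub t2
  rw [sub_zero] at t3
  filter_upwards [ev01, (tendsto_order.1 t3).1 (τ / 2) (by linarith)] with ρ hρ h3
  have ho := me_osp hφ hg hr hρ.1
  have hcs := me_cs hφ hg hr hρ.1 hρ.2
  have hI := I_mono om_sp ho.1 hcs ho.sp
  simp only [MA_om, mul_one] at hI
  have hInt : Integrable fun x => -mol φ (env g) ρ x * MA (fun y => om y + mol φ (env g) ρ y) x :=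
    (ho.1.continuous.neg.mul (MA_cont (om_cd.add ho.1))).integrable_of_hasCompactSupport hcs.neg.mul_right
  have hsplit := integral_add_compl hUo.measurableSet hInt
  have hI2 : ∫ x, -mol φ (env g) ρ x ≤ ∫ x, -mol φ (env g) ρ x * MA (fun y => om y + mol φ (env g) ρ y) x := by
    simp only [neg_mul, integral_neg]; linarith
  have hUfin : IntegrableOn (MA fun y => om y + mol φ (env g) ρ y) {x | g x ≠ 0} := by
    have hc := hg.cs.isCompact
    exact ((MA_cont (om_cd.add ho.1)).continuousOn.integrableOn_compact hc).mono_set (subset_tsupport g)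
  have hle : ∫ x in {x | g x ≠ 0}, -mol φ (env g) ρ x * MA (fun y => om y + mol φ (env g) ρ y) x ≤
      B * ∫ x in {x | g x ≠ 0}, MA (fun y => om y + mol φ (env g) ρ y) x := by
    rw [← integral_const_mul]
    refine integral_mono hInt.integrableOn (hUfin.const_mul B) fun x => ?_
    exact mul_le_mul_of_nonneg_right (by have := me_ge (ρ := ρ) hφ hg hr x; linarith) (me_MA_nonneg hφ hg hr hρ.1 x)
  linarith

end Mass

section Iter
set_option linter.unusedSimpArgs false
set_option linter.unusedVariables false
open Matrix MeasureTheory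
open scoped ContDiff ComplexOrder Manifold
variable {N : ℕ}

theorem cutoff_exists {E O : Set (Fin N → ℂ)} (hE : IsCompact E) (hO : IsOpen O) (h : E ⊆ O) :
    ∃ κ : (Fin N → ℂ) → ℝ, ContDiff ℝ ∞ κ ∧ HasCompactSupport κ ∧ (∀ᶠ x in nhdsSet E, κ x = 1) ∧
      (∀ x, x ∉ O → κ x = 0) ∧ ∀ x, 0 ≤ κ x ∧ κ x ≤ 1 := by
  obtain ⟨t, ht, h1, h2⟩ := exists_compact_between hE hO h
  obtain ⟨f, f1, f2, f3⟩ := exists_contMDiffMap_one_nhds_of_subset_interior (n := (⊤ : ℕ∞)) 𝓘(ℝ, Fin N → ℂ)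
    hE.isClosed h1
  refine ⟨f, f.contMDiff.contDiff, HasCompactSupport.intro ht f2, f1, fun x hx => f2 x fun h => hx (h2 h), f3⟩

structure Cut (E : Set (Fin N → ℂ)) (R : ℝ) (κ : (Fin N → ℂ) → ℝ) : Prop where
  cd : ContDiff ℝ ∞ κ
  cs : HasCompactSupport κ
  one : ∀ᶠ x in nhdsSet E, κ x = 1
  z : ∀ x, R ≤ om x → κ x = 0
  r : ∀ x, 0 ≤ κ x ∧ κ x ≤ 1

def gk (t : ℝ) (κ : (Fin N → ℂ) → ℝ) : (Fin N → ℂ) → ℝ := fun x => -(κ x * (om x + t))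

theorem Cut.obst {E : Set (Fin N → ℂ)} {R t : ℝ} {κ : (Fin N → ℂ) → ℝ} (h : Cut E R κ) (ht : 0 ≤ t)
    (hR : 0 ≤ R) : Obst (gk t κ) R t where
  cd := (h.cd.mul (om_cd.add contDiff_const)).neg
  cs := (h.cs.mul_right (f' := fun x => om x + t)).neg
  np x := by
    have := mul_nonneg (h.r x).1 (add_nonneg (om_nonneg x) ht)
    unfold gk; linarith
  ge x := by
    have := mul_le_mul_of_nonneg_right (h.r x).2 (add_nonneg (om_nonneg x) ht)
    unfold gk; linarith
  z x hx := by simp [gk, h.z x hx]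
  t0 := ht
  R0 := hR

/-- the standing hypothesis -/
def Wit (E : Set (Fin N → ℂ)) (δ : ℝ) : Prop := ∀ Rad : ℝ, ∃ C0 : ℝ, ∀ ε > 0, ∃ a b : (Fin N → ℂ) → ℝ,
  Sp a ∧ Sp b ∧ (∀ x ∈ closedBall (0 : Fin N → ℂ) Rad, |a x - b x| ≤ C0) ∧ (∀ x ∈ E, δ < a x - b x) ∧
  (∀ x ∈ closedBall (0 : Fin N → ℂ) Rad, -ε ≤ a x - b x) ∧
  (∫ x in closedBall (0 : Fin N → ℂ) Rad, |a x - b x|) ≤ ε ∧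
  (∫ x in closedBall (0 : Fin N → ℂ) Rad, |a x|) ≤ C0

theorem env_mono {g g' : (Fin N → ℂ) → ℝ} {R t : ℝ} (hg : Obst g R t)
    (h : ∀ x, g x ≤ g' x) (x : Fin N → ℂ) : env g x ≤ env g' x :=
  env_lub hg x _ fun ψ hψ => le_env ⟨hψ.1, fun y => (hψ.2 y).trans (h y)⟩ x

/-- Lr against a fixed cutoff depends only on behaviour where the cutoff varies -/
theorem Lr_theta {v θ : (Fin N → ℂ) → ℝ} {A : ℝ} (hv : ∀ x, A < ‖x‖ → v =ᶠ[nhds x] om)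
    (hθ : ∀ x, ‖x‖ ≤ A → θ =ᶠ[nhds x] fun _ => 1) (x : Fin N → ℂ) : Lr v θ x = Lr om θ x := by
  by_cases h : ‖x‖ ≤ A
  · rw [Lr_congr v (hθ x h), Lr_congr om (hθ x h)]
    simp [Lr, hess_const]
  · rw [Lr, hess_congr (hv x (not_le.1 h)), Lr]

theorem ci {h : (Fin N → ℂ) → ℝ} (hh : Continuous h) (Rad : ℝ) :
    IntegrableOn h (closedBall (0 : Fin N → ℂ) Rad) :=
  hh.continuousOn.integrableOn_compact (isCompact_closedBall _ _)

theorem int_theta_le {θ h : (Fin N → ℂ) → ℝ} {Rad M I : ℝ} (hθ : Continuous θ)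
    (hθs : tsupport θ ⊆ closedBall 0 Rad) (hh : Continuous h) (hM : ∀ x, |θ x| ≤ M)
    (hI : ∫ x in closedBall (0 : Fin N → ℂ) Rad, |h x| ≤ I) : ∫ x, h x * θ x ≤ M * I := by
  have hcs : HasCompactSupport θ := HasCompactSupport.of_support_subset_isCompact (isCompact_closedBall 0 Rad)
    ((subset_tsupport θ).trans hθs)
  have i1 : Integrable fun x => h x * θ x := (hh.mul hθ).integrable_of_hasCompactSupport hcs.mul_left
  have i2 : IntegrableOn (fun x => |h x|) (closedBall (0 : Fin N → ℂ) Rad) :=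
    hh.abs.continuousOn.integrableOn_compact (isCompact_closedBall _ _)
  have e : ∫ x, h x * θ x = ∫ x in closedBall (0 : Fin N → ℂ) Rad, h x * θ x := by
    rw [setIntegral_eq_integral_of_forall_compl_eq_zero]
    intro x hx
    rw [image_eq_zero_of_notMem_tsupport fun h => hx (hθs h), mul_zero]
  have hM0 : 0 ≤ M := (abs_nonneg _).trans (hM 0)
  rw [e]
  calc _ ≤ ∫ x in closedBall (0 : Fin N → ℂ) Rad, M * |h x| := by
        refine integral_mono i1.integrableOn (i2.const_mul M) fun x => ?_
        calc h x * θ x ≤ |h x| * |θ x| := by rw [← abs_mul]; exact le_abs_self _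
          _ ≤ M * |h x| := by rw [mul_comm]; exact mul_le_mul_of_nonneg_right (hM x) (abs_nonneg _)
    _ = M * ∫ x in closedBall (0 : Fin N → ℂ) Rad, |h x| := integral_const_mul _ _
    _ ≤ M * I := mul_le_mul_of_nonneg_left hI hM0

theorem Gam_const {v θ a b : (Fin N → ℂ) → ℝ} {Rad M C0 : ℝ} (hv : Sp v) (ha : Sp a) (hb : Sp b)
    (hθ : ContDiff ℝ ∞ θ) (hθs : tsupport θ ⊆ closedBall 0 Rad) (hθ0 : ∀ x, 0 ≤ θ x)
    (hL : ∀ x, Lr v θ x = Lr om θ x) (hM : ∀ x, |Lr om θ x| ≤ M)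
    (h1 : ∀ x ∈ closedBall (0 : Fin N → ℂ) Rad, |a x - b x| ≤ C0) (hC : 0 ≤ C0)
    (h2 : (∫ x in closedBall (0 : Fin N → ℂ) Rad, |a x - b x|) ≤ 1)
    (h3 : (∫ x in closedBall (0 : Fin N → ℂ) Rad, |a x|) ≤ C0) :
    ∫ x, θ x * Gam v (fun x => a x - b x) (fun x => a x - b x) x ≤
      1/2 * (M * C0) + C0 * (M * (2 * C0 + 1)) := by
  have hcs : HasCompactSupport θ := HasCompactSupport.of_support_subset_isCompact (isCompact_closedBall 0 Rad)
    ((subset_tsupport θ).trans hθs)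
  have hac := ha.1.continuous
  have hbc := hb.1.continuous
  have hLc := Lr_cont om_cd hθ
  have hLs : tsupport (Lr om θ) ⊆ closedBall 0 Rad := by
    refine (closure_minimal ?_ (isClosed_tsupport θ)).trans hθs
    intro x hx
    by_contra h
    exact hx (Lr_supp om h)
  have := Gam_mass (f := fun x => a x - b x) hv ha hb (fun _ => rfl) hθ hcs hθ0 hL C0 (fun x hx => h1 x (hθs hx))
  refine this.trans (add_le_add (mul_le_mul_of_nonneg_left ?_ (by norm_num)) (mul_le_mul_of_nonneg_left ?_ hC))
  · refine int_theta_le hLc hLs (by fun_prop) hM ?_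
    calc _ ≤ ∫ x in closedBall (0 : Fin N → ℂ) Rad, C0 * |a x - b x| := by
          refine setIntegral_mono_on (ci (by fun_prop) Rad)
            (ci (by fun_prop) Rad) measurableSet_closedBall
            fun x hx => ?_
          rw [abs_mul]
          exact mul_le_mul_of_nonneg_right (h1 x hx) (abs_nonneg _)
      _ = C0 * ∫ x in closedBall (0 : Fin N → ℂ) Rad, |a x - b x| := integral_const_mul _ _
      _ ≤ C0 * 1 := mul_le_mul_of_nonneg_left h2 hC
      _ = C0 := mul_one _
  · refine int_theta_le hLc hLs (by fun_prop) hM ?_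
    calc _ ≤ ∫ x in closedBall (0 : Fin N → ℂ) Rad, (2 * |a x| + |a x - b x|) := by
          refine setIntegral_mono_on (ci (by fun_prop) Rad)
            (ci (by fun_prop) Rad) measurableSet_closedBall
            fun x hx => ?_
          have : a x + b x = 2 * a x - (a x - b x) := by ring
          rw [this]
          refine (abs_sub _ _).trans ?_
          rw [abs_mul]; simp
      _ = 2 * (∫ x in closedBall (0 : Fin N → ℂ) Rad, |a x|) + ∫ x in closedBall (0 : Fin N → ℂ) Rad, |a x - b x| := by
          rw [integral_add (ci (by fun_prop) Rad)
            (ci (by fun_prop) Rad), integral_const_mul]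
      _ ≤ 2 * C0 + 1 := by linarith

/-- comparison of the two Monge-Ampere measures tested against f -/
theorem gap {g g' φ θ a b : (Fin N → ℂ) → ℝ} {R t L C L' C' δ ε c0 CG Rad : ℝ} (hφ : Mlf φ) (hg : Obst g R t)
    (hr : Reg g L C) (hg' : Obst g' R t) (hr' : Reg g' L' C') (hle : ∀ x, g x ≤ g' x) {ρ : ℝ} (hρ : 0 < ρ)
    (hρ1 : ρ ≤ 1)
    (hθ : ContDiff ℝ ∞ θ) (hθs : tsupport θ ⊆ closedBall 0 Rad) (hθ0 : ∀ x, 0 ≤ θ x) (hθ2 : ∀ x, θ x ≤ 1)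
    (hθ1 : ∀ x, ‖x‖ ≤ A0 R t + 1 → θ =ᶠ[nhds x] fun _ => 1)
    (ha : Sp a) (hb : Sp b) (hδ0 : 0 < δ) (hδ : ∀ x, g' x ≠ 0 → δ < a x - b x)
    (hε0 : 0 < ε) (hε : ∀ x ∈ closedBall (0 : Fin N → ℂ) Rad, -ε ≤ a x - b x)
    (hε1 : (∫ x in closedBall (0 : Fin N → ℂ) Rad, |a x - b x|) ≤ ε)
    (hc0 : c0 ≤ ∫ x in {x | g' x ≠ 0}, MA (fun y => om y + mol φ (env g') ρ y) x) (hc : 0 < c0)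
    (hεs : ε * ((∫ x, θ x) + Cs N C) ≤ δ * c0 / 2) (hCG0 : 0 < CG)
    (hCG : ∀ v, Sp v → (∀ x, Lr v θ x = Lr om θ x) →
      ∫ x, θ x * Gam v (fun x => a x - b x) (fun x => a x - b x) x ≤ CG) :
    δ ^ 2 * c0 ^ 2 / (4 * CG) ≤
      ∫ x, (mol φ (env g') ρ x - mol φ (env g) ρ x) * MA (fun y => om y + mol φ (env g) ρ y) x := by
  have hcs : HasCompactSupport θ := HasCompactSupport.of_support_subset_isCompact (isCompact_closedBall 0 Rad)
    ((subset_tsupport θ).trans hθs)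
  have hac := ha.1.continuous
  have hbc := hb.1.continuous
  have ho := me_osp hφ hg hr hρ
  have ho' := me_osp hφ hg' hr' hρ
  set F := mol φ (env g) ρ with hF
  set F' := mol φ (env g') ρ with hF'
  set v : (Fin N → ℂ) → ℝ := fun y => om y + F y with hv
  set d : (Fin N → ℂ) → ℝ := fun y => F' y - F y with hd
  have hdc : ContDiff ℝ ∞ d := ho'.1.sub ho.1
  have hvd : (fun y => v y + d y) = fun y => om y + F' y := by ext y; simp only [hv, hd]; ring
  have hFz : ∀ x, A0 R t + 1 ≤ ‖x‖ → F x = 0 := me_zero hφ hg hr hρ hρ1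
  have hFz' : ∀ x, A0 R t + 1 ≤ ‖x‖ → F' x = 0 := me_zero hφ hg' hr' hρ hρ1
  have hdz : ∀ x, A0 R t + 1 ≤ ‖x‖ → d x = 0 := fun x hx => by simp only [hd]; rw [hFz x hx, hFz' x hx, sub_zero]
  have hds : tsupport d ⊆ closedBall 0 (A0 R t + 1) := by
    refine closure_minimal (fun x hx => ?_) isClosed_closedBall
    rw [mem_closedBall_zero_iff]
    by_contra h
    exact hx (hdz x (not_le.1 h).le)
  have hdcs : HasCompactSupport d := HasCompactSupport.of_support_subset_isCompact
    (isCompact_closedBall 0 (A0 R t + 1)) ((subset_tsupport d).trans hds)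
  have hd0 : ∀ x, 0 ≤ d x := fun x => sub_nonneg.2
    (mol_mono hφ (env_cont hg hr) (env_cont hg' hr') ρ x fun y _ => env_mono hg hle _)
  have hθd : ∀ x ∈ tsupport d, θ =ᶠ[nhds x] fun _ => 1 := fun x hx => hθ1 x (mem_closedBall_zero_iff.1 (hds hx))
  have hθF' : ∀ x ∈ tsupport F', θ =ᶠ[nhds x] fun _ => 1 := fun x hx =>
    hθ1 x (mem_closedBall_zero_iff.1 (me_supp hφ hg' hr' hρ hρ1 hx))
  have hsv : Sp v := ho.sp
  have hsv1 : Sp fun y => v y + d y := by rw [hvd]; exact ho'.sp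
  have hGam : ∀ s : ℝ, 0 ≤ s → s ≤ 1 →
      ∫ x, θ x * Gam (fun y => v y + s * d y) (fun x => a x - b x) (fun x => a x - b x) x ≤ CG := by
    intro s h0 h1
    refine hCG _ (Sp.path hsv hsv1 hdc s h0 h1) (Lr_theta (A := A0 R t + 1) (fun x hx => ?_) hθ1)
    filter_upwards [(isOpen_lt continuous_const continuous_norm).mem_nhds hx] with y hy
    have hy' : A0 R t + 1 ≤ ‖y‖ := le_of_lt hy
    rw [hdz y hy', hv]; simp [hFz y hy']
  have hpath := path_est hsv hsv1 (f := fun x => a x - b x) (ha.1.sub hb.1) hdc hdcs hd0 hθ hcs hθ0 hθd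
    (δ * c0 / (2 * CG)) (by positivity) CG hGam
  rw [hvd] at hpath
  -- upper bound
  have hup : ∫ x, θ x * (a x - b x) * MA v x ≤ Cs N C * ε := by
    have hm : ∀ x, |θ x * MA v x| ≤ Cs N C := fun x => by
      rw [abs_of_nonneg (mul_nonneg (hθ0 x) (hsv.MA_nonneg x))]
      calc _ ≤ 1 * MA v x := mul_le_mul_of_nonneg_right (hθ2 x) (hsv.MA_nonneg x)
        _ ≤ _ := by rw [one_mul]; exact me_MA_le hφ hg hr hρ x
    have := int_theta_le (θ := fun x => θ x * MA v x) (h := fun x => a x - b x)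
      (hθ.continuous.mul (MA_cont hsv.1)) ((tsupport_mul_subset_left).trans hθs) (hac.sub hbc) hm hε1
    refine le_trans (le_of_eq ?_) this
    exact integral_congr_ae (Eventually.of_forall fun x => by ring)
  -- lower bound
  have hMc := MA_cont ho'.sp.1
  have hlow : δ * c0 - ε * ∫ x, θ x ≤ ∫ x, θ x * (a x - b x) * MA (fun y => om y + F' y) x := by
    have hmass : ∫ x, θ x * MA (fun y => om y + F' y) x = ∫ x, θ x := by
      have := mass_path om_cd ho'.1 (me_cs hφ hg' hr' hρ hρ1) hθ hcs hθF' 1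
      simpa [MA_om] using this
    have i1 : Integrable fun x => θ x * (a x - b x) * MA (fun y => om y + F' y) x :=
      Continuous.integrable_of_hasCompactSupport ((hθ.continuous.mul (hac.sub hbc)).mul hMc)
        (hcs.mul_right.mul_right)
    have i2 : Integrable fun x => ε * (θ x * MA (fun y => om y + F' y) x) :=
      (Continuous.integrable_of_hasCompactSupport (hθ.continuous.mul hMc) hcs.mul_right).const_mul ε
    have hUo : IsOpen {x | g' x ≠ 0} := isOpen_ne_fun hg'.cd.continuous continuous_const
    have hUfin : IntegrableOn (MA fun y => om y + F' y) {x | g' x ≠ 0} :=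
      (hMc.continuousOn.integrableOn_compact hg'.cs.isCompact).mono_set (subset_tsupport g')
    have hUA : ∀ x, g' x ≠ 0 → θ x = 1 := fun x hx => by
      by_contra h
      have hn : A0 R t + 1 < ‖x‖ := by
        by_contra h'
        exact h (hθ1 x (not_lt.1 h')).self_of_nhds
      exact hx (le_antisymm (hg'.np x) (by
        have h1 := env_zero hg' x (by linarith)
        have h2 := env_le hg' x
        linarith))
    have h4 : ∫ x, ({x | g' x ≠ 0}.indicator fun x => δ * MA (fun y => om y + F' y) x) x ≤
        ∫ x, (θ x * (a x - b x) * MA (fun y => om y + F' y) x + ε * (θ x * MA (fun y => om y + F' y) x)) := by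
      refine integral_mono ((integrable_indicator_iff hUo.measurableSet).2 (hUfin.const_mul δ)) (i1.add i2) fun x => ?_
      have hn := ho'.sp.MA_nonneg x
      by_cases hx : g' x ≠ 0
      · rw [Set.indicator_of_mem (show x ∈ {x | g' x ≠ 0} from hx)]
        beta_reduce
        rw [hUA x hx]
        have := hδ x hx
        nlinarith
      · rw [Set.indicator_of_notMem (show x ∉ {x | g' x ≠ 0} from hx)]
        beta_reduce
        by_cases hxr : x ∈ closedBall (0 : Fin N → ℂ) Rad
        · have h5 := hε x hxr
          have h6 := mul_nonneg (hθ0 x) hn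
          nlinarith [mul_nonneg (show 0 ≤ (a x - b x) + ε by linarith) h6]
        · rw [image_eq_zero_of_notMem_tsupport fun h => hxr (hθs h)]; simp
    rw [integral_add i1 i2, integral_const_mul, hmass, integral_indicator hUo.measurableSet,
      integral_const_mul] at h4
    have := mul_le_mul_of_nonneg_left hc0 hδ0.le
    linarith
  have hX : δ * c0 / 2 ≤ δ * c0 / (2 * CG) / 2 * CG + 1 / (2 * (δ * c0 / (2 * CG))) * ∫ x, d x * MA v x := by
    refine le_trans ?_ hpath
    nlinarith
  have e1 : δ * c0 / (2 * CG) / 2 * CG = δ * c0 / 4 := by field_simp; norm_num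
  have e2 : 1 / (2 * (δ * c0 / (2 * CG))) = CG / (δ * c0) := by field_simp
  rw [e1, e2] at hX
  have h7 : δ * c0 / 4 ≤ CG / (δ * c0) * ∫ x, d x * MA v x := by linarith
  have hp : 0 < δ * c0 := mul_pos hδ0 hc
  calc δ ^ 2 * c0 ^ 2 / (4 * CG) = (δ * c0 / CG) * (δ * c0 / 4) := by field_simp
    _ ≤ (δ * c0 / CG) * (CG / (δ * c0) * ∫ x, d x * MA v x) := mul_le_mul_of_nonneg_left h7 (by positivity)
    _ = ∫ x, d x * MA v x := by field_simp

end Iter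

section Thin
set_option linter.unusedSimpArgs false
set_option linter.unusedVariables false
open Matrix MeasureTheory
open scoped ContDiff ComplexOrder Manifold
variable {N : ℕ}

theorem A0_pos {R t : ℝ} (hR : 0 ≤ R) : 0 < A0 R t := by unfold A0; positivity

theorem thinning {E : Set (Fin N → ℂ)} (hE : IsCompact E) {δ : ℝ} (hδ : 0 < δ) (hW : Wit E δ) {R t τ : ℝ}
    (hR : 0 ≤ R) (hER : ∀ x ∈ E, om x < R) (ht : 0 < t) (hτ : 0 < τ) :
    ∃ κ, Cut E R κ ∧ ∫ x, -env (gk t κ) x < τ := by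
  by_contra hcon
  push Not at hcon
  obtain ⟨φ, hφ⟩ := mlf_exists (N := N)
  obtain ⟨θ, hθ, hθc, hθ1, -, hθr⟩ := cutoff_exists (isCompact_closedBall (0 : Fin N → ℂ) (A0 R t + 1))
    isOpen_univ (Set.subset_univ _)
  have hθ1' : ∀ x, ‖x‖ ≤ A0 R t + 1 → θ =ᶠ[nhds x] fun _ => 1 := fun x hx =>
    hθ1.filter_mono (nhds_le_nhdsSet (mem_closedBall_zero_iff.2 hx))
  obtain ⟨Rad, hRad⟩ := hθc.isCompact.isBounded.subset_closedBall (0 : Fin N → ℂ)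
  obtain ⟨C0, hC0⟩ := hW Rad
  obtain ⟨M, hM⟩ : ∃ M, ∀ x, |Lr om θ x| ≤ M := by
    have hs : HasCompactSupport (Lr om θ) := HasCompactSupport.intro hθc.isCompact fun x hx => Lr_supp om hx
    obtain ⟨M, hM⟩ := hs.exists_bound_of_continuous (Lr_cont om_cd hθ)
    exact ⟨M, hM⟩
  have hM0 : 0 ≤ M := (abs_nonneg _).trans (hM 0)
  set B := t + N * A0 R t ^ 2 with hB
  have hB0 : 0 < B := by positivity
  set c0 := τ / (2 * B) with hc0
  have hc0p : 0 < c0 := by positivity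
  have hC00 : 0 ≤ C0 := by
    obtain ⟨a, b, -, -, -, -, -, -, h⟩ := hC0 1 one_pos
    exact (integral_nonneg fun _ => abs_nonneg _).trans h
  set CG := 1/2 * (M * C0) + C0 * (M * (2 * C0 + 1)) + 1 with hCG
  have hCGp : 0 < CG := by positivity
  set η := δ ^ 2 * c0 ^ 2 / (4 * CG) with hη
  have hηp : 0 < η := by positivity
  have hθint : 0 ≤ ∫ x, θ x := integral_nonneg fun x => (hθr x).1
  have step : ∀ κ : {κ // Cut E R κ}, ∃ κ' : {κ // Cut E R κ}, (∀ x, κ'.1 x ≤ κ.1 x) ∧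
      ∀ᶠ ρ in nhdsWithin (0:ℝ) (Set.Ioi 0), η ≤ ∫ x, (mol φ (env (gk t κ'.1)) ρ x - mol φ (env (gk t κ.1)) ρ x) *
        MA (fun y => om y + mol φ (env (gk t κ.1)) ρ y) x := by
    rintro ⟨κ, hκ⟩
    have hg := hκ.obst ht.le hR
    obtain ⟨L, C, hr⟩ := reg_exists hg.cd hg.cs
    have hCs := Cs_nonneg (N := N) hr.C0
    set ε := min 1 (δ * c0 / 2 / ((∫ x, θ x) + Cs N C + 1)) with hε
    have hεp : 0 < ε := lt_min one_pos (by positivity)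
    obtain ⟨a, b, ha, hb, h1, h2, h3, h4, h5⟩ := hC0 ε hεp
    have hfc : Continuous fun x => a x - b x := ha.1.continuous.sub hb.1.continuous
    obtain ⟨κ', k1, k2, k3, k4, k5⟩ := cutoff_exists hE
      (O := ({x | δ < a x - b x} ∩ interior {x | κ x = 1}) ∩ {x | om x < R})
      (((isOpen_lt continuous_const hfc).inter isOpen_interior).inter
        (isOpen_lt om_cd.continuous continuous_const)) (fun x hx => ⟨⟨h2 x hx, by
          rw [mem_interior_iff_mem_nhds]
          exact hκ.one.filter_mono (nhds_le_nhdsSet hx)⟩, hER x hx⟩)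
    have hκ' : Cut E R κ' := ⟨k1, k2, k3, fun x hx => k4 x fun h => absurd h.2 (not_lt.2 hx), k5⟩
    have hle : ∀ x, κ' x ≤ κ x := fun x => by
      by_cases h : κ' x = 0
      · rw [h]; exact (hκ.r x).1
      · have : x ∈ interior {x | κ x = 1} := by
          by_contra h'; exact h (k4 x fun hh => h' hh.1.2)
        have : x ∈ {x | κ x = 1} := interior_subset this
        have : κ x = 1 := this
        rw [this]; exact (k5 x).2
    have hg' := hκ'.obst ht.le hR
    obtain ⟨L', C', hr'⟩ := reg_exists hg'.cd hg'.cs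
    refine ⟨⟨κ', hκ'⟩, hle, ?_⟩
    filter_upwards [ev01, mass_low hφ hg' hr' hτ (hcon κ' hκ')] with ρ hρ hm
    refine gap (R := R) (t := t) (ε := ε) (Rad := Rad) hφ hg hr hg' hr' (fun x => ?_) hρ.1 hρ.2 hθ hRad (fun x => (hθr x).1)
      (fun x => (hθr x).2) hθ1' ha hb hδ (fun x hx => ?_) hεp h3 h4 ?_ hc0p ?_ hCGp ?_
    · have := mul_le_mul_of_nonneg_right (hle x) (add_nonneg (om_nonneg x) ht.le)
      simp only [gk]; linarith
    · by_contra h'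
      have : κ' x = 0 := k4 x fun hh => h' hh.1.1
      exact hx (by simp [gk, this])
    · rw [hc0, div_le_iff₀ (by positivity)]
      rw [← hB] at hm; linarith
    · calc ε * ((∫ x, θ x) + Cs N C) ≤ (δ * c0 / 2 / ((∫ x, θ x) + Cs N C + 1)) * ((∫ x, θ x) + Cs N C + 1) := by
            refine mul_le_mul (min_le_right _ _) (by linarith) (by positivity) (by positivity)
        _ = δ * c0 / 2 := by field_simp
    · intro v hv hL
      have := Gam_const hv ha hb hθ hRad (fun x => (hθr x).1) hL hM h1 hC00 (h4.trans (min_le_left _ _)) h5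
      linarith
  choose nxt hn1 hn2 using step
  obtain ⟨κ0, q1, q2, q3, q4, q5⟩ := cutoff_exists hE (O := {x | om x < R})
    (isOpen_lt om_cd.continuous continuous_const) hER
  have hκ0 : Cut E R κ0 := ⟨q1, q2, q3, fun x hx => q4 x (not_lt.2 hx), q5⟩
  set sq : ℕ → {κ // Cut E R κ} := fun s => Nat.rec ⟨κ0, hκ0⟩ (fun _ k => nxt k) s with hsq
  have hs : ∀ s, sq (s+1) = nxt (sq s) := fun s => rfl
  obtain ⟨m, hm⟩ := exists_nat_gt ((N + 1) * (B * ∫ x, θ x) / η)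
  rw [div_lt_iff₀ hηp] at hm
  have hev : ∀ᶠ ρ in nhdsWithin (0:ℝ) (Set.Ioi 0), ∀ s ∈ Finset.range m, η ≤
      ∫ x, (mol φ (env (gk t (sq (s+1)).1)) ρ x - mol φ (env (gk t (sq s).1)) ρ x) *
        MA (fun y => om y + mol φ (env (gk t (sq s).1)) ρ y) x :=
    (Finset.eventually_all _).2 fun s _ => by rw [hs]; exact hn2 (sq s)
  obtain ⟨ρ, hρ, hall⟩ := (ev01.and hev).exists
  set F : ℕ → (Fin N → ℂ) → ℝ := fun s => mol φ (env (gk t (sq s).1)) ρ with hF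
  have hob : ∀ s, Obst (gk t (sq s).1) R t := fun s => (sq s).2.obst ht.le hR
  have hre : ∀ s, ∃ L C, Reg (gk t (sq s).1) L C := fun s => reg_exists (hob s).cd (hob s).cs
  choose L C hr using hre
  have hO : ∀ s, Osp (F s) := fun s => me_osp hφ (hob s) (hr s) hρ.1
  have hcs : ∀ s, HasCompactSupport (F s) := fun s => me_cs hφ (hob s) (hr s) hρ.1 hρ.2
  have hinc : ∀ s ∈ Finset.range m, η ≤ (N + 1) * (Jen om (F (s+1)) - Jen om (F s)) := by
    intro s hsm
    refine (hall s hsm).trans ?_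
    have e : (fun y => F s y + (F (s+1) y - F s y)) = F (s+1) := by ext y; ring
    have := Jen_incr (w := om) (g := F s) (d := fun y => F (s+1) y - F s y) om_cd (hO s).1 ((hO (s+1)).1.sub (hO s).1)
      (hcs s) ((hcs (s+1)).sub (hcs s)) (fun x => sub_nonneg.2 (mol_mono hφ (env_cont (hob s) (hr s))
        (env_cont (hob (s+1)) (hr (s+1))) ρ x fun y _ => env_mono (hob s) (fun z => by
          have := mul_le_mul_of_nonneg_right (hn1 (sq s) z) (add_nonneg (om_nonneg z) ht.le)
          rw [hs]; simp only [gk]; linarith) _)) (hO s).sp (by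
        have : (fun x => om x + (F s x + (F (s+1) x - F s x))) = fun x => om x + F (s+1) x := by ext x; ring
        rw [this]; exact (hO (s+1)).sp)
    rw [e] at this
    exact this
  have hsum := Finset.sum_le_sum hinc
  rw [← Finset.mul_sum, Finset.sum_range_sub (fun s => Jen om (F s))] at hsum
  simp only [Finset.sum_const, Finset.card_range, nsmul_eq_mul] at hsum
  have hj1 := Jen_nonpos om_sp (hO m).1 (fun x => me_np hφ (hob m) (hr m) x) (hO m).sp
  have hj2 := Jen_bound om_sp (hO 0).1 (hcs 0) B (fun x => me_ge hφ (hob 0) (hr 0) x) (hO 0).sp hθ hθc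
    (fun x => (hθr x).1) (fun x hx => hθ1' x (mem_closedBall_zero_iff.1 (me_supp hφ (hob 0) (hr 0) hρ.1 hρ.2 hx)))
  simp only [MA_om, mul_one] at hj2
  have : ((N:ℝ) + 1) * (Jen om (F m) - Jen om (F 0)) ≤ (N + 1) * (B * ∫ x, θ x) :=
    mul_le_mul_of_nonneg_left (by linarith) (by positivity)
  linarith

/-- deep psh functions close to `om` -/
theorem deep {E : Set (Fin N → ℂ)} (hE : IsCompact E) {δ : ℝ} (hδ : 0 < δ) (hW : Wit E δ) {t τ : ℝ}
    (ht : 0 ≤ t) (hτ : 0 < τ) :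
    ∃ w : (Fin N → ℂ) → ℝ, Sp w ∧ (∀ x, w x ≤ om x) ∧ (∀ x ∈ E, w x ≤ -t) ∧
      Integrable (fun x => om x - w x) ∧ ∫ x, (om x - w x) < τ := by
  obtain ⟨R, hR⟩ := (hE.image om_cd.continuous).bddAbove
  have hER : ∀ x ∈ E, om x < max R 0 + 1 := fun x hx => by
    have := hR (Set.mem_image_of_mem om hx)
    have := le_max_left R 0
    linarith
  obtain ⟨κ, hκ, hlt⟩ := thinning hE hδ hW (R := max R 0 + 1) (by positivity) hER (show 0 < t + 1 by linarith) hτ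
  obtain ⟨φ, hφ⟩ := mlf_exists (N := N)
  have hg := hκ.obst (show 0 ≤ t + 1 by linarith) (show 0 ≤ max R 0 + 1 by positivity)
  obtain ⟨L, C, hr⟩ := reg_exists hg.cd hg.cs
  have hL := hr.L0
  set g := gk (t+1) κ with hgd
  set B := (t+1) + N * A0 (max R 0 + 1) (t+1) ^ 2 with hB
  set K := Metric.closedBall (0 : Fin N → ℂ) (A0 (max R 0 + 1) (t+1) + 1) with hK
  have hKf : volume K ≠ ⊤ := (isCompact_closedBall _ _).measure_lt_top.ne
  have t1 : Tendsto (fun ρ => ∫ x, -mol φ (env g) ρ x) (nhdsWithin 0 (Set.Ioi 0)) (nhds (∫ x, -env g x)) := by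
    refine tendsto_integral_filter_of_dominated_convergence (K.indicator fun _ => B) ?_ ?_ ?_ ?_
    · filter_upwards [ev01] with ρ h
      exact (me_osp hφ hg hr h.1).1.continuous.neg.aestronglyMeasurable
    · filter_upwards [ev01] with ρ h
      refine Eventually.of_forall fun x => ?_
      by_cases hx : x ∈ K
      · rw [Set.indicator_of_mem hx, norm_neg, Real.norm_eq_abs, abs_le]
        exact ⟨me_ge hφ hg hr x, (me_np hφ hg hr x).trans (Bpos hg)⟩
      · rw [Set.indicator_of_notMem hx, me_zero hφ hg hr h.1 h.2 x (by
          rw [hK, mem_closedBall_zero_iff] at hx; linarith)]; simp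
    · exact (integrable_indicator_iff measurableSet_closedBall).2 (integrableOn_const hKf)
    · exact Eventually.of_forall fun x => (me_tendsto hφ hg hr x).neg
  have h2 : ∀ᶠ ρ : ℝ in nhdsWithin 0 (Set.Ioi 0), ρ ≤ 1 / (L + 1) := by
    filter_upwards [Ioc_mem_nhdsGT (show (0:ℝ) < 1 / (L + 1) by positivity)] with ρ h
    exact h.2
  obtain ⟨ρ, hρ, hi, hl⟩ := (ev01.and (((tendsto_order.1 t1).2 τ hlt).and h2)).exists
  have ho := me_osp hφ hg hr hρ.1
  have e : (fun x => om x - (om x + mol φ (env g) ρ x)) = fun x => -mol φ (env g) ρ x := by ext x; ring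
  refine ⟨fun x => om x + mol φ (env g) ρ x, ho.sp, fun x => ?_, fun x hx => ?_, ?_, ?_⟩
  · linarith [me_np (ρ := ρ) hφ hg hr x]
  · have h3 := (abs_le.1 (me_close hφ hg hr hρ.1 x)).2
    have h4 := env_le hg x
    have h5 : g x = -(om x + (t + 1)) := by
      have := (hκ.one.filter_mono (nhds_le_nhdsSet hx)).self_of_nhds
      simp [hgd, gk, this]
    have h6 : L * ρ ≤ 1 := by
      calc L * ρ ≤ (L + 1) * (1 / (L+1)) := mul_le_mul (by linarith) hl hρ.1.le (by linarith)
        _ = 1 := by field_simp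
    linarith
  · rw [e]
    exact ho.1.continuous.neg.integrable_of_hasCompactSupport (me_cs hφ hg hr hρ.1 hρ.2).neg
  · rw [e]; exact hi

end Thin

section PshSec
set_option linter.unusedSimpArgs false
set_option linter.unusedVariables false
open Matrix MeasureTheory
open scoped ContDiff ComplexOrder
variable {N : ℕ}

theorem locsec {h h' : ℝ → ℝ} {c : ℝ} (h1 : ∀ᶠ r in nhds 0, HasDerivAt h (h' r) r) (h2 : HasDerivAt h' c 0)
    (hm : IsLocalMax h 0) : c ≤ 0 := by
  by_contra hc
  push Not at hc
  have e : deriv h =ᶠ[nhds 0] h' := h1.mono fun r hr => hr.deriv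
  have d2 : deriv (deriv h) 0 = c := by rw [e.deriv_eq]; exact h2.deriv
  have hmin : IsLocalMin h 0 := isLocalMin_of_deriv_deriv_pos (by rw [d2]; exact hc) hm.deriv_eq_zero
    h1.self_of_nhds.continuousAt
  have hconst : h =ᶠ[nhds 0] fun _ => h 0 := by
    filter_upwards [hm, hmin] with x a b
    exact le_antisymm a b
  have e1 : deriv h =ᶠ[nhds 0] fun _ => 0 := by
    filter_upwards [hconst.eventuallyEq_nhds] with x hx
    rw [hx.deriv_eq]; simp
  have : deriv (deriv h) 0 = 0 := by rw [e1.deriv_eq]; simp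
  linarith

theorem line_test {S : (Fin N → ℂ) → ℝ} (hS : ContDiff ℝ ∞ S) (a v : Fin N → ℂ) {c z : ℂ} {r ε : ℝ} {h : ℂ → ℝ}
    {F : ℂ → ℂ} (hF : DifferentiableOn ℂ F (ball c r)) (hFh : ∀ z ∈ ball c r, h z = (F z).re) (hz : z ∈ ball c r)
    (hmax : ∀ y ∈ ball c r, S (a + y • v) - h y + ε * ‖y - c‖ ^ 2 ≤ S (a + z • v) - h z + ε * ‖z - c‖ ^ 2)
    (ξ : ℂ) (hξ : ‖ξ‖ = 1) :
    D2 S (a + z • v) (ξ • v) (ξ • v) - (deriv (deriv F) z * ξ ^ 2).re + 2 * ε ≤ 0 := by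
  have hcont : Continuous fun t : ℝ => z + t * ξ := by fun_prop
  have hmem : ∀ᶠ t : ℝ in nhds 0, z + t * ξ ∈ ball c r :=
    hcont.continuousAt.eventually (isOpen_ball.mem_nhds (by simpa using hz))
  have hl : ∀ t : ℝ, HasDerivAt (fun t : ℝ => z + t * ξ) ξ t := fun t => by
    simpa using ((Complex.ofRealCLM.hasDerivAt (x := t)).mul_const ξ).const_add z
  have hF2 := hF.deriv isOpen_ball
  set β : ℝ := ((z - c) * (starRingEnd ℂ) ξ).re with hβ
  have hq : ∀ t : ℝ, ‖z + t * ξ - c‖ ^ 2 = ‖z - c‖ ^ 2 + 2 * β * t + t ^ 2 := fun t => by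
    have h1 : ξ.re ^ 2 + ξ.im ^ 2 = 1 := by
      have := Complex.sq_norm ξ; rw [hξ, Complex.normSq_apply] at this; nlinarith
    rw [Complex.sq_norm, Complex.sq_norm, Complex.normSq_apply, Complex.normSq_apply, hβ]
    simp
    linear_combination t ^ 2 * h1
  have hline : ∀ t : ℝ, a + (z + t * ξ) • v = (a + z • v) + t • (ξ • v) := fun t => by
    rw [add_smul, ← add_assoc, mul_smul]; rfl
  refine locsec (h := fun t : ℝ => S ((a + z • v) + t • (ξ • v)) - (F (z + t * ξ)).re +
      ε * (‖z - c‖ ^ 2 + 2 * β * t + t ^ 2))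
    (h' := fun t => fderiv ℝ S ((a + z • v) + t • (ξ • v)) (ξ • v) - (deriv F (z + t * ξ) * ξ).re +
      ε * (2 * β + 2 * t)) ?_ ?_ ?_
  · filter_upwards [hmem] with t ht
    have d1 := line_d1 (cd_diff hS) (a + z • v) (ξ • v) t
    have d2 : HasDerivAt (fun t : ℝ => F (z + t * ξ)) (deriv F (z + t * ξ) * ξ) t :=
      ((hF.differentiableAt (isOpen_ball.mem_nhds ht)).hasDerivAt).comp t (hl t)
    have d3 : HasDerivAt (fun t : ℝ => (F (z + t * ξ)).re) (deriv F (z + t * ξ) * ξ).re t :=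
      Complex.reCLM.hasFDerivAt.comp_hasDerivAt t d2
    have d4 : HasDerivAt (fun t : ℝ => ε * (‖z - c‖ ^ 2 + 2 * β * t + t ^ 2)) (ε * (2 * β + 2 * t)) t := by
      refine ((((hasDerivAt_id t).const_mul (2 * β)).const_add _).add (hasDerivAt_pow 2 t)).const_mul ε
        |>.congr_deriv ?_
      simp
    exact (d1.sub d3).add d4
  · have d1 := line_d2 hS (a + z • v) (ξ • v) (ξ • v) 0
    have d2 : HasDerivAt (fun t : ℝ => deriv F (z + t * ξ)) (deriv (deriv F) (z + (0:ℝ) * ξ) * ξ) 0 :=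
      ((hF2.differentiableAt (isOpen_ball.mem_nhds (by simpa using hz))).hasDerivAt).comp (0:ℝ) (hl 0)
    have d3 : HasDerivAt (fun t : ℝ => (deriv F (z + t * ξ) * ξ).re) ((deriv (deriv F) (z + (0:ℝ) * ξ) * ξ) * ξ).re 0 :=
      Complex.reCLM.hasFDerivAt.comp_hasDerivAt (0:ℝ) (d2.mul_const ξ)
    have d4 : HasDerivAt (fun t : ℝ => ε * (2 * β + 2 * t)) (2 * ε) 0 := by
      refine ((((hasDerivAt_id (0:ℝ)).const_mul 2).const_add (2 * β)).const_mul ε).congr_deriv ?_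
      ring
    refine ((d1.sub d3).add d4).congr_deriv ?_
    simp [pow_two, mul_assoc]
  · have : ∀ᶠ t : ℝ in nhds 0, S ((a + z • v) + t • (ξ • v)) - (F (z + t * ξ)).re +
      ε * (‖z - c‖ ^ 2 + 2 * β * t + t ^ 2) ≤ S ((a + z • v) + (0:ℝ) • (ξ • v)) - (F (z + (0:ℝ) * ξ)).re +
      ε * (‖z - c‖ ^ 2 + 2 * β * (0:ℝ) + (0:ℝ) ^ 2) := by
      filter_upwards [hmem] with t ht
      have := hmax _ ht
      rw [hFh _ ht, hFh z hz, hq, hline] at this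
      simpa using this
    exact this

theorem maxp {S : (Fin N → ℂ) → ℝ} (hS : Sp S) (a v : Fin N → ℂ) {c : ℂ} {r : ℝ} (hr : 0 < r) {h : ℂ → ℝ}
    (hh : ContinuousOn h (closedBall c r))
    {F : ℂ → ℂ} (hF : DifferentiableOn ℂ F (ball c r)) (hFh : ∀ z ∈ ball c r, h z = (F z).re)
    (hs : ∀ z ∈ sphere c r, S (a + z • v) ≤ h z) : ∀ z ∈ closedBall c r, S (a + z • v) ≤ h z := by
  by_contra hcon
  push Not at hcon
  obtain ⟨z0, hz0, hlt⟩ := hcon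
  set γ := S (a + z0 • v) - h z0 with hγ
  have hγ0 : 0 < γ := by linarith
  set ε := γ / (2 * r ^ 2) with hε
  have hε0 : 0 < ε := by positivity
  have hSc := hS.1.continuous
  obtain ⟨z, hz, hzm⟩ := (isCompact_closedBall c r).exists_isMaxOn ⟨z0, hz0⟩
    (f := fun y => S (a + y • v) - h y + ε * ‖y - c‖ ^ 2)
    (((hSc.comp (by fun_prop : Continuous fun y : ℂ => a + y • v)).continuousOn.sub hh).add
      (by fun_prop))
  have h1 : γ ≤ S (a + z • v) - h z + ε * ‖z - c‖ ^ 2 := by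
    have := hzm hz0
    simp only [Set.mem_ofPred_eq] at this
    have : 0 ≤ ε * ‖z0 - c‖ ^ 2 := by positivity
    linarith
  have hzb : z ∈ ball c r := by
    by_contra hb
    have hsp : z ∈ sphere c r := by
      rw [mem_sphere]; rw [mem_closedBall] at hz; rw [mem_ball] at hb; linarith
    have h2 := hs z hsp
    rw [mem_sphere_iff_norm] at hsp
    rw [hsp] at h1
    have : ε * r ^ 2 = γ / 2 := by rw [hε]; field_simp
    linarith
  have hmax : ∀ y ∈ ball c r, S (a + y • v) - h y + ε * ‖y - c‖ ^ 2 ≤ S (a + z • v) - h z + ε * ‖z - c‖ ^ 2 :=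
    fun y hy => hzm (ball_subset_closedBall hy)
  have l1 := line_test hS.1 a v hF hFh hzb hmax 1 (by simp)
  have l2 := line_test hS.1 a v hF hFh hzb hmax Complex.I (by simp)
  have := hS.2 (a + z • v) v
  simp at l1 l2
  linarith

/-- decreasing limits of smooth psh functions are psh -/
theorem psh_iInf {S : ℕ → (Fin N → ℂ) → ℝ} (hS : ∀ m, Sp (S m)) (hd : ∀ m x, S (m+1) x ≤ S m x)
    (u : (Fin N → ℂ) → EReal) (hu : u = fun x => ⨅ m, (S m x : EReal)) :
    UpperSemicontinuous u ∧ (∀ x, u x ≠ ⊤) ∧ ∀ a v, SubharmonicFn fun w : ℂ => u (a + w • v) := by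
  have husc : UpperSemicontinuous u := by
    rw [hu]
    exact upperSemicontinuous_iInf fun m =>
      (continuous_coe_real_ereal.comp (hS m).1.continuous).upperSemicontinuous
  have hle : ∀ m x, u x ≤ (S m x : EReal) := fun m x => by rw [hu]; exact iInf_le _ m
  have htop : ∀ x, u x ≠ ⊤ := fun x => ((hle 0 x).trans_lt (EReal.coe_lt_top _)).ne
  refine ⟨husc, htop, fun a v => ⟨?_, fun z => htop _, ?_⟩⟩
  · exact husc.comp (by fun_prop : Continuous fun w : ℂ => a + w • v)
  intro c r hr h hh hF hs z hz
  obtain ⟨F, hF, hFh⟩ := hF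
  have hanti : ∀ x, Antitone fun m => S m x := fun x => antitone_nat_of_succ_le fun m => hd m x
  refine EReal.le_of_forall_lt_iff_le.1 fun y hy => ?_
  have hy' : h z < y := by exact_mod_cast hy
  set ε := y - h z with hε
  have hε0 : 0 < ε := by linarith
  have hkey : ∃ m, ∀ w ∈ sphere c r, S m (a + w • v) ≤ h w + ε := by
    have hloc : ∀ w ∈ sphere c r, ∃ m, S m (a + w • v) < h w + ε := fun w hw => by
      have h1 : u (a + w • v) < ((h w + ε : ℝ) : EReal) := (hs w hw).trans_lt (by exact_mod_cast (by linarith))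
      rw [hu] at h1
      obtain ⟨m, hm⟩ := iInf_lt_iff.1 h1
      exact ⟨m, by exact_mod_cast hm⟩
    have hnb : ∀ w ∈ sphere c r, ∃ m, ∀ᶠ w' in nhdsWithin w (sphere c r), S m (a + w' • v) < h w' + ε := by
      intro w hw
      obtain ⟨m, hm⟩ := hloc w hw
      refine ⟨m, ?_⟩
      have c1 : ContinuousWithinAt (fun w => S m (a + w • v)) (sphere c r) w :=
        ((hS m).1.continuous.comp (by fun_prop : Continuous fun w : ℂ => a + w • v)).continuousWithinAt
      have c2 : ContinuousWithinAt (fun w => h w + ε) (sphere c r) w :=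
        ((hh w (sphere_subset_closedBall hw)).mono sphere_subset_closedBall).add continuousWithinAt_const
      exact c1.eventually_lt c2 hm
    choose! m hm using hnb
    obtain ⟨t, hts, hcov⟩ := (isCompact_sphere c r).elim_nhdsWithin_subcover
      (fun w => {w' | S (m w) (a + w' • v) < h w' + ε}) (fun w hw => hm w hw)
    refine ⟨t.sup m, fun w hw => ?_⟩
    obtain ⟨w0, hw0, hw1⟩ := Set.mem_iUnion₂.1 (hcov hw)
    exact (hanti _ (Finset.le_sup hw0)).trans (le_of_lt hw1)
  obtain ⟨m, hm⟩ := hkey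
  have := maxp (hS m) a v hr (h := fun w => h w + ε) (hh.add continuousOn_const) (F := fun w => F w + ε)
    (hF.add_const _) (fun w hw => by simp [hFh w hw]) hm z hz
  refine (hle m _).trans ?_
  have h3 : S m (a + z • v) ≤ y := by simp only [hε] at this; linarith
  exact_mod_cast h3

end PshSec

section Polar
set_option linter.unusedSimpArgs false
set_option linter.unusedVariables false
open Matrix MeasureTheory
open scoped ContDiff ComplexOrder
variable {N : ℕ}

theorem wsum (m : ℕ) : ∑ j ∈ Finset.range m, (1/2:ℝ) ^ (j+1) = 1 - (1/2) ^ m := by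
  induction m with
  | zero => simp
  | succ k ih => rw [Finset.sum_range_succ, ih]; ring

theorem Sp.sum {ι : Type*} (s : Finset ι) {u : ι → (Fin N → ℂ) → ℝ} (h : ∀ i, Sp (u i)) :
    Sp fun x => ∑ i ∈ s, u i x := by
  classical
  induction s using Finset.induction_on with
  | empty => simpa using Sp.const 0
  | insert i s hi ih =>
    simp only [Finset.sum_insert hi]
    exact (h i).add ih

theorem polar_of_wit {E : Set (Fin N → ℂ)} (hE : IsCompact E) {δ : ℝ} (hδ : 0 < δ) (hW : Wit E δ) :
    ∃ u : (Fin N → ℂ) → EReal, (UpperSemicontinuous u ∧ (∀ x, u x ≠ ⊤) ∧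
      ∀ a v, SubharmonicFn fun w : ℂ => u (a + w • v)) ∧ (∃ x, u x ≠ ⊥) ∧ ∀ x ∈ E, u x = ⊥ := by
  have hex : ∀ j : ℕ, _ := fun j => deep hE hδ hW (t := 2 ^ (j+1)) (τ := 1) (by positivity) one_pos
  choose w w1 w2 w3 w4 w5 using hex
  set S : ℕ → (Fin N → ℂ) → ℝ := fun m x => om x - ∑ j ∈ Finset.range m, (1/2:ℝ) ^ (j+1) * (om x - w j x) with hS
  have hSp : ∀ m, Sp (S m) := fun m => by
    have e : S m = fun x => (1/2:ℝ) ^ m * om x + ∑ j ∈ Finset.range m, (1/2:ℝ) ^ (j+1) * w j x := by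
      ext x
      simp only [hS, mul_sub, Finset.sum_sub_distrib, ← Finset.sum_mul, wsum]
      ring
    rw [e]
    exact (om_sp.smul (by positivity)).add (Sp.sum _ fun j => (w1 j).smul (by positivity))
  have hd : ∀ m x, S (m+1) x ≤ S m x := fun m x => by
    simp only [hS, Finset.sum_range_succ]
    have : 0 ≤ (1/2:ℝ) ^ (m+1) * (om x - w m x) := mul_nonneg (by positivity) (sub_nonneg.2 (w2 m x))
    linarith
  refine ⟨fun x => ⨅ m, (S m x : EReal), psh_iInf hSp hd _ rfl, ?_, fun x hx => ?_⟩
  · -- finiteness somewhere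
    set G : ℕ → (Fin N → ℂ) → ENNReal := fun j x => ENNReal.ofReal ((1/2:ℝ) ^ (j+1) * (om x - w j x)) with hG
    have hGm : ∀ j, Measurable (G j) := fun j =>
      (continuous_const.mul (om_cd.continuous.sub (w1 j).1.continuous)).measurable.ennreal_ofReal
    have hInt : ∫⁻ x, ∑' j, G j x ≠ ⊤ := by
      rw [lintegral_tsum fun j => (hGm j).aemeasurable]
      have hj : ∀ j, ∫⁻ x, G j x ≤ ENNReal.ofReal ((1/2:ℝ) ^ j * (1/2)) := fun j => by
        rw [hG, ← ofReal_integral_eq_lintegral_ofReal ((w4 j).const_mul _) (Eventually.of_forall fun x =>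
          mul_nonneg (by positivity) (sub_nonneg.2 (w2 j x))), integral_const_mul]
        refine ENNReal.ofReal_le_ofReal ?_
        rw [pow_succ]
        have := mul_le_mul_of_nonneg_left (w5 j).le (show (0:ℝ) ≤ (1/2) ^ j * (1/2) by positivity)
        linarith
      refine ((ENNReal.tsum_le_tsum hj).trans_lt ?_).ne
      have hsum : Summable fun j : ℕ => (1/2:ℝ) ^ j * (1/2) :=
        (summable_geometric_of_lt_one (by norm_num) (by norm_num)).mul_right _
      rw [← ENNReal.ofReal_tsum_of_nonneg (fun j => by positivity) hsum]
      exact ENNReal.ofReal_lt_top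
    obtain ⟨x0, hx0⟩ := (ae_lt_top (Measurable.tsum hGm) hInt).exists
    refine ⟨x0, ?_⟩
    set T := (∑' j, G j x0).toReal with hT
    have hb : ∀ m, om x0 - T ≤ S m x0 := fun m => by
      have h1 : ∑ j ∈ Finset.range m, G j x0 ≤ ∑' j, G j x0 := ENNReal.sum_le_tsum _
      rw [hG] at h1
      rw [← ENNReal.ofReal_sum_of_nonneg fun j _ => mul_nonneg (by positivity) (sub_nonneg.2 (w2 j x0))] at h1
      have h2 := (ENNReal.ofReal_le_iff_le_toReal hx0.ne).1 h1
      simp only [hS]; linarith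
    have : ((om x0 - T : ℝ) : EReal) ≤ ⨅ m, (S m x0 : EReal) := le_iInf fun m => by exact_mod_cast hb m
    exact ((EReal.bot_lt_coe _).trans_le this).ne'
  · have hb : ∀ m, S m x ≤ om x - m := fun m => by
      have : (m:ℝ) ≤ ∑ j ∈ Finset.range m, (1/2:ℝ) ^ (j+1) * (om x - w j x) := by
        have h1 : ∑ j ∈ Finset.range m, (1:ℝ) ≤ ∑ j ∈ Finset.range m, (1/2:ℝ) ^ (j+1) * (om x - w j x) := by
          refine Finset.sum_le_sum fun j _ => ?_
          have h2 := w3 j x hx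
          have h3 := om_nonneg x
          calc (1:ℝ) = (1/2) ^ (j+1) * 2 ^ (j+1) := by rw [← mul_pow]; norm_num
            _ ≤ _ := mul_le_mul_of_nonneg_left (by linarith) (by positivity)
        simpa using h1
      simp only [hS]; linarith
    rw [EReal.eq_bot_iff_forall_lt]
    intro y
    obtain ⟨m, hm⟩ := exists_nat_gt (om x - y)
    refine (iInf_le _ m).trans_lt ?_
    have := hb m
    exact_mod_cast (by linarith : S m x < y)

/-- coordinates on `ℂⁿ × ℂ` -/
def coordE (n : ℕ) : (Fin n → ℂ) × ℂ →L[ℂ] (Fin (n+1) → ℂ) :=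
  ContinuousLinearMap.pi (Fin.cons (ContinuousLinearMap.snd ℂ (Fin n → ℂ) ℂ)
    (fun i => (ContinuousLinearMap.proj i).comp (ContinuousLinearMap.fst ℂ (Fin n → ℂ) ℂ)))

theorem coordE_zero {n : ℕ} (p : (Fin n → ℂ) × ℂ) : coordE n p 0 = p.2 := by simp [coordE]
theorem coordE_succ {n : ℕ} (p : (Fin n → ℂ) × ℂ) (i : Fin n) : coordE n p i.succ = p.1 i := by simp [coordE]

theorem coordE_surj {n : ℕ} (x : Fin (n+1) → ℂ) : ∃ p, coordE n p = x := by
  refine ⟨(fun i => x i.succ, x 0), funext fun i => ?_⟩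
  refine Fin.cases ?_ (fun i => ?_) i
  · rw [coordE_zero]
  · rw [coordE_succ]

theorem pluripolar_of_wit {n : ℕ} {G : Set ((Fin n → ℂ) × ℂ)} (hG : IsCompact G) {δ : ℝ} (hδ : 0 < δ)
    (hW : Wit (coordE n '' G) δ) : Pluripolar G := by
  obtain ⟨u, ⟨h1, h2, h3⟩, ⟨x, hx⟩, h4⟩ := polar_of_wit (hG.image (coordE n).continuous) hδ hW
  refine ⟨fun p => u (coordE n p), ⟨h1.comp (coordE n).continuous, fun z => h2 _, fun a v => ?_⟩, ?_,
    fun p hp => h4 _ ⟨p, hp, rfl⟩⟩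
  · simp only [map_add, map_smul]
    exact h3 _ _
  · obtain ⟨p, rfl⟩ := coordE_surj x
    exact ⟨p, hx⟩

end Polar

section VolSub
set_option linter.unusedSimpArgs false
set_option linter.unusedVariables false
open Matrix MeasureTheory
open scoped ContDiff ComplexOrder
variable {N : ℕ}

theorem Sp.toOsp {u : (Fin N → ℂ) → ℝ} (hu : Sp u) : Osp u :=
  ⟨hu.1, fun x ξ => by linarith [hu.2 x ξ, om_nonneg ξ]⟩

theorem Sp.submean {u : (Fin N → ℂ) → ℝ} (hu : Sp u) (x ξ : Fin N → ℂ) :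
    2 * Real.pi * u x ≤ ∫ θ in (0:ℝ)..(2 * Real.pi), u (cpt x ξ θ) := by
  by_contra h
  push Not at h
  set I := ∫ θ in (0:ℝ)..(2 * Real.pi), u (cpt x ξ θ) with hI
  set d := 2 * Real.pi * u x - I with hd
  have hd0 : 0 < d := by rw [hd]; linarith
  set t : ℝ := (2 * Real.pi * om ξ + 1) / d with ht
  have ht0 : 0 < t := by have := om_nonneg ξ; have := Real.pi_pos; positivity
  have h1 := osp_submean (hu.smul ht0.le).toOsp x ξ
  rw [intervalIntegral.integral_const_mul, ← hI] at h1
  have h2 : t * d = 2 * Real.pi * om ξ + 1 := by rw [ht]; field_simp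
  rw [hd] at h2
  nlinarith

theorem rot_preserving (θ : ℝ) : MeasurePreserving (fun ξ : Fin N → ℂ => Complex.exp (θ * Complex.I) • ξ) := by
  have h : ∀ i : Fin N, MeasurePreserving (fun z : ℂ => Complex.exp (θ * Complex.I) * z) := by
    intro i
    exact (rotation (Circle.exp θ)).measurePreserving
  exact volume_preserving_pi h

theorem rot_integral (θ r : ℝ) {h : (Fin N → ℂ) → ℝ} :
    ∫ ξ in closedBall (0 : Fin N → ℂ) r, h (Complex.exp (θ * Complex.I) • ξ) =
    ∫ ξ in closedBall (0 : Fin N → ℂ) r, h ξ := by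
  have hc : Complex.exp (θ * Complex.I) ≠ 0 := Complex.exp_ne_zero _
  have hme : MeasurableEmbedding (fun ξ : Fin N → ℂ => Complex.exp (θ * Complex.I) • ξ) :=
    (Homeomorph.smulOfNeZero _ hc).measurableEmbedding
  have := (rot_preserving (N := N) θ).setIntegral_preimage_emb hme h (closedBall 0 r)
  rw [← this]
  congr 2
  ext ξ
  simp [norm_smul, Complex.norm_exp_ofReal_mul_I]

theorem Sp.volsub {u : (Fin N → ℂ) → ℝ} (hu : Sp u) (x : Fin N → ℂ) (r : ℝ) :
    volume.real (closedBall (0 : Fin N → ℂ) r) * u x ≤ ∫ ξ in closedBall (0 : Fin N → ℂ) r, u (x + ξ) := by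
  have hcu := hu.1.continuous
  have hp := Real.pi_pos
  have hcont : Continuous (Function.uncurry fun (θ : ℝ) (ξ : Fin N → ℂ) => u (cpt x ξ θ)) := by
    simp only [Function.uncurry_def, cpt]; fun_prop
  have sw : (∫ θ in (0:ℝ)..(2 * Real.pi), ∫ ξ in closedBall (0 : Fin N → ℂ) r, u (cpt x ξ θ)) =
      ∫ ξ in closedBall (0 : Fin N → ℂ) r, ∫ θ in (0:ℝ)..(2 * Real.pi), u (cpt x ξ θ) := by
    rw [intervalIntegral_integral_swap]
    rw [Set.uIoc_of_le (by positivity)]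
    have : IntegrableOn (Function.uncurry fun (θ : ℝ) (ξ : Fin N → ℂ) => u (cpt x ξ θ))
        (Set.Icc 0 (2 * Real.pi) ×ˢ closedBall (0 : Fin N → ℂ) r) (volume.prod volume) :=
      hcont.continuousOn.integrableOn_compact (isCompact_Icc.prod (isCompact_closedBall _ _))
    replace this := this.mono_set (Set.prod_mono (Set.Ioc_subset_Icc_self (a := (0:ℝ))) subset_rfl)
    rw [IntegrableOn, ← Measure.prod_restrict] at this
    exact this
  have e1 : ∀ θ : ℝ, ∫ ξ in closedBall (0 : Fin N → ℂ) r, u (cpt x ξ θ) =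
      ∫ ξ in closedBall (0 : Fin N → ℂ) r, u (x + ξ) := fun θ =>
    rot_integral θ r (h := fun ξ => u (x + ξ))
  simp only [e1] at sw
  rw [intervalIntegral.integral_const] at sw
  have hI : Continuous fun ξ : Fin N → ℂ => ∫ θ in (0:ℝ)..(2 * Real.pi), u (cpt x ξ θ) := by
    refine intervalIntegral.continuous_parametric_intervalIntegral_of_continuous' ?_ _ _
    simp only [Function.uncurry_def, cpt]; fun_prop
  have h3 : ∫ ξ in closedBall (0 : Fin N → ℂ) r, 2 * Real.pi * u x ≤
      ∫ ξ in closedBall (0 : Fin N → ℂ) r, ∫ θ in (0:ℝ)..(2 * Real.pi), u (cpt x ξ θ) := by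
    refine integral_mono (ci continuous_const r) (ci hI r) fun ξ => hu.submean x ξ
  rw [setIntegral_const, ← sw] at h3
  simp only [smul_eq_mul, sub_zero] at h3
  have : 0 < 2 * Real.pi := by positivity
  nlinarith

theorem eval_cd (p : MvPolynomial (Fin N) ℂ) : ContDiff ℂ ∞ fun x : Fin N → ℂ => MvPolynomial.eval x p := by
  induction p using MvPolynomial.induction_on with
  | C a => simpa using contDiff_const
  | add p q hp hq => simpa using hp.add hq
  | mul_X p i hp => simpa using hp.mul (contDiff_apply ℂ ℂ i)

theorem eval_homog {p : MvPolynomial (Fin N) ℂ} {i : ℕ} (hp : p.IsHomogeneous i) (s : ℂ) (x : Fin N → ℂ) :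
    MvPolynomial.eval (s • x) p = s ^ i * MvPolynomial.eval x p := by
  rw [MvPolynomial.eval_eq', MvPolynomial.eval_eq', Finset.mul_sum]
  refine Finset.sum_congr rfl fun d hd => ?_
  have h := hp (MvPolynomial.mem_support_iff.mp hd)
  have h2 : ∑ j, d j = i := by
    rw [← h, Finsupp.weight_apply, Finsupp.sum_fintype] <;> simp
  simp only [Pi.smul_apply, smul_eq_mul, mul_pow, Finset.prod_mul_distrib, Finset.prod_pow_eq_pow_sum, h2]
  ring

theorem growth {p : MvPolynomial (Fin N) ℂ} {k : ℕ} (hk : p.totalDegree ≤ k) {m : ℝ}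
    (hm : ∀ x ∈ closedBall (0 : Fin N → ℂ) 1, ‖MvPolynomial.eval x p‖ ≤ m) {D : ℝ} (hD : 1 ≤ D)
    {x : Fin N → ℂ} (hx : ‖x‖ ≤ D) : ‖MvPolynomial.eval x p‖ ≤ D ^ k * m := by
  have hD0 : 0 < D := by linarith
  set c : ℕ → ℂ := fun i => MvPolynomial.eval x (MvPolynomial.homogeneousComponent i p) with hc
  have hsc : ∀ s : ℂ, MvPolynomial.eval (s • x) p = ∑ i ∈ Finset.range (k+1), s ^ i * c i := by
    intro s
    have hp : p = ∑ i ∈ Finset.range (k+1), MvPolynomial.homogeneousComponent i p := by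
      conv_lhs => rw [← MvPolynomial.sum_homogeneousComponent p]
      refine Finset.sum_subset (Finset.range_mono (by omega)) fun i _ hi => ?_
      exact MvPolynomial.homogeneousComponent_eq_zero _ _ (by simp at hi; omega)
    conv_lhs => rw [hp]
    rw [map_sum]
    exact Finset.sum_congr rfl fun i _ => eval_homog (MvPolynomial.homogeneousComponent_isHomogeneous i p) s x
  set h : ℂ → ℂ := fun s => ∑ i ∈ Finset.range (k+1), s ^ (k - i) * c i with hh
  have hhs : ∀ s : ℂ, s ≠ 0 → h s = s ^ k * MvPolynomial.eval (s⁻¹ • x) p := by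
    intro s hs
    rw [hsc, hh, Finset.mul_sum]
    refine Finset.sum_congr rfl fun i hi => ?_
    have : i ≤ k := by simp at hi; omega
    rw [← mul_assoc, inv_pow, pow_sub₀ _ hs this]
  have hd : Differentiable ℂ h := by rw [hh]; fun_prop
  have key := Complex.norm_le_of_forall_mem_frontier_norm_le (U := ball (0:ℂ) D) isBounded_ball
    (f := h) (C := D ^ k * m) hd.diffContOnCl (by
      intro s hs
      rw [frontier_ball _ hD0.ne'] at hs
      have hsn : ‖s‖ = D := by simpa using hs
      have hs0 : s ≠ 0 := by rw [← norm_pos_iff, hsn]; exact hD0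
      rw [hhs s hs0, norm_mul, norm_pow, hsn]
      gcongr
      apply hm
      rw [mem_closedBall_zero_iff, norm_smul, norm_inv, hsn]
      rw [inv_mul_le_iff₀ hD0]; linarith) (z := 1) (by
      rw [closure_ball _ hD0.ne']; simpa using hD)
  rw [hhs 1 one_ne_zero] at key
  simpa using key
end VolSub

section Norml
set_option linter.unusedSimpArgs false
set_option linter.unusedVariables false
open Matrix MeasureTheory
open scoped ContDiff ComplexOrder
variable {N : ℕ}

def PS (e : ℝ) (p q : MvPolynomial (Fin N) ℂ) (x : Fin N → ℂ) : ℝ :=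
  e + (‖MvPolynomial.eval x p‖ ^ 2 + ‖MvPolynomial.eval x q‖ ^ 2)

theorem PS_pos {e : ℝ} (he : 0 < e) (p q : MvPolynomial (Fin N) ℂ) (x : Fin N → ℂ) : 0 < PS e p q x := by
  unfold PS; positivity

theorem PS_lp {e : ℝ} (he : 0 < e) (p q : MvPolynomial (Fin N) ℂ) : Lp (PS e p q) :=
  (Lp.const he.le).add ((Lp.holo (eval_cd p)).add (Lp.holo (eval_cd q)))

def PA (k : ℕ) (e : ℝ) (p q : MvPolynomial (Fin N) ℂ) (x : Fin N → ℂ) : ℝ :=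
  (1 / (2 * k)) * Real.log (PS e p q x)

theorem PA_sp (k : ℕ) {e : ℝ} (he : 0 < e) (p q : MvPolynomial (Fin N) ℂ) : Sp (PA k e p q) :=
  (Lp.log (PS_lp he p q) (PS_pos he p q)).smul (by positivity)

theorem PA_norm {k : ℕ} (hk : 0 < k) {e : ℝ} (he : 0 < e) {p q : MvPolynomial (Fin N) ℂ}
    (hp : p.totalDegree ≤ k) (hq : q.totalDegree ≤ k) :
    ∃ M : ℝ, (∃ y ∈ closedBall (0 : Fin N → ℂ) 1, PA k e p q y = M) ∧
      ∀ D : ℝ, 1 ≤ D → ∀ x : Fin N → ℂ, ‖x‖ ≤ D → PA k e p q x - M ≤ Real.log D + 1 := by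
  have hcont : Continuous (PS e p q) := (PS_lp he p q).1.continuous
  obtain ⟨y, hy, hmax⟩ := (isCompact_closedBall (0 : Fin N → ℂ) 1).exists_isMaxOn
    ⟨0, by simp⟩ hcont.continuousOn
  have hkr : (0:ℝ) < k := by exact_mod_cast hk
  refine ⟨PA k e p q y, ⟨y, hy, rfl⟩, fun D hD x hx => ?_⟩
  have hSy := PS_pos he p q y
  set m := Real.sqrt (PS e p q y) with hm
  have hm2 : m ^ 2 = PS e p q y := Real.sq_sqrt hSy.le
  have hpm : ∀ x ∈ closedBall (0 : Fin N → ℂ) 1, ‖MvPolynomial.eval x p‖ ≤ m := by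
    intro x hx
    apply Real.le_sqrt_of_sq_le
    refine le_trans ?_ (hmax hx)
    simp only [PS]; nlinarith [sq_nonneg ‖MvPolynomial.eval x q‖]
  have hqm : ∀ x ∈ closedBall (0 : Fin N → ℂ) 1, ‖MvPolynomial.eval x q‖ ≤ m := by
    intro x hx
    apply Real.le_sqrt_of_sq_le
    refine le_trans ?_ (hmax hx)
    simp only [PS]; nlinarith [sq_nonneg ‖MvPolynomial.eval x p‖]
  have g1 := growth hp hpm hD hx
  have g2 := growth hq hqm hD hx
  have g1' := pow_le_pow_left₀ (norm_nonneg _) g1 2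
  have g2' := pow_le_pow_left₀ (norm_nonneg _) g2 2
  have hDk : 1 ≤ D ^ k := one_le_pow₀ hD
  have hey : e ≤ PS e p q y := by unfold PS; nlinarith [sq_nonneg ‖MvPolynomial.eval y p‖, sq_nonneg ‖MvPolynomial.eval y q‖]
  have hS : PS e p q x ≤ 3 * ((D ^ k) ^ 2 * PS e p q y) := by
    rw [mul_pow, hm2] at g1' g2'
    have : PS e p q y ≤ (D ^ k) ^ 2 * PS e p q y := by
      have : 1 ≤ (D^k)^2 := one_le_pow₀ hDk
      nlinarith
    have : PS e p q x = e + (‖MvPolynomial.eval x p‖ ^ 2 + ‖MvPolynomial.eval x q‖ ^ 2) := rfl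
    linarith
  have hlog := Real.log_le_log (PS_pos he p q x) hS
  have hD0 : 0 < D := by linarith
  rw [Real.log_mul (by norm_num) (by positivity), Real.log_mul (by positivity) hSy.ne', Real.log_pow, Real.log_pow] at hlog
  push_cast at hlog
  have h3 : Real.log 3 ≤ 2 := by
    have := Real.log_le_sub_one_of_pos (x := 3) (by norm_num); linarith
  have hk1 : (1:ℝ) ≤ k := by exact_mod_cast hk
  unfold PA
  rw [← mul_sub, one_div, inv_mul_le_iff₀ (by positivity)]
  nlinarith

theorem PA_L1 {u : (Fin N → ℂ) → ℝ} (hu : Sp u) {y : Fin N → ℂ} (hy : y ∈ closedBall (0 : Fin N → ℂ) 1)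
    (h0 : u y = 0) {R C : ℝ} (hC : 0 ≤ C) (hub : ∀ x : Fin N → ℂ, ‖x‖ ≤ R + 2 → u x ≤ C) :
    (∫ x in closedBall (0 : Fin N → ℂ) R, |u x|) ≤ 2 * C * volume.real (closedBall (0 : Fin N → ℂ) (R + 1)) := by
  have hcu := hu.1.continuous
  have h1 := hu.volsub y (R + 1)
  rw [h0, mul_zero] at h1
  have hy1 : ‖y‖ ≤ 1 := by simpa using hy
  have h2 : (∫ x in closedBall (0 : Fin N → ℂ) R, |u x|) ≤ ∫ x in closedBall y (R+1), |u x| := by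
    refine setIntegral_mono_set ?_ (Eventually.of_forall fun x => abs_nonneg _) ?_
    · exact hcu.abs.continuousOn.integrableOn_compact (isCompact_closedBall _ _)
    · refine (closedBall_subset_closedBall' ?_).eventuallyLE
      rw [dist_zero_left]; linarith
  have h3 : ∫ x in closedBall y (R+1), |u x| = ∫ ξ in closedBall (0 : Fin N → ℂ) (R+1), |u (y + ξ)| := by
    have := (measurePreserving_add_left (volume : Measure (Fin N → ℂ)) y).setIntegral_preimage_emb
      (measurableEmbedding_addLeft y) (fun x => |u x|) (closedBall y (R+1))
    rw [← this]
    congr 2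
    ext ξ; simp
  rw [h3] at h2
  refine h2.trans ?_
  have h4 : ∫ ξ in closedBall (0 : Fin N → ℂ) (R+1), |u (y + ξ)| ≤
      ∫ ξ in closedBall (0 : Fin N → ℂ) (R+1), (2 * C - u (y + ξ)) := by
    refine setIntegral_mono_on (ci (by fun_prop) _) (ci (by fun_prop) _) measurableSet_closedBall fun ξ hξ => ?_
    have : u (y + ξ) ≤ C := hub _ (by
      have := norm_add_le y ξ
      have : ‖ξ‖ ≤ R + 1 := by simpa using hξ
      linarith)
    rw [abs_le]; constructor <;> linarith
  rw [integral_sub (ci continuous_const _) (ci (by fun_prop) _), setIntegral_const, smul_eq_mul] at h4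
  linarith
end Norml

section GraphEst
set_option linter.unusedSimpArgs false
set_option linter.unusedVariables false
open Matrix MeasureTheory
open scoped ContDiff ComplexOrder
variable {n : ℕ}

theorem tube_meas {g : (Fin n → ℂ) → ℂ} (hg : Measurable g) (R t : ℝ) :
    volume {x : Fin (n+1) → ℂ | (fun i => x i.succ) ∈ closedBall (0 : Fin n → ℂ) R ∧
      ‖x 0 - g (fun i => x i.succ)‖ < t} ≤
    volume (closedBall (0 : Fin n → ℂ) R) * (ENNReal.ofReal t ^ 2 * NNReal.pi) := by
  set S : Set (ℂ × (Fin n → ℂ)) := {y | y.2 ∈ closedBall (0 : Fin n → ℂ) R ∧ ‖y.1 - g y.2‖ < t} with hS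
  have hSm : MeasurableSet S := by
    refine (measurable_snd measurableSet_closedBall).inter ?_
    exact measurableSet_lt ((measurable_fst.sub (hg.comp measurable_snd)).norm) measurable_const
  have hmp := volume_preserving_piFinSuccAbove (fun _ : Fin (n+1) => ℂ) 0
  have e := hmp.measure_preimage_equiv S
  have e2 : (MeasurableEquiv.piFinSuccAbove (fun _ : Fin (n+1) => ℂ) 0) ⁻¹' S =
      {x : Fin (n+1) → ℂ | (fun i => x i.succ) ∈ closedBall (0 : Fin n → ℂ) R ∧
      ‖x 0 - g (fun i => x i.succ)‖ < t} := by
    ext x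
    rfl
  rw [← e2, e, Measure.volume_eq_prod, Measure.prod_apply_symm hSm]
  calc ∫⁻ z, volume ((fun w => (w, z)) ⁻¹' S)
      ≤ ∫⁻ z, (closedBall (0 : Fin n → ℂ) R).indicator (fun _ => ENNReal.ofReal t ^ 2 * NNReal.pi) z := by
        refine lintegral_mono fun z => ?_
        by_cases hz : z ∈ closedBall (0 : Fin n → ℂ) R
        · rw [Set.indicator_of_mem hz, ← Complex.volume_ball (g z) t]
          refine measure_mono fun w hw => ?_
          rw [mem_ball, dist_eq_norm]; exact hw.2
        · rw [Set.indicator_of_notMem hz]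
          have : ((fun w => (w, z)) ⁻¹' S) = (∅ : Set ℂ) := by
            ext w; simp only [Set.mem_preimage, Set.mem_empty_iff_false, iff_false]
            exact fun h => hz h.1
          rw [this]; simp
    _ = _ := by
        rw [lintegral_indicator measurableSet_closedBall, setLIntegral_const, mul_comm]

variable (P Q w : ℂ)

theorem est_up {e s : ℝ} {k : ℕ} (he : 0 < e) (hs : 0 < s) (hs1 : s < 1) {A B : ℝ} (hA : 0 ≤ A) (hB : 0 ≤ B)
    (hk : 0 < k) : (1 / (2 * k)) * Real.log (e + A) - (1 / (2 * k)) * Real.log (e + (B + s ^ (2 * k) * A))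
      ≤ Real.log (1 / s) := by
  have hkr : (0:ℝ) < k := by exact_mod_cast hk
  have h1 : s ^ (2 * k) * (e + A) ≤ e + (B + s ^ (2 * k) * A) := by
    have : s ^ (2 * k) ≤ 1 := pow_le_one₀ hs.le hs1.le
    nlinarith
  have h2 := Real.log_le_log (by positivity) h1
  rw [Real.log_mul (by positivity) (by positivity), Real.log_pow] at h2
  push_cast at h2
  rw [← mul_sub, one_div, inv_mul_le_iff₀ (by positivity), one_div, Real.log_inv]
  nlinarith

theorem est_low {k : ℕ} (hk : 0 < k) {S T c : ℝ} (hS : 0 < S) (hT : 0 < T) (hc : 0 < c)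
    (h : T ≤ c * S) : -(Real.log c / (2 * k)) ≤ (1 / (2 * k)) * Real.log S - (1 / (2 * k)) * Real.log T := by
  have hkr : (0:ℝ) < k := by exact_mod_cast hk
  have h2 := Real.log_le_log hT h
  rw [Real.log_mul hc.ne' hS.ne'] at h2
  rw [← mul_sub, one_div, div_eq_inv_mul, ← mul_neg]
  gcongr
  linarith

theorem est_T {e s R : ℝ} {k : ℕ} (he : 0 < e) (hs : 0 < s) (hs1 : s < 1) (hw : ‖w‖ ≤ R) :
    e + (‖Q * w - P‖ ^ 2 + s ^ (2 * k) * (‖P‖ ^ 2 + ‖Q‖ ^ 2)) ≤ (2 + R ^ 2) * (e + (‖P‖ ^ 2 + ‖Q‖ ^ 2)) := by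
  have h1 : ‖Q * w - P‖ ≤ ‖Q‖ * R + ‖P‖ := by
    refine (norm_sub_le _ _).trans ?_
    rw [norm_mul]; gcongr
  have h2 : s ^ (2 * k) ≤ 1 := pow_le_one₀ hs.le hs1.le
  have h3 := pow_le_pow_left₀ (norm_nonneg _) h1 2
  have h4 : (‖Q‖ * R + ‖P‖) ^ 2 ≤ (1 + R ^ 2) * (‖P‖ ^ 2 + ‖Q‖ ^ 2) := by nlinarith [sq_nonneg (‖Q‖ - R * ‖P‖)]
  have h5 : s ^ (2 * k) * (‖P‖ ^ 2 + ‖Q‖ ^ 2) ≤ 1 * (‖P‖ ^ 2 + ‖Q‖ ^ 2) := by gcongr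
  nlinarith [mul_nonneg he.le (sq_nonneg R)]

theorem est_G {e s : ℝ} {k : ℕ} (hs : 0 < s) (hQ : Q ≠ 0) (h : ‖w - P / Q‖ ≤ s ^ k)
    (he0 : 0 < e) (he : e ≤ s ^ (2 * k) * ‖Q‖ ^ 2) :
    e + (‖Q * w - P‖ ^ 2 + s ^ (2 * k) * (‖P‖ ^ 2 + ‖Q‖ ^ 2)) ≤ (3 * s ^ (2 * k)) * (e + (‖P‖ ^ 2 + ‖Q‖ ^ 2)) := by
  have h1 : Q * w - P = Q * (w - P / Q) := by field_simp
  have h2 : ‖Q * w - P‖ ^ 2 ≤ s ^ (2 * k) * ‖Q‖ ^ 2 := by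
    rw [h1, norm_mul, mul_pow, mul_comm 2 k, pow_mul, mul_comm]
    gcongr
  have : 0 < s ^ (2 * k) := by positivity
  nlinarith [sq_nonneg ‖P‖, mul_pos this he0, mul_nonneg this.le (sq_nonneg ‖P‖)]

theorem est_tube {e s η R : ℝ} {k : ℕ} (he : 0 < e) (hs : 0 < s) (hk : 0 < k) (hw : ‖w‖ ≤ R)
    (hη : Real.exp (-(k * η)) ≤ 1 / 2)
    (h : η < (1 / (2 * k)) * Real.log (e + (‖P‖ ^ 2 + ‖Q‖ ^ 2)) -
      (1 / (2 * k)) * Real.log (e + (‖Q * w - P‖ ^ 2 + s ^ (2 * k) * (‖P‖ ^ 2 + ‖Q‖ ^ 2)))) :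
    ‖w - P / Q‖ < 2 * (1 + R) * Real.exp (-(k * η)) := by
  have hkr : (0:ℝ) < k := by exact_mod_cast hk
  set l := Real.exp (-(k * η)) with hl
  have hl0 : 0 < l := Real.exp_pos _
  rw [← mul_sub, one_div, lt_inv_mul_iff₀ (by positivity)] at h
  set S := e + (‖P‖ ^ 2 + ‖Q‖ ^ 2) with hS
  set T := e + (‖Q * w - P‖ ^ 2 + s ^ (2 * k) * (‖P‖ ^ 2 + ‖Q‖ ^ 2)) with hT
  have hSp : 0 < S := by positivity
  have hTp : 0 < T := by positivity
  have h1 : T < l ^ 2 * S := by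
    rw [← Real.log_lt_log_iff hTp (by positivity), Real.log_mul (by positivity) hSp.ne', Real.log_pow, hl, Real.log_exp]
    push_cast; linarith
  have hl2 : l ^ 2 ≤ 1 := by nlinarith
  have h2 : ‖Q * w - P‖ ^ 2 < l ^ 2 * (‖P‖ ^ 2 + ‖Q‖ ^ 2) := by
    have : 0 ≤ s ^ (2 * k) * (‖P‖ ^ 2 + ‖Q‖ ^ 2) := by positivity
    rw [hT, hS] at h1
    nlinarith
  have h3 : ‖Q * w - P‖ < l * (‖P‖ + ‖Q‖) := by
    refine lt_of_pow_lt_pow_left₀ 2 (by positivity) (h2.trans_le ?_)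
    rw [mul_pow]
    gcongr
    nlinarith [norm_nonneg P, norm_nonneg Q]
  have h4 : ‖P‖ ≤ ‖Q‖ * R + ‖Q * w - P‖ := by
    calc ‖P‖ = ‖Q * w - (Q * w - P)‖ := by congr 1; ring
      _ ≤ ‖Q * w‖ + ‖Q * w - P‖ := norm_sub_le _ _
      _ ≤ _ := by rw [norm_mul]; gcongr
  have hR : 0 ≤ R := (norm_nonneg w).trans hw
  have h5 : ‖Q * w - P‖ < 2 * (1 + R) * l * ‖Q‖ := by
    nlinarith [norm_nonneg (Q * w - P)]
  have hQ : Q ≠ 0 := by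
    rintro rfl
    simp at h5
    have := norm_nonneg P
    linarith
  have h6 : Q * w - P = Q * (w - P / Q) := by field_simp
  rw [h6, norm_mul] at h5
  have := norm_pos_iff.mpr hQ
  nlinarith
end GraphEst

section GraphWit
set_option linter.unusedSimpArgs false
set_option linter.unusedVariables false
open Matrix MeasureTheory
open scoped ContDiff ComplexOrder
variable {n : ℕ}

theorem wit_of {E : Set (Fin n → ℂ)} {δ : ℝ} (h : ∀ Rad : ℝ, 0 ≤ Rad → ∃ C0, ∀ ε > 0, ∃ a b, Sp a ∧ Sp b ∧
    (∀ x ∈ closedBall (0 : Fin n → ℂ) Rad, |a x - b x| ≤ C0) ∧ (∀ x ∈ E, δ < a x - b x) ∧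
    (∀ x ∈ closedBall (0 : Fin n → ℂ) Rad, -ε ≤ a x - b x) ∧
    (∫ x in closedBall (0 : Fin n → ℂ) Rad, |a x - b x|) ≤ ε ∧
    (∫ x in closedBall (0 : Fin n → ℂ) Rad, |a x|) ≤ C0) : Wit E δ := by
  intro Rad
  obtain ⟨C0, hC⟩ := h (max Rad 0) (le_max_right _ _)
  have hsub : closedBall (0 : Fin n → ℂ) Rad ⊆ closedBall 0 (max Rad 0) := closedBall_subset_closedBall (le_max_left _ _)
  refine ⟨C0, fun ε hε => ?_⟩
  obtain ⟨a, b, ha, hb, h1, h2, h3, h4, h5⟩ := hC ε hε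
  refine ⟨a, b, ha, hb, fun x hx => h1 x (hsub hx), h2, fun x hx => h3 x (hsub hx), le_trans ?_ h4, le_trans ?_ h5⟩
  · exact setIntegral_mono_set (ci (ha.1.continuous.sub hb.1.continuous).abs _)
      (Eventually.of_forall fun x => abs_nonneg _) hsub.eventuallyLE
  · exact setIntegral_mono_set (ci ha.1.continuous.abs _)
      (Eventually.of_forall fun x => abs_nonneg _) hsub.eventuallyLE

def PB (k : ℕ) (e s : ℝ) (p q : MvPolynomial (Fin n) ℂ) (x : Fin (n+1) → ℂ) : ℝ :=
  (1 / (2 * k)) * Real.log (e + (‖MvPolynomial.eval x (MvPolynomial.rename Fin.succ q) * x 0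
    - MvPolynomial.eval x (MvPolynomial.rename Fin.succ p)‖ ^ 2 + s ^ (2 * k) *
    (‖MvPolynomial.eval x (MvPolynomial.rename Fin.succ p)‖ ^ 2 + ‖MvPolynomial.eval x (MvPolynomial.rename Fin.succ q)‖ ^ 2)))

theorem PB_sp (k : ℕ) {e s : ℝ} (he : 0 < e) (hs : 0 < s) (p q : MvPolynomial (Fin n) ℂ) : Sp (PB k e s p q) := by
  have h0 : ContDiff ℂ ∞ fun x : Fin (n+1) → ℂ => MvPolynomial.eval x (MvPolynomial.rename Fin.succ q) * x 0
    - MvPolynomial.eval x (MvPolynomial.rename Fin.succ p) :=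
    ((eval_cd _).mul (contDiff_apply ℂ ℂ 0)).sub (eval_cd _)
  refine (Lp.log ((Lp.const he.le).add ((Lp.holo h0).add
    (((Lp.holo (eval_cd _)).add (Lp.holo (eval_cd _))).smul (by positivity)))) fun x => by positivity).smul (by positivity)

theorem eval_succ (p : MvPolynomial (Fin n) ℂ) (x : Fin (n+1) → ℂ) :
    MvPolynomial.eval x (MvPolynomial.rename Fin.succ p) = MvPolynomial.eval (fun i => x i.succ) p := by
  rw [MvPolynomial.eval_rename]; rfl

theorem graph_wit {K : Set (Fin n → ℂ)} (hK : IsCompact K) {f : (Fin n → ℂ) → ℂ} {s : ℝ} (hs : 0 < s) (hs1 : s < 1)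
    (happ : ∀ k0 : ℕ, ∃ k ≥ k0, ∃ p q : MvPolynomial (Fin n) ℂ, p.totalDegree ≤ k ∧ q.totalDegree ≤ k ∧
      (∀ z ∈ K, MvPolynomial.eval z q ≠ 0) ∧
      ∀ z ∈ K, ‖f z - MvPolynomial.eval z p / MvPolynomial.eval z q‖ ≤ s ^ k) :
    Wit (coordE n '' {p : (Fin n → ℂ) × ℂ | ∃ z ∈ K, p = (z, f z)}) (Real.log (1 / s) / 2) := by
  refine wit_of fun R hR => ?_
  set L := Real.log (1 / s) with hL
  have hL0 : 0 < L := Real.log_pos (by rw [one_div]; exact (one_lt_inv₀ hs).mpr hs1)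
  set V := volume.real (closedBall (0 : Fin (n+1) → ℂ) R) with hV
  set V' := volume.real (closedBall (0 : Fin n → ℂ) R) with hV'
  have hV0 : 0 ≤ V := measureReal_nonneg
  have hV'0 : 0 ≤ V' := measureReal_nonneg
  set C1 := Real.log (R + 2) + 1 with hC1
  have hC10 : 0 ≤ C1 := by have := Real.log_nonneg (x := R + 2) (by linarith); linarith
  set C2 := 2 * C1 * volume.real (closedBall (0 : Fin (n+1) → ℂ) (R+1)) with hC2
  have hl2 : 0 ≤ Real.log (2 + R ^ 2) := Real.log_nonneg (by nlinarith)
  refine ⟨L + Real.log (2 + R ^ 2) + C2, fun ε hε => ?_⟩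
  have hC20 : 0 ≤ C2 := by positivity
  set η := ε / (2 * (V + 1)) with hη
  have hη0 : 0 < η := by positivity
  have hηε : η ≤ ε := by
    rw [hη, div_le_iff₀ (by positivity)]; nlinarith
  have hηV : η * V ≤ ε / 2 := by
    have : η * (V + 1) = ε / 2 := by rw [hη]; field_simp
    nlinarith
  -- choose k large
  have tk : Tendsto (fun k : ℕ => (k:ℝ)) atTop atTop := tendsto_natCast_atTop_atTop
  have tex : Tendsto (fun k : ℕ => Real.exp (-(k * η))) atTop (nhds 0) :=
    Real.tendsto_exp_neg_atTop_nhds_zero.comp (tk.atTop_mul_const hη0)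
  have tinv : ∀ c : ℝ, Tendsto (fun k : ℕ => c / (2 * (k:ℝ))) atTop (nhds 0) := fun c =>
    (tk.const_mul_atTop two_pos).const_div_atTop c
  have tL : Tendsto (fun k : ℕ => L * (V' * (Real.pi * (2 * (1 + R) * Real.exp (-(k * η))) ^ 2))) atTop (nhds 0) := by
    have := (((tex.const_mul (2 * (1 + R))).pow 2).const_mul Real.pi).const_mul V' |>.const_mul L
    simpa using this
  obtain ⟨k0, hk0⟩ := eventually_atTop.mp
    ((tex.eventually_le_const (show (0:ℝ) < 1/2 by norm_num)).and
    (((tinv (Real.log (2 + R ^ 2))).eventually_le_const hη0).and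
    (((tinv (Real.log 3)).eventually_lt_const (half_pos hL0)).and
    ((tL.eventually_le_const (half_pos hε)).and (eventually_gt_atTop 0)))))
  obtain ⟨k, hkk, p, q, hp, hq, hq0, hfa⟩ := happ k0
  obtain ⟨b1, b2, b3, b4, hk⟩ := hk0 k hkk
  have hkr : (1:ℝ) ≤ k := by exact_mod_cast hk
  -- choose e
  obtain ⟨e, he, heK⟩ : ∃ e > 0, ∀ z ∈ K, e ≤ s ^ (2 * k) * ‖MvPolynomial.eval z q‖ ^ 2 := by
    rcases K.eq_empty_or_nonempty with h | h
    · exact ⟨1, one_pos, by simp [h]⟩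
    · have hcq : Continuous fun z => s ^ (2 * k) * ‖MvPolynomial.eval z q‖ ^ 2 := by
        have := (eval_cd q).continuous
        fun_prop
      obtain ⟨z0, hz0, hmin⟩ := hK.exists_isMinOn h hcq.continuousOn
      refine ⟨_, ?_, fun z hz => hmin hz⟩
      have := norm_pos_iff.mpr (hq0 z0 hz0)
      positivity
  set p' := MvPolynomial.rename Fin.succ p with hp'
  set q' := MvPolynomial.rename Fin.succ q with hq'
  have hpd : p'.totalDegree ≤ k := (MvPolynomial.totalDegree_rename_le _ _).trans hp
  have hqd : q'.totalDegree ≤ k := (MvPolynomial.totalDegree_rename_le _ _).trans hq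
  obtain ⟨M, ⟨y, hy, hyM⟩, hM⟩ := PA_norm hk he hpd hqd
  have hab : ∀ x, (PA k e p' q' x + -M) - (PB k e s p q x + -M) = PA k e p' q' x - PB k e s p q x := fun x => by ring
  have ha : Sp fun x => PA k e p' q' x + -M := (PA_sp k he p' q').add (Sp.const _)
  have hb : Sp fun x => PB k e s p q x + -M := (PB_sp k he hs p q).add (Sp.const _)
  have hup : ∀ x, PA k e p' q' x - PB k e s p q x ≤ L := fun x =>
    est_up he hs hs1 (by positivity) (by positivity) hk
  have hlow : ∀ x ∈ closedBall (0 : Fin (n+1) → ℂ) R, -(Real.log (2 + R ^ 2) / (2 * k)) ≤ PA k e p' q' x - PB k e s p q x := by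
    intro x hx
    refine est_low hk (PS_pos he p' q' x) (by positivity) (by positivity) (est_T _ _ _ he hs hs1 ?_)
    exact (norm_le_pi_norm x 0).trans (by simpa using hx)
  have hd2 : Real.log (2 + R ^ 2) / (2 * k) ≤ Real.log (2 + R ^ 2) := div_le_self hl2 (by linarith)
  refine ⟨_, _, ha, hb, ?_, ?_, ?_, ?_, ?_⟩
  · intro x hx
    rw [hab, abs_le]
    have := hup x
    have := hlow x hx
    constructor <;> linarith
  · rintro _ ⟨_, ⟨z, hz, rfl⟩, rfl⟩
    rw [hab]
    have ez : (fun i : Fin n => coordE n (z, f z) i.succ) = z := by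
      funext i; rw [coordE_succ]
    have h1 := est_G (MvPolynomial.eval z p) (MvPolynomial.eval z q) (f z) hs (hq0 z hz) (hfa z hz) he (heK z hz)
    have h2 : -(Real.log (3 * s ^ (2 * k)) / (2 * k)) ≤ PA k e p' q' (coordE n (z, f z)) - PB k e s p q (coordE n (z, f z)) := by
      unfold PA PB PS
      rw [← hp', ← hq', hp', hq', eval_succ, eval_succ, ez, coordE_zero]
      exact est_low hk (by positivity) (by positivity) (by positivity) h1
    refine lt_of_lt_of_le ?_ h2
    rw [Real.log_mul (by norm_num) (by positivity), Real.log_pow, add_div]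
    push_cast
    rw [mul_div_cancel_left₀ (Real.log s) (show (2 * (k:ℝ)) ≠ 0 by positivity)]
    have : L = - Real.log s := by rw [hL, one_div, Real.log_inv]
    linarith
  · intro x hx
    rw [hab]
    linarith [hlow x hx]
  · simp only [hab]
    set g : (Fin n → ℂ) → ℂ := fun z => MvPolynomial.eval z p / MvPolynomial.eval z q with hg
    have hgm : Measurable g := (eval_cd p).continuous.measurable.div (eval_cd q).continuous.measurable
    set t := 2 * (1 + R) * Real.exp (-(k * η)) with ht
    have ht0 : 0 ≤ t := by positivity
    set S : Set (Fin (n+1) → ℂ) := {x : Fin (n+1) → ℂ | (fun i => x i.succ) ∈ closedBall (0 : Fin n → ℂ) R ∧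
      ‖x 0 - g (fun i => x i.succ)‖ < t} with hS
    have hSm : MeasurableSet S := by
      have m1 : Measurable fun x : Fin (n+1) → ℂ => fun i : Fin n => x i.succ := by fun_prop
      refine (m1 measurableSet_closedBall).inter ?_
      exact measurableSet_lt (((measurable_pi_apply 0).sub (hgm.comp m1)).norm) measurable_const
    have hSv := tube_meas hgm R t
    rw [← hS] at hSv
    have hfin : volume (closedBall (0 : Fin n → ℂ) R) * (ENNReal.ofReal t ^ 2 * NNReal.pi) ≠ ⊤ := by
      refine ENNReal.mul_ne_top (measure_closedBall_lt_top).ne (ENNReal.mul_ne_top (by simp) (by simp))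
    have hSr : volume.real S ≤ V' * (Real.pi * t ^ 2) := by
      have := ENNReal.toReal_mono hfin hSv
      rw [ENNReal.toReal_mul, ENNReal.toReal_mul, ENNReal.toReal_pow, ENNReal.toReal_ofReal ht0] at this
      rw [mul_comm Real.pi]
      exact this
    have hSfin : volume S ≠ ⊤ := (hSv.trans_lt hfin.lt_top).ne
    have hpt : ∀ x ∈ closedBall (0 : Fin (n+1) → ℂ) R, |PA k e p' q' x - PB k e s p q x| ≤ η + S.indicator (fun _ => L) x := by
      intro x hx
      have hxn : ‖x‖ ≤ R := by simpa using hx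
      have hind : 0 ≤ S.indicator (fun _ => L) x := Set.indicator_nonneg (fun _ _ => hL0.le) _
      rw [abs_le]
      refine ⟨by linarith [hlow x hx], ?_⟩
      by_cases hxη : PA k e p' q' x - PB k e s p q x ≤ η
      · linarith
      push Not at hxη
      have hxS : x ∈ S := by
        refine ⟨?_, ?_⟩
        · rw [mem_closedBall_zero_iff]
          exact (pi_norm_le_iff_of_nonneg hR).mpr fun i => (norm_le_pi_norm x i.succ).trans hxn
        · have := est_tube (MvPolynomial.eval x p') (MvPolynomial.eval x q') (x 0) he hs hk
            ((norm_le_pi_norm x 0).trans hxn) b1 hxη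
          rw [hp', hq', eval_succ, eval_succ] at this
          exact this
      rw [Set.indicator_of_mem hxS]
      linarith [hup x]
    have hInt : Integrable (S.indicator fun _ => L) (volume.restrict (closedBall (0 : Fin (n+1) → ℂ) R)) :=
      ((integrable_indicator_iff hSm).mpr (integrableOn_const hSfin)).restrict
    have hcab : Continuous fun x => |PA k e p' q' x - PB k e s p q x| :=
      ((PA_sp k he p' q').1.continuous.sub (PB_sp k he hs p q).1.continuous).abs
    have h1 := setIntegral_mono_on (ci hcab R) ((ci (continuous_const (y := η)) R).add hInt) measurableSet_closedBall hpt
    refine h1.trans ?_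
    simp only [Pi.add_apply]
    rw [integral_add (ci continuous_const R) hInt, setIntegral_const]
    have h2 : ∫ x in closedBall (0 : Fin (n+1) → ℂ) R, S.indicator (fun _ => L) x ≤ L * volume.real S := by
      rw [integral_indicator hSm, setIntegral_const, smul_eq_mul, mul_comm]
      gcongr
      exact ENNReal.toReal_mono hSfin (Measure.restrict_apply_le _ _)
    have h3 : L * volume.real S ≤ L * (V' * (Real.pi * t ^ 2)) := by gcongr
    rw [← hV, smul_eq_mul]
    linarith
  · refine (PA_L1 ha hy (by rw [hyM]; ring) hC10 fun x hx => ?_).trans (by linarith)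
    have := hM (R + 2) (by linarith) x hx
    linarith
end GraphWit

section Extract
set_option linter.unusedSimpArgs false
set_option linter.unusedVariables false
open Matrix MeasureTheory
variable {n : ℕ}

theorem rho_nonempty (f : (Fin n → ℂ) → ℂ) {K : Set (Fin n → ℂ)} {Mf : ℝ} (hM : ∀ z ∈ K, ‖f z‖ ≤ Mf) (k : ℕ) :
    Mf ∈ {t : ℝ | ∃ p q : MvPolynomial (Fin n) ℂ,
    p.totalDegree ≤ k ∧ q.totalDegree ≤ k ∧
    (∀ z ∈ K, MvPolynomial.eval z q ≠ 0) ∧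
    ∀ z ∈ K, ‖f z - MvPolynomial.eval z p / MvPolynomial.eval z q‖ ≤ t} :=
  ⟨0, 1, by simp, by simp, by simp, by simpa using hM⟩

theorem gonchar_extract {K : Set (Fin n → ℂ)} (hK : IsCompact K) (hne : K.Nonempty) {f : (Fin n → ℂ) → ℂ}
    (hf : ContinuousOn f K)
    (hG : Filter.liminf (fun k : ℕ => (rhoMv f K k) ^ (1 / (k : ℝ))) Filter.atTop < 1) :
    ∃ s : ℝ, 0 < s ∧ s < 1 ∧ ∀ k0 : ℕ, ∃ k ≥ k0, ∃ p q : MvPolynomial (Fin n) ℂ,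
      p.totalDegree ≤ k ∧ q.totalDegree ≤ k ∧
      (∀ z ∈ K, MvPolynomial.eval z q ≠ 0) ∧
      ∀ z ∈ K, ‖f z - MvPolynomial.eval z p / MvPolynomial.eval z q‖ ≤ s ^ k := by
  obtain ⟨z0, hz0⟩ := hne
  obtain ⟨M0, hM0⟩ := hK.exists_bound_of_continuousOn hf
  set Mf := max M0 1 with hMf
  have hM : ∀ z ∈ K, ‖f z‖ ≤ Mf := fun z hz => (hM0 z hz).trans (le_max_left _ _)
  have hM1 : 1 ≤ Mf := le_max_right _ _
  have hbdd : ∀ k, BddBelow {t : ℝ | ∃ p q : MvPolynomial (Fin n) ℂ,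
    p.totalDegree ≤ k ∧ q.totalDegree ≤ k ∧
    (∀ z ∈ K, MvPolynomial.eval z q ≠ 0) ∧
    ∀ z ∈ K, ‖f z - MvPolynomial.eval z p / MvPolynomial.eval z q‖ ≤ t} := by
    intro k
    refine ⟨0, ?_⟩
    rintro t ⟨p, q, _, _, _, h⟩
    exact (norm_nonneg _).trans (h z0 hz0)
  have hr0 : ∀ k, 0 ≤ rhoMv f K k := by
    intro k
    refine le_csInf ⟨_, rho_nonempty f hM k⟩ ?_
    rintro t ⟨p, q, _, _, _, h⟩
    exact (norm_nonneg _).trans (h z0 hz0)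
  have hrM : ∀ k, rhoMv f K k ≤ Mf := fun k => csInf_le (hbdd k) (rho_nonempty f hM k)
  have hle : ∀ k : ℕ, (rhoMv f K k) ^ (1 / (k : ℝ)) ≤ Mf := by
    intro k
    calc (rhoMv f K k) ^ (1 / (k : ℝ)) ≤ Mf ^ (1 / (k : ℝ)) := Real.rpow_le_rpow (hr0 k) (hrM k) (by positivity)
      _ ≤ Mf ^ (1:ℝ) := by
        refine Real.rpow_le_rpow_of_exponent_le hM1 ?_
        rcases Nat.eq_zero_or_pos k with h | h
        · simp [h]
        · rw [div_le_one (by exact_mod_cast h)]; exact_mod_cast h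
      _ = Mf := Real.rpow_one _
  obtain ⟨s0, h1, h2⟩ := exists_between hG
  set s := max s0 (1/2) with hs
  have hs0 : 0 < s := lt_of_lt_of_le (by norm_num) (le_max_right _ _)
  have hs1 : s < 1 := max_lt h2 (by norm_num)
  have hlt : Filter.liminf (fun k : ℕ => (rhoMv f K k) ^ (1 / (k : ℝ))) Filter.atTop < s :=
    h1.trans_le (le_max_left _ _)
  have hco : Filter.IsCoboundedUnder (· ≥ ·) Filter.atTop (fun k : ℕ => (rhoMv f K k) ^ (1 / (k : ℝ))) := by
    refine Filter.IsBoundedUnder.isCoboundedUnder_ge ?_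
    exact ⟨Mf, Filter.eventually_map.mpr (Filter.Eventually.of_forall hle)⟩
  have hfr := Filter.frequently_lt_of_liminf_lt hco hlt
  refine ⟨s, hs0, hs1, fun k0 => ?_⟩
  obtain ⟨k, hk, hks⟩ := (Filter.frequently_atTop.mp hfr) (max k0 1)
  have hk1 : 1 ≤ k := (le_max_right _ _).trans hk
  have hkr : (k:ℝ) ≠ 0 := by positivity
  have hlt2 : rhoMv f K k < s ^ k := by
    have h3 := pow_lt_pow_left₀ hks (Real.rpow_nonneg (hr0 k) _) (by omega : k ≠ 0)
    rwa [← Real.rpow_natCast, ← Real.rpow_mul (hr0 k), one_div, inv_mul_cancel₀ hkr, Real.rpow_one] at h3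
  obtain ⟨t, ⟨p, q, a1, a2, a3, a4⟩, ht⟩ := exists_lt_of_csInf_lt ⟨_, rho_nonempty f hM k⟩ hlt2
  exact ⟨k, (le_max_left _ _).trans hk, p, q, a1, a2, a3, fun z hz => (a4 z hz).trans ht.le⟩
end Extract

theorem graph_pluripolar_of_gonchar_compact {n : ℕ} (K : Set (Fin n → ℂ))
    (hK : IsCompact K) (f : (Fin n → ℂ) → ℂ) (hf : ContinuousOn f K)
    (hGonchar : Filter.liminf (fun k : ℕ => (rhoMv f K k) ^ (1 / (k : ℝ)))
      Filter.atTop < 1) :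
    Pluripolar {p : (Fin n → ℂ) × ℂ | ∃ z ∈ K, p = (z, f z)} := by
  have hset : {p : (Fin n → ℂ) × ℂ | ∃ z ∈ K, p = (z, f z)} = (fun z => (z, f z)) '' K := by
    ext p
    constructor
    · rintro ⟨z, hz, rfl⟩; exact ⟨z, hz, rfl⟩
    · rintro ⟨z, hz, rfl⟩; exact ⟨z, hz, rfl⟩
  have hGc : IsCompact {p : (Fin n → ℂ) × ℂ | ∃ z ∈ K, p = (z, f z)} := by
    rw [hset]; exact hK.image_of_continuousOn (continuousOn_id.prodMk hf)
  have hexs : ∃ s : ℝ, 0 < s ∧ s < 1 ∧ ∀ k0 : ℕ, ∃ k ≥ k0, ∃ p q : MvPolynomial (Fin n) ℂ,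
      p.totalDegree ≤ k ∧ q.totalDegree ≤ k ∧
      (∀ z ∈ K, MvPolynomial.eval z q ≠ 0) ∧
      ∀ z ∈ K, ‖f z - MvPolynomial.eval z p / MvPolynomial.eval z q‖ ≤ s ^ k := by
    rcases K.eq_empty_or_nonempty with h | h
    · refine ⟨1/2, by norm_num, by norm_num, fun k0 => ⟨k0, le_rfl, 0, 1, by simp, by simp, ?_, ?_⟩⟩ <;> simp [h]
    · exact gonchar_extract hK h hf hGonchar
  obtain ⟨s, hs, hs1, happ⟩ := hexs
  refine pluripolar_of_wit hGc ?_ (graph_wit hK hs hs1 happ)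
  have : 0 < Real.log (1 / s) := Real.log_pos (by rw [one_div]; exact (one_lt_inv₀ hs).mpr hs1)
  linarith
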